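/- Fix r ∈ ℕ with r > 2 and suppose (a,b,c) satisfies the parabolicity–regularity assumption with respect to some ρ ≥ 3r. Then for each n ∈ ℕ there exist a family of translation-invariant kernels (K_n^w)_{w∈ℝ^{1+d}} belonging to C^r(Φ_r^2) ∩ Λ_r and a kernel R_n ∈ Ψ_r^r such that (Z*(−E)^{*n})(z,z̄) = K_n^{z̄}(z−z̄) + R_n(z,z̄) for all z, z̄ ∈ ℝ^{1+d}. Moreover the maps A_ρ ∋ (a,b,c) ↦ K_n and A_ρ ∋ (a,b,c) ↦ R_n are continuous into the respective spaces. -/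

import Mathlib

open MeasureTheory Filter
open scoped BigOperators ENNReal

namespace VarBPHZ

/-! ## Basic parabolic setting on `ℝ^{1+d}` -/

/-- A space-time point in `ℝ^{1+d}`; coordinate `0` is time, coordinates `1, …, d` are space. -/
abbrev Pt (d : ℕ) := Fin (d + 1) → ℝ

variable {d : ℕ}

/-- Parabolic scaled degree `|k|_𝔰 = 2k₀ + k₁ + ⋯ + k_d` of a multi-index. -/
def pdeg (k : Fin (d + 1) → ℕ) : ℕ := k 0 + ∑ i, k i

/-- Parabolic norm `|z|_𝔰 = |t|^{1/2} + ∑ᵢ |xᵢ|`. -/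
noncomputable def pnorm (z : Pt d) : ℝ := Real.sqrt |z 0| + ∑ i : Fin d, |z i.succ|

/-- First-order partial derivative in the `i`-th coordinate. -/
noncomputable def pd (i : Fin (d + 1)) (f : Pt d → ℝ) : Pt d → ℝ :=
  fun z => fderiv ℝ f z (Pi.single i 1)

/-- Iterated partial derivative `∂^k` for a multi-index `k`. -/
noncomputable def mderiv (k : Fin (d + 1) → ℕ) (f : Pt d → ℝ) : Pt d → ℝ :=
  (List.finRange (d + 1)).foldr (fun i g => (pd i)^[k i] g) f

/-- Mixed partial derivative `∂₁^j ∂₂^m` of a two-argument kernel. -/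
noncomputable def mderiv2 (j m : Fin (d + 1) → ℕ) (F : Pt d → Pt d → ℝ) :
    Pt d → Pt d → ℝ :=
  fun z zb => mderiv j (fun z' => mderiv m (F z') zb) z

/-- Space-time convolution `u * v (z, z̄) = ∫ u(z, ζ) v(ζ, z̄) dζ`. -/
noncomputable def conv (u v : Pt d → Pt d → ℝ) : Pt d → Pt d → ℝ :=
  fun z zb => ∫ ζ : Pt d, u z ζ * v ζ zb

/-! ## The heat calculus spaces `Ψ_r^α` and `Φ_r^α` -/

/-- `Ft` is an `F̃`-representation of `F` for the space `Ψ_r^α`; the second argument of `Ft`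
packs `(u, v) ∈ ℝ × ℝ^d` as an element of `ℝ^{1+d}`. -/
def PsiRep (α : ℝ) (Ft : Pt d → Pt d → ℝ) (F : Pt d → Pt d → ℝ) : Prop :=
  ∀ z zb : Pt d, F z zb =
    if zb 0 < z 0 then
      (z 0 - zb 0) ^ ((α - d - 2) / 2) *
        Ft zb (Fin.cons (Real.sqrt (z 0 - zb 0))
          fun i : Fin d => (z i.succ - zb i.succ) / Real.sqrt (z 0 - zb 0))
    else 0

/-- Existence (and continuity) of the derivatives of `F̃` entering the `Ψ_r^α` seminorms:
derivatives are counted parabolically in the first slot and by total order in the second. -/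
def PsiSmooth (r : ℕ) (Ft : Pt d → Pt d → ℝ) : Prop :=
  (∀ j m : Fin (d + 1) → ℕ, pdeg j + ∑ i, m i < r →
    Differentiable ℝ fun p : Pt d × Pt d => mderiv2 j m Ft p.1 p.2) ∧
  ∀ j m : Fin (d + 1) → ℕ, pdeg j + ∑ i, m i ≤ r →
    Continuous fun p : Pt d × Pt d => mderiv2 j m Ft p.1 p.2

/-- The set of numbers of which the `Ψ_r^α` seminorm `‖·‖_{α,r;T,n}` of a representation
`Ft` is the supremum. -/
def psiSet (r : ℕ) (T : ℝ) (n : ℕ) (Ft : Pt d → Pt d → ℝ) : Set ℝ :=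
  {y | ∃ (j m : Fin (d + 1) → ℕ) (w uv : Pt d),
    pdeg j + ∑ i, m i ≤ r ∧ 0 ≤ uv 0 ∧ uv 0 ≤ Real.sqrt T ∧
    y = (1 + Real.sqrt (∑ i : Fin d, uv i.succ ^ 2)) ^ n * |mderiv2 j m Ft w uv|}

/-- Membership in the heat-calculus space `Ψ_r^α`. -/
def MemPsi (α : ℝ) (r : ℕ) (F : Pt d → Pt d → ℝ) : Prop :=
  ∃ Ft, PsiRep α Ft F ∧ PsiSmooth r Ft ∧
    ∀ T : ℝ, 0 < T → ∀ n : ℕ, BddAbove (psiSet r T n Ft)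

/-- The `Ψ_r^α` seminorm `‖F‖_{α,r;T,n}` of a kernel `F`. -/
noncomputable def psiNorm (α : ℝ) (r : ℕ) (T : ℝ) (n : ℕ) (F : Pt d → Pt d → ℝ) : ℝ :=
  sInf {y | ∃ Ft, PsiRep α Ft F ∧ PsiSmooth r Ft ∧ BddAbove (psiSet r T n Ft) ∧
    y = sSup (psiSet r T n Ft)}

/-- Translation invariance of a two-argument kernel. -/
def TransInv (F : Pt d → Pt d → ℝ) : Prop := ∀ z zb h : Pt d, F (z + h) (zb + h) = F z zb

/-- Membership in `Φ_r^α`, the translation-invariant part of `Ψ_r^α`. -/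
def MemPhi (α : ℝ) (r : ℕ) (F : Pt d → Pt d → ℝ) : Prop := MemPsi α r F ∧ TransInv F

/-- `∂_w^m` of a family of kernels depending on a parameter `w`. -/
noncomputable def famDeriv (m : Fin (d + 1) → ℕ) (F : Pt d → Pt d → Pt d → ℝ) :
    Pt d → Pt d → Pt d → ℝ :=
  fun w z zb => mderiv m (fun w' => F w' z zb) w

/-- Membership in `C^m(Ψ_r^α)` for a family of kernels. -/
def MemCPsi (m : ℕ) (α : ℝ) (r : ℕ) (F : Pt d → Pt d → Pt d → ℝ) : Prop :=
  (∀ m' : Fin (d + 1) → ℕ, pdeg m' < m → ∀ z zb : Pt d,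
    Differentiable ℝ fun w => famDeriv m' F w z zb) ∧
  (∀ m' : Fin (d + 1) → ℕ, pdeg m' ≤ m → ∀ w : Pt d, MemPsi α r (famDeriv m' F w)) ∧
  ∀ T : ℝ, 0 < T → ∀ n : ℕ,
    BddAbove {y | ∃ (m' : Fin (d + 1) → ℕ) (w : Pt d), pdeg m' ≤ m ∧
      y = psiNorm α r T n (famDeriv m' F w)}

/-- The `C^m(Ψ_r^α)` seminorm `sup_w max_{|m'|_𝔰 ≤ m} ‖∂_w^{m'} F_w‖_{α,r;T,n}`. -/
noncomputable def cpsiNorm (m : ℕ) (α : ℝ) (r : ℕ) (T : ℝ) (n : ℕ)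
    (F : Pt d → Pt d → Pt d → ℝ) : ℝ :=
  sSup {y | ∃ (m' : Fin (d + 1) → ℕ) (w : Pt d), pdeg m' ≤ m ∧
    y = psiNorm α r T n (famDeriv m' F w)}

/-- Membership in `C^m(Φ_r^α)`. -/
def MemCPhi (m : ℕ) (α : ℝ) (r : ℕ) (F : Pt d → Pt d → Pt d → ℝ) : Prop :=
  MemCPsi m α r F ∧ ∀ w, TransInv (F w)

/-- The Beta function `B(a,b) = ∫₀¹ (1−s)^{a−1} s^{b−1} ds`. -/
noncomputable def betaFn (a b : ℝ) : ℝ := ∫ s in (0 : ℝ)..1, (1 - s) ^ (a - 1) * s ^ (b - 1)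

/-! ## Coefficient fields, the parabolicity–regularity assumption, `Z`, `E` and `Γ` -/

/-- Membership in the parabolic space `C^ρ`: all parabolic derivatives of order `≤ ρ`
exist, are continuous and bounded. -/
def MemCpar (ρ : ℕ) (f : Pt d → ℝ) : Prop :=
  (∀ k : Fin (d + 1) → ℕ, pdeg k < ρ → Differentiable ℝ (mderiv k f)) ∧
  ∀ k : Fin (d + 1) → ℕ, pdeg k ≤ ρ →
    Continuous (mderiv k f) ∧ ∃ M : ℝ, ∀ z, |mderiv k f z| ≤ M

/-- The `C^ρ` norm `max_{|k|_𝔰 ≤ ρ} sup |∂^k f|`. -/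
noncomputable def cparNorm (ρ : ℕ) (f : Pt d → ℝ) : ℝ :=
  sSup {y | ∃ (k : Fin (d + 1) → ℕ) (z : Pt d), pdeg k ≤ ρ ∧ y = |mderiv k f z|}

/-- A triple of coefficient fields `(a, b, c)`. -/
structure Coeffs (d : ℕ) where
  a : Pt d → Matrix (Fin d) (Fin d) ℝ
  b : Pt d → Fin d → ℝ
  c : Pt d → ℝ

/-- The parabolicity–regularity assumption, with ellipticity constant `lam` and
regularity exponent `ρ`. -/
structure ParReg (lam : ℝ) (ρ : ℕ) (A : Coeffs d) : Prop where
  symm : ∀ z, (A.a z).IsSymm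
  lower : ∀ (z : Pt d) (ζ : Fin d → ℝ), lam * ∑ i, ζ i ^ 2 ≤ ∑ i, ∑ j, A.a z i j * ζ i * ζ j
  upper : ∀ (z : Pt d) (ζ : Fin d → ℝ), ∑ i, ∑ j, A.a z i j * ζ i * ζ j ≤ lam⁻¹ * ∑ i, ζ i ^ 2
  areg : ∀ i j, MemCpar ρ fun z => A.a z i j
  breg : ∀ i, MemCpar ρ fun z => A.b z i
  creg : MemCpar ρ A.c

/-- The norm `‖(a,b,c)‖_ρ` on coefficient triples. -/
noncomputable def coeffNorm (ρ : ℕ) (A : Coeffs d) : ℝ :=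
  sSup {y | ∃ i j, y = cparNorm ρ fun z => A.a z i j} +
    sSup {y | ∃ i, y = cparNorm ρ fun z => A.b z i} + cparNorm ρ A.c

/-- Difference of two coefficient triples. -/
def coeffSub (A B : Coeffs d) : Coeffs d where
  a := fun z => A.a z - B.a z
  b := fun z => A.b z - B.b z
  c := fun z => A.c z - B.c z

/-- The distance on the space `𝐀_ρ` of coefficient fields. -/
noncomputable def coeffDist (ρ : ℕ) (A B : Coeffs d) : ℝ := coeffNorm ρ (coeffSub A B)

/-- The constant-coefficient heat kernel `W^w` with coefficients frozen at `w`. -/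
noncomputable def Wker (A : Coeffs d) (w : Pt d) (z : Pt d) : ℝ :=
  if 0 < z 0 then
    (4 * Real.pi) ^ (-(d : ℝ) / 2) * (A.a w).det ^ (-(1 : ℝ) / 2) * z 0 ^ (-(d : ℝ) / 2) *
      Real.exp (-(∑ i, ∑ j, (A.a w)⁻¹ i j * z i.succ * z j.succ) / (4 * z 0))
  else 0

/-- `Z(z, z̄) = W^{z̄}(z − z̄)`. -/
noncomputable def Zker (A : Coeffs d) : Pt d → Pt d → ℝ := fun z zb => Wker A zb (z - zb)

/-- `∂ᵢ Z`, derivative in the `i`-th spatial coordinate of the first argument. -/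
noncomputable def ZkerD (A : Coeffs d) (i : Fin d) : Pt d → Pt d → ℝ :=
  fun z zb => pd i.succ (fun y => Zker A y zb) z

/-- `∂ᵢ ∂ⱼ Z`. -/
noncomputable def ZkerDD (A : Coeffs d) (i j : Fin d) : Pt d → Pt d → ℝ :=
  fun z zb => pd i.succ (fun y => pd j.succ (fun y' => Zker A y' zb) y) z

/-- The kernel `E = LZ` away from the diagonal. -/
noncomputable def Eker (A : Coeffs d) : Pt d → Pt d → ℝ := fun z zb =>
  (∑ i, ∑ j, (A.a zb i j - A.a z i j) * ZkerDD A i j z zb) -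
    (∑ i, A.b z i * ZkerD A i z zb) - A.c z * Zker A z zb

/-- The `k`-th term `Z * (−E)^{*k}` of the Volterra series. -/
noncomputable def volterra (A : Coeffs d) : ℕ → (Pt d → Pt d → ℝ)
  | 0 => Zker A
  | k + 1 => conv (volterra A k) fun z zb => -Eker A z zb

/-- The heat kernel `Γ`, defined as the sum of the Volterra series. -/
noncomputable def GammaKer (A : Coeffs d) : Pt d → Pt d → ℝ :=
  fun z zb => ∑' k, volterra A k z zb

/-! ## The classes `Λ_r` of local families of translation-invariant kernels -/

/-- Names for the entries of the coefficient fields `a`, `a⁻¹`, `b`, `c`. -/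
inductive CoeffVar (d : ℕ) where
  | aa : Fin d → Fin d → CoeffVar d
  | ai : Fin d → Fin d → CoeffVar d
  | bb : Fin d → CoeffVar d
  | cc : CoeffVar d
deriving DecidableEq

/-- Evaluation of a formal variable `∂^l (entry)` of the coefficient field at `w`. -/
noncomputable def coeffEval (A : Coeffs d) (w : Pt d) :
    (Fin (d + 1) → ℕ) × CoeffVar d → ℝ
  | (l, CoeffVar.aa i j) => mderiv l (fun z => A.a z i j) w
  | (l, CoeffVar.ai i j) => mderiv l (fun z => (A.a z)⁻¹ i j) w
  | (l, CoeffVar.bb i) => mderiv l (fun z => A.b z i) w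
  | (l, CoeffVar.cc) => mderiv l A.c w

/-- The rational kernel `P(t,x) = t^{-1/2} Q(t^{1/2}, t^{-1/2} x)` attached to a
polynomial `Q`, extended by `0` to `t ≤ 0`. -/
noncomputable def ratKer (Q : MvPolynomial (Fin (d + 1)) ℝ) (z : Pt d) : ℝ :=
  if 0 < z 0 then
    (Real.sqrt (z 0))⁻¹ *
      MvPolynomial.eval
        (Fin.cons (Real.sqrt (z 0)) fun i : Fin d => z i.succ / Real.sqrt (z 0)) Q
  else 0

/-- The chain of differences `y_i − y_{i+1}` with `y_0 = ζ` and `y_{N+1} = 0`. -/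
noncomputable def chainDiff {N : ℕ} (ζ : Pt d) (y : Fin N → Pt d) (i : Fin (N + 1)) : Pt d :=
  (Fin.cons ζ (Fin.snoc y 0) : Fin (N + 2) → Pt d) i.castSucc -
    (Fin.cons ζ (Fin.snoc y 0) : Fin (N + 2) → Pt d) i.succ

/-- A single building block of the class `Λ_r`:
`K^w(ζ) = F(w) ∫ dy₁ ⋯ dy_N ∏ᵢ P^{[i]}(yᵢ − yᵢ₊₁) W^w(yᵢ − yᵢ₊₁)`. -/
noncomputable def lambdaAtom (A : Coeffs d)
    (p : MvPolynomial ((Fin (d + 1) → ℕ) × CoeffVar d) ℝ) (N : ℕ)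
    (Q : Fin (N + 1) → MvPolynomial (Fin (d + 1)) ℝ) (w ζ : Pt d) : ℝ :=
  MvPolynomial.eval (coeffEval A w) p *
    ∫ y : Fin N → Pt d, ∏ i : Fin (N + 1),
      (ratKer (Q i) (chainDiff ζ y i) * Wker A w (chainDiff ζ y i))

/-- Membership in `Λ_r`: finite linear combinations of the building blocks, where the
polynomial prefactor only involves derivatives `∂^l` of the coefficients with `|l|_𝔰 ≤ r`. -/
def MemLambda (A : Coeffs d) (r : ℕ) (K : Pt d → Pt d → ℝ) : Prop :=
  ∃ (M : ℕ) (p : Fin M → MvPolynomial ((Fin (d + 1) → ℕ) × CoeffVar d) ℝ)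
    (N : Fin M → ℕ) (Q : (m : Fin M) → Fin (N m + 1) → MvPolynomial (Fin (d + 1)) ℝ),
    (∀ m : Fin M, ∀ mo ∈ (p m).support, ∀ v ∈ mo.support, pdeg v.1 ≤ r) ∧
    ∀ w ζ : Pt d, K w ζ = ∑ m, lambdaAtom A (p m) (N m) (Q m) w ζ

set_option linter.unusedSectionVars false
set_option linter.unusedSimpArgs false
set_option linter.unnecessarySimpa false

/-! ## Part 1: a calculus of smooth weighted families -/

structure Idx (𝒜 : Type*) where
  N : 𝒜 → ℝ
  δ : 𝒜 → 𝒜 → ℝ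
  δ_nonneg : ∀ A B, 0 ≤ δ A B

structure Wt (E Ω : Type*) [TopologicalSpace E] where
  G : E → Ω → ℝ
  H : E → Ω → ℝ
  one_le : ∀ p ω, 1 ≤ G p ω
  H_nonneg : ∀ p ω, 0 ≤ H p ω
  G_cont : ∀ ω, Continuous fun p => G p ω

section goodcalc
variable {𝒜 E Ω : Type*} [NormedAddCommGroup E] [NormedSpace ℝ E] [MeasurableSpace Ω]

/-- the weight -/
noncomputable def Wt.wt (W : Wt E Ω) (ε : ℝ) (k : ℕ) (p : E) (ω : Ω) : ℝ :=
  W.G p ω ^ k * Real.exp (-(ε * W.H p ω))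

lemma Wt.wt_nonneg (W : Wt E Ω) (ε : ℝ) (k : ℕ) (p : E) (ω : Ω) : 0 ≤ W.wt ε k p ω := by
  have := W.one_le p ω
  unfold Wt.wt; positivity

lemma Wt.wt_mono (W : Wt E Ω) {ε ε' : ℝ} (h : ε' ≤ ε) {k l : ℕ} (hkl : k ≤ l) (p : E) (ω : Ω) :
    W.wt ε k p ω ≤ W.wt ε' l p ω := by
  have h1 := W.one_le p ω
  have h2 := W.H_nonneg p ω
  unfold Wt.wt
  gcongr

lemma Wt.wt_mul (W : Wt E Ω) (ε ε' : ℝ) (k l : ℕ) (p : E) (ω : Ω) :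
    W.wt ε k p ω * W.wt ε' l p ω = W.wt (ε + ε') (k + l) p ω := by
  unfold Wt.wt
  rw [pow_add, show -((ε + ε') * W.H p ω) = -(ε * W.H p ω) + -(ε' * W.H p ω) by ring, Real.exp_add]
  ring

def Bdd (I : Idx 𝒜) (W : Wt E Ω) (ε : ℝ) (f : 𝒜 → E → Ω → ℝ) : Prop :=
  ∀ M : ℝ, ∃ (C : ℝ) (k : ℕ), 0 ≤ C ∧ ∀ A B, I.N A ≤ M → I.N B ≤ M → ∀ p ω,
    |f A p ω| ≤ C * W.wt ε k p ω ∧ |f A p ω - f B p ω| ≤ C * I.δ A B * W.wt ε k p ω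

structure Base (I : Idx 𝒜) (W : Wt E Ω) (ε : ℝ) (f : 𝒜 → E → Ω → ℝ) : Prop where
  bdd : Bdd I W ε f
  cont : ∀ A ω, Continuous fun p => f A p ω
  meas : ∀ A p, Measurable (f A p)

noncomputable def dirD (e : E) (f : 𝒜 → E → Ω → ℝ) : 𝒜 → E → Ω → ℝ :=
  fun A p ω => fderiv ℝ (fun q => f A q ω) p e

def Good (I : Idx 𝒜) (W : Wt E Ω) (ε : ℝ) : ℕ → (𝒜 → E → Ω → ℝ) → Prop
  | 0, f => Base I W ε f
  | r + 1, f => Base I W ε f ∧ (∀ A ω, Differentiable ℝ fun p => f A p ω) ∧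
      ∀ e : E, Good I W ε r (dirD e f)

variable {I : Idx 𝒜} {W : Wt E Ω} {ε ε' : ℝ} {r : ℕ} {f g : 𝒜 → E → Ω → ℝ}

lemma Good.base (h : Good I W ε r f) : Base I W ε f := by
  cases r with
  | zero => exact h
  | succ r => exact h.1

lemma Good.of_succ (h : Good I W ε (r+1) f) : Good I W ε r f := by
  induction r generalizing f with
  | zero => exact h.1
  | succ r ih => exact ⟨h.1, h.2.1, fun e => ih (h.2.2 e)⟩

lemma Good.of_le {r' : ℕ} (h : Good I W ε r f) (hr : r' ≤ r) : Good I W ε r' f := by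
  induction r with
  | zero => obtain rfl : r' = 0 := by omega
            exact h
  | succ r ih =>
    rcases Nat.lt_or_ge r r' with h1 | h1
    · obtain rfl : r' = r + 1 := by omega
      exact h
    · exact ih h.of_succ h1

lemma Base.mono_eps (h : Base I W ε f) (hε : ε' ≤ ε) : Base I W ε' f := by
  refine ⟨fun M => ?_, h.cont, h.meas⟩
  obtain ⟨C, k, hC, hb⟩ := h.bdd M
  refine ⟨C, k, hC, fun A B hA hB p ω => ?_⟩
  have := hb A B hA hB p ω
  have hw := W.wt_mono hε (le_refl k) p ω
  have hδ := I.δ_nonneg A B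
  exact ⟨this.1.trans (by gcongr), this.2.trans (by gcongr)⟩

lemma Good.mono_eps (h : Good I W ε r f) (hε : ε' ≤ ε) : Good I W ε' r f := by
  induction r generalizing f with
  | zero => exact Base.mono_eps h hε
  | succ r ih => exact ⟨h.1.mono_eps hε, h.2.1, fun e => ih (h.2.2 e)⟩

lemma Base.zero : Base I W ε (fun _ _ _ => 0) :=
  ⟨fun M => ⟨0, 0, le_rfl, fun A B _ _ p ω => by simp⟩, fun _ _ => continuous_const,
    fun _ _ => measurable_const⟩

lemma Good.zero : Good I W ε r (fun _ _ _ => 0) := by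
  induction r with
  | zero => exact Base.zero
  | succ r ih =>
    refine ⟨Base.zero, fun _ _ => differentiable_const _, fun e => ?_⟩
    convert ih using 1
    funext A p ω; simp [dirD]

/-- functions independent of `p` -/
lemma Good.param {h : 𝒜 → Ω → ℝ} (hb : Base I W ε (fun A _ ω => h A ω)) :
    Good I W ε r (fun A _ ω => h A ω) := by
  cases r with
  | zero => exact hb
  | succ r =>
    refine ⟨hb, fun _ _ => differentiable_const _, fun e => ?_⟩
    convert Good.zero (r := r) using 1
    funext A p ω; simp [dirD]

lemma Base.omega {h : Ω → ℝ} (hm : Measurable h) {C : ℝ} {k : ℕ} (hC : 0 ≤ C)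
    (hb : ∀ p ω, |h ω| ≤ C * W.G p ω ^ k) : Base I W 0 (fun _ _ ω => h ω) := by
  refine ⟨fun M => ⟨C, k, hC, fun A B _ _ p ω => ⟨?_, ?_⟩⟩, fun _ _ => continuous_const, fun _ _ => hm⟩
  · simpa [Wt.wt] using hb p ω
  · have := W.wt_nonneg 0 k p ω
    have hδ := I.δ_nonneg A B
    simp only [sub_self, abs_zero]; positivity

lemma Good.omega {h : Ω → ℝ} (hm : Measurable h) {C : ℝ} {k : ℕ} (hC : 0 ≤ C)
    (hb : ∀ p ω, |h ω| ≤ C * W.G p ω ^ k) : Good I W 0 r (fun _ _ ω => h ω) :=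
  Good.param (Base.omega hm hC hb)

lemma Good.const (c : ℝ) : Good I W 0 r (fun _ _ _ => c) :=
  Good.omega (k := 0) measurable_const (abs_nonneg c) (by simp)

lemma Good.linear (ℓ : E →L[ℝ] ℝ) {C : ℝ} {k : ℕ} (hC : 0 ≤ C)
    (hb : ∀ p ω, |ℓ p| ≤ C * W.G p ω ^ k) : Good I W 0 r (fun _ p _ => ℓ p) := by
  have hB : Base I W 0 (fun _ p _ => ℓ p) := by
    refine ⟨fun M => ⟨C, k, hC, fun A B _ _ p ω => ⟨?_, ?_⟩⟩, fun _ _ => ℓ.continuous,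
      fun _ _ => measurable_const⟩
    · simpa [Wt.wt] using hb p ω
    · have := W.wt_nonneg 0 k p ω
      have hδ := I.δ_nonneg A B
      simp only [sub_self, abs_zero]; positivity
  cases r with
  | zero => exact hB
  | succ r =>
    refine ⟨hB, fun _ _ => ℓ.differentiable, fun e => ?_⟩
    convert Good.const (I := I) (W := W) (r := r) (ℓ e) using 1
    funext A p ω; simp [dirD]

lemma Base.add (hf : Base I W ε f) (hg : Base I W ε g) :
    Base I W ε (fun A p ω => f A p ω + g A p ω) := by
  refine ⟨fun M => ?_, fun A ω => (hf.cont A ω).add (hg.cont A ω),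
    fun A p => (hf.meas A p).add (hg.meas A p)⟩
  obtain ⟨C, k, hC, hb⟩ := hf.bdd M
  obtain ⟨C', k', hC', hb'⟩ := hg.bdd M
  refine ⟨C + C', k + k', by positivity, fun A B hA hB p ω => ?_⟩
  have h1 := hb A B hA hB p ω
  have h2 := hb' A B hA hB p ω
  have hw := W.wt_mono (le_refl ε) (Nat.le_add_right k k') p ω
  have hw' := W.wt_mono (le_refl ε) (Nat.le_add_left k' k) p ω
  have hδ := I.δ_nonneg A B
  constructor
  · calc _ ≤ |f A p ω| + |g A p ω| := abs_add_le _ _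
      _ ≤ C * W.wt ε k p ω + C' * W.wt ε k' p ω := add_le_add h1.1 h2.1
      _ ≤ C * W.wt ε (k+k') p ω + C' * W.wt ε (k+k') p ω := by gcongr
      _ = _ := by ring
  · calc |f A p ω + g A p ω - (f B p ω + g B p ω)|
        = |(f A p ω - f B p ω) + (g A p ω - g B p ω)| := by ring_nf
      _ ≤ |f A p ω - f B p ω| + |g A p ω - g B p ω| := abs_add_le _ _
      _ ≤ C * I.δ A B * W.wt ε k p ω + C' * I.δ A B * W.wt ε k' p ω := add_le_add h1.2 h2.2
      _ ≤ C * I.δ A B * W.wt ε (k+k') p ω + C' * I.δ A B * W.wt ε (k+k') p ω := by gcongr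
      _ = _ := by ring

lemma Good.add (hf : Good I W ε r f) (hg : Good I W ε r g) :
    Good I W ε r (fun A p ω => f A p ω + g A p ω) := by
  induction r generalizing f g with
  | zero => exact Base.add hf hg
  | succ r ih =>
    refine ⟨hf.1.add hg.1, fun A ω => (hf.2.1 A ω).add (hg.2.1 A ω), fun e => ?_⟩
    convert ih (hf.2.2 e) (hg.2.2 e) using 1
    funext A p ω
    simp only [dirD]
    rw [fderiv_fun_add (hf.2.1 A ω p) (hg.2.1 A ω p)]; rfl

lemma Base.mul (hf : Base I W ε f) (hg : Base I W ε' g) :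
    Base I W (ε + ε') (fun A p ω => f A p ω * g A p ω) := by
  refine ⟨fun M => ?_, fun A ω => (hf.cont A ω).mul (hg.cont A ω),
    fun A p => (hf.meas A p).mul (hg.meas A p)⟩
  obtain ⟨C, k, hC, hb⟩ := hf.bdd M
  obtain ⟨C', k', hC', hb'⟩ := hg.bdd M
  refine ⟨2 * (C * C'), k + k', by positivity, fun A B hA hB p ω => ?_⟩
  have h1 := hb A B hA hB p ω
  have h2 := hb' A B hA hB p ω
  have h3 := hb' B B hB hB p ω
  have hw := W.wt_nonneg ε k p ω
  have hw' := W.wt_nonneg ε' k' p ω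
  have hww := W.wt_mul ε ε' k k' p ω
  have hδ := I.δ_nonneg A B
  constructor
  · calc _ = |f A p ω| * |g A p ω| := abs_mul _ _
      _ ≤ (C * W.wt ε k p ω) * (C' * W.wt ε' k' p ω) := by gcongr; exact h1.1; exact h2.1
      _ = C * C' * W.wt (ε + ε') (k + k') p ω := by rw [← hww]; ring
      _ ≤ _ := by
        have := W.wt_nonneg (ε+ε') (k+k') p ω
        have : 0 ≤ C * C' := by positivity
        rw [mul_assoc]; nlinarith [mul_nonneg ‹0 ≤ C * C'› ‹0 ≤ W.wt (ε+ε') (k+k') p ω›]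
  · calc |f A p ω * g A p ω - f B p ω * g B p ω|
        = |f A p ω * (g A p ω - g B p ω) + (f A p ω - f B p ω) * g B p ω| := by ring_nf
      _ ≤ |f A p ω| * |g A p ω - g B p ω| + |f A p ω - f B p ω| * |g B p ω| := by
        rw [← abs_mul, ← abs_mul]; exact abs_add_le _ _
      _ ≤ (C * W.wt ε k p ω) * (C' * I.δ A B * W.wt ε' k' p ω) +
          (C * I.δ A B * W.wt ε k p ω) * (C' * W.wt ε' k' p ω) := by
        gcongr
        exacts [h1.1, h2.2, h1.2, h3.1]
      _ = _ := by rw [← hww]; ring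

lemma Good.mul (hf : Good I W ε r f) (hg : Good I W ε' r g) :
    Good I W (ε + ε') r (fun A p ω => f A p ω * g A p ω) := by
  induction r generalizing f g with
  | zero => exact Base.mul hf hg
  | succ r ih =>
    refine ⟨hf.1.mul hg.1, fun A ω => (hf.2.1 A ω).mul (hg.2.1 A ω), fun e => ?_⟩
    convert (ih hf.of_succ (hg.2.2 e)).add (ih (hf.2.2 e) hg.of_succ) using 1
    funext A p ω
    simp only [dirD]
    rw [fderiv_fun_mul (hf.2.1 A ω p) (hg.2.1 A ω p)]
    simp [mul_comm]

lemma Good.mul0 (hf : Good I W 0 r f) (hg : Good I W ε r g) :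
    Good I W ε r (fun A p ω => f A p ω * g A p ω) := by
  simpa using hf.mul hg

lemma Good.cmul (c : ℝ) (hf : Good I W ε r f) : Good I W ε r (fun A p ω => c * f A p ω) :=
  (Good.const c).mul0 hf

lemma Good.neg (hf : Good I W ε r f) : Good I W ε r (fun A p ω => - f A p ω) := by
  simpa using hf.cmul (-1)

lemma Good.sub (hf : Good I W ε r f) (hg : Good I W ε r g) :
    Good I W ε r (fun A p ω => f A p ω - g A p ω) := by
  simpa [sub_eq_add_neg] using hf.add hg.neg

lemma Good.sum {ι : Type*} (s : Finset ι) {F : ι → 𝒜 → E → Ω → ℝ}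
    (h : ∀ i ∈ s, Good I W ε r (F i)) : Good I W ε r (fun A p ω => ∑ i ∈ s, F i A p ω) := by
  classical
  induction s using Finset.induction_on with
  | empty => simpa using Good.zero
  | insert i s hi ih =>
    simp only [Finset.sum_insert hi]
    exact (h i (by simp)).add (ih fun j hj => h j (by simp [hj]))

lemma Good.prod {ι : Type*} (s : Finset ι) {F : ι → 𝒜 → E → Ω → ℝ}
    (h : ∀ i ∈ s, Good I W 0 r (F i)) : Good I W 0 r (fun A p ω => ∏ i ∈ s, F i A p ω) := by
  classical
  induction s using Finset.induction_on with
  | empty => simpa using Good.const 1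
  | insert i s hi ih =>
    simp only [Finset.prod_insert hi]
    exact (h i (by simp)).mul0 (ih fun j hj => h j (by simp [hj]))

lemma Good.pow (hf : Good I W 0 r f) (n : ℕ) : Good I W 0 r (fun A p ω => f A p ω ^ n) := by
  induction n with
  | zero => simpa using Good.const 1
  | succ n ih => simpa [pow_succ] using ih.mul0 hf

lemma abs_exp_sub_exp_le {x y c : ℝ} (hx : c ≤ x) (hy : c ≤ y) :
    |Real.exp (-x) - Real.exp (-y)| ≤ |x - y| * Real.exp (-c) := by
  wlog h : x ≤ y generalizing x y
  · rw [abs_sub_comm, abs_sub_comm x]; exact this hy hx (le_of_not_ge h)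
  have h1 : Real.exp (-y) ≤ Real.exp (-x) := by gcongr
  rw [abs_of_nonneg (by linarith), abs_sub_comm, abs_of_nonneg (by linarith)]
  have h2 : Real.exp (-x) - Real.exp (-y) = Real.exp (-x) * (1 - Real.exp (-(y - x))) := by
    rw [mul_sub, mul_one, ← Real.exp_add]; ring_nf
  rw [h2]
  have h3 : 1 - Real.exp (-(y-x)) ≤ y - x := by
    have := Real.add_one_le_exp (-(y-x)); linarith
  have h4 : Real.exp (-x) ≤ Real.exp (-c) := by gcongr
  have h5 : 0 ≤ 1 - Real.exp (-(y-x)) := by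
    have : Real.exp (-(y-x)) ≤ 1 := by rw [Real.exp_le_one_iff]; linarith
    linarith
  calc _ ≤ Real.exp (-c) * (y - x) := by gcongr
    _ = _ := by ring

lemma Base.exp (hf : Base I W 0 f)
    (hlow : ∀ M : ℝ, ∃ C : ℝ, ∀ A, I.N A ≤ M → ∀ p ω, ε * W.H p ω - C ≤ f A p ω) :
    Base I W ε (fun A p ω => Real.exp (-f A p ω)) := by
  refine ⟨fun M => ?_, fun A ω => (hf.cont A ω).neg.rexp, fun A p => (hf.meas A p).neg.exp⟩
  obtain ⟨C, k, hC, hb⟩ := hf.bdd M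
  obtain ⟨c, hc⟩ := hlow M
  refine ⟨(1 + C) * Real.exp c, k, by positivity, fun A B hA hB p ω => ?_⟩
  have h1 := hb A B hA hB p ω
  have hG : W.wt 0 0 p ω ≤ W.wt 0 k p ω := W.wt_mono le_rfl (Nat.zero_le k) p ω
  have e1 : ∀ k, W.wt ε k p ω = W.wt 0 k p ω * Real.exp (-(ε * W.H p ω)) := by
    intro k; simp [Wt.wt]
  have hG1 : 1 ≤ W.wt 0 k p ω := by simpa [Wt.wt] using hG
  have h2 : Real.exp (-(ε * W.H p ω - c)) = Real.exp c * Real.exp (-(ε * W.H p ω)) := by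
    rw [← Real.exp_add]; ring_nf
  have hδ := I.δ_nonneg A B
  constructor
  · rw [abs_of_pos (Real.exp_pos _)]
    calc _ ≤ Real.exp (-(ε * W.H p ω - c)) := by gcongr; exact hc A hA p ω
      _ = 1 * Real.exp c * (1 * Real.exp (-(ε * W.H p ω))) := by rw [h2]; ring
      _ ≤ (1 + C) * Real.exp c * (W.wt 0 k p ω * Real.exp (-(ε * W.H p ω))) := by
        gcongr; linarith
      _ = _ := by rw [e1]
  · refine (abs_exp_sub_exp_le (hc A hA p ω) (hc B hB p ω)).trans ?_
    calc _ ≤ C * I.δ A B * W.wt 0 k p ω * Real.exp (-(ε * W.H p ω - c)) := by gcongr; exact h1.2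
      _ = C * I.δ A B * W.wt ε k p ω * Real.exp c := by rw [h2, e1]; ring
      _ ≤ _ := by
        have := W.wt_nonneg ε k p ω
        have : 0 ≤ I.δ A B * W.wt ε k p ω * Real.exp c := by positivity
        nlinarith

lemma Good.exp (hf : Good I W 0 r f)
    (hlow : ∀ M : ℝ, ∃ C : ℝ, ∀ A, I.N A ≤ M → ∀ p ω, ε * W.H p ω - C ≤ f A p ω) :
    Good I W ε r (fun A p ω => Real.exp (-f A p ω)) := by
  induction r with
  | zero => exact Base.exp hf hlow
  | succ r ih =>
    refine ⟨hf.1.exp hlow, fun A ω => (hf.2.1 A ω).neg.exp, fun e => ?_⟩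
    convert (hf.2.2 e).neg.mul0 (ih hf.of_succ) using 1
    funext A p ω
    simp only [dirD]
    have : fderiv ℝ (fun q => Real.exp (-f A q ω)) p = _ :=
      ((hf.2.1 A ω p).hasFDerivAt.neg.exp).fderiv
    rw [this]
    simp [mul_comm]

/-- trivial weights -/
def trivWt (E : Type*) [TopologicalSpace E] : Wt E Unit where
  G := fun _ _ => 1
  H := fun _ _ => 0
  one_le := fun _ _ => le_rfl
  H_nonneg := fun _ _ => le_rfl
  G_cont := fun _ => continuous_const

/-- bounded smooth functions -/
def Cb (I : Idx 𝒜) (r : ℕ) (g : 𝒜 → E → ℝ) : Prop :=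
  Good I (trivWt E) 0 r (fun A p _ => g A p)

lemma Base.comp [FiniteDimensional ℝ E] {F : Type*} [NormedAddCommGroup F] [NormedSpace ℝ F]
    [MeasurableSpace F] [BorelSpace F] {g : 𝒜 → F → ℝ}
    (hg : Base I (trivWt F) 0 (fun A p _ => g A p)) {x : E → Ω → F}
    (hc : ∀ ω, Continuous fun p => x p ω) (hm : ∀ p, Measurable (x p)) :
    Base I W 0 (fun A p ω => g A (x p ω)) := by
  refine ⟨fun M => ?_, fun A ω => (hg.cont A ()).comp (hc ω),
    fun A p => (hg.cont A ()).measurable.comp (hm p)⟩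
  obtain ⟨C, k, hC, hb⟩ := hg.bdd M
  refine ⟨C, 0, hC, fun A B hA hB p ω => ?_⟩
  have := hb A B hA hB (x p ω) ()
  simpa [Wt.wt, trivWt] using this

end goodcalc

section comp
variable {𝒜 E Ω : Type*} [NormedAddCommGroup E] [NormedSpace ℝ E] [MeasurableSpace Ω]
variable {I : Idx 𝒜} {W : Wt E Ω} {r d : ℕ}

lemma pi_eq_sum_single (v : Pt d) : v = ∑ i, v i • (Pi.single i (1:ℝ) : Pt d) := by
  funext j
  simp [Finset.sum_apply, Pi.single_apply]

lemma Good.comp {g : 𝒜 → Pt d → ℝ} (hg : Cb I r g) {x : E → Ω → Pt d}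
    (hx : ∀ i, Good I W 0 r (fun _ p ω => x p ω i)) [FiniteDimensional ℝ E] [Nonempty 𝒜] :
    Good I W 0 r (fun A p ω => g A (x p ω)) := by
  have A₀ : 𝒜 := Classical.arbitrary 𝒜
  induction r generalizing g with
  | zero =>
    exact Base.comp hg (fun ω => continuous_pi fun i => (hx i).base.cont A₀ ω)
      (fun p => measurable_pi_lambda _ fun i => (hx i).base.meas A₀ p)
  | succ r ih =>
    refine ⟨Base.comp hg.1 (fun ω => continuous_pi fun i => (hx i).base.cont A₀ ω)
      (fun p => measurable_pi_lambda _ fun i => (hx i).base.meas A₀ p), fun A ω => ?_, fun e => ?_⟩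
    · exact (hg.2.1 A ()).comp (differentiable_pi.2 fun i => (hx i).2.1 A ω)
    · have := Good.sum (I := I) (W := W) (ε := 0) (r := r) Finset.univ (F := fun (i : Fin (d+1)) A p ω =>
          dirD e (fun (_ : 𝒜) p ω => x p ω i) A p ω * pd i (g A) (x p ω))
        (fun i _ => ((hx i).2.2 e).mul0 (ih (hg.2.2 (Pi.single i 1)) fun i => (hx i).of_succ))
      convert this using 1
      funext A p ω
      simp only [dirD]
      have hd : DifferentiableAt ℝ (fun q => x q ω) p :=
        differentiableAt_pi.2 fun i => (hx i).2.1 A ω p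
      have h1 := (hg.2.1 A () (x p ω)).hasFDerivAt.comp p hd.hasFDerivAt
      have h2 : fderiv ℝ (fun q => g A (x q ω)) p = _ := h1.fderiv
      rw [h2]
      simp only [ContinuousLinearMap.comp_apply]
      rw [pi_eq_sum_single (fderiv ℝ (fun q => x q ω) p e), map_sum]
      refine Finset.sum_congr rfl fun i _ => ?_
      rw [map_smul, smul_eq_mul, fderiv_pi fun i => (hx i).2.1 A ω p]
      rfl

end comp

section goodint
variable {𝒜 E Ω Ω' Θ : Type*} [NormedAddCommGroup E] [NormedSpace ℝ E] [FiniteDimensional ℝ E]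
  [MeasurableSpace Ω] [MeasurableSpace Ω'] [MeasurableSpace Θ]

/-- data for integrating out a variable `θ` -/
structure Fib (W : Wt E Ω) (W' : Wt E Ω') (ε : ℝ) (ν : Measure Θ) where
  j : Ω → Θ → Ω'
  γ : Θ → ℝ
  j_meas : Measurable (Function.uncurry j)
  γ_nonneg : ∀ θ, 0 ≤ γ θ
  hG : ∀ p ω θ, W'.G p (j ω θ) ≤ W.G p ω * (1 + γ θ)
  hH : ∀ p ω θ, W.H p ω + γ θ ≤ W'.H p (j ω θ)
  hitg : ∀ k : ℕ, Integrable (fun θ => (1 + γ θ) ^ k * Real.exp (-(ε * γ θ))) ν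
  eps_nonneg : 0 ≤ ε

variable {I : Idx 𝒜} {W : Wt E Ω} {W' : Wt E Ω'} {ε : ℝ} {ν : Measure Θ} [SFinite ν]
  {r : ℕ} {f : 𝒜 → E → Ω' → ℝ}

noncomputable def Fib.w (S : Fib W W' ε ν) (k : ℕ) (θ : Θ) : ℝ :=
  (1 + S.γ θ) ^ k * Real.exp (-(ε * S.γ θ))

lemma Fib.w_nonneg (S : Fib W W' ε ν) (k : ℕ) (θ : Θ) : 0 ≤ S.w k θ := by
  have := S.γ_nonneg θ
  unfold Fib.w; positivity

lemma Fib.wt_le (S : Fib W W' ε ν) (k : ℕ) (p : E) (ω : Ω) (θ : Θ) :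
    W'.wt ε k p (S.j ω θ) ≤ W.wt ε k p ω * S.w k θ := by
  have h1 := S.hG p ω θ
  have h2 := S.hH p ω θ
  have h3 := W'.one_le p (S.j ω θ)
  have h4 := W.one_le p ω
  have h5 := S.γ_nonneg θ
  have hε := S.eps_nonneg
  unfold Wt.wt Fib.w
  calc _ ≤ (W.G p ω * (1 + S.γ θ)) ^ k * Real.exp (-(ε * (W.H p ω + S.γ θ))) := by gcongr
    _ = _ := by
      rw [mul_pow, mul_add, neg_add, Real.exp_add]; ring

/-- the fibre integral -/
noncomputable def Fib.int (S : Fib W W' ε ν) (f : 𝒜 → E → Ω' → ℝ) : 𝒜 → E → Ω → ℝ :=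
  fun A p ω => ∫ θ, f A p (S.j ω θ) ∂ν

lemma Fib.meas_fib (S : Fib W W' ε ν) (ω : Ω) : Measurable (S.j ω) :=
  S.j_meas.comp measurable_prodMk_left

lemma Fib.integrable (S : Fib W W' ε ν) (hf : Base I W' ε f) (A : 𝒜) (p : E) (ω : Ω) :
    Integrable (fun θ => f A p (S.j ω θ)) ν := by
  obtain ⟨C, k, hC, hb⟩ := hf.bdd (I.N A)
  refine Integrable.mono' ((S.hitg k).const_mul (C * W.wt ε k p ω))
    ((hf.meas A p).comp (S.meas_fib ω)).aestronglyMeasurable (ae_of_all _ fun θ => ?_)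
  have := (hb A A le_rfl le_rfl p (S.j ω θ)).1
  have h2 := S.wt_le k p ω θ
  rw [Real.norm_eq_abs, mul_assoc]
  exact this.trans (by gcongr; exact h2)

/-- local domination -/
lemma Fib.local_dom (S : Fib W W' ε ν) (hf : Base I W' ε f) (A : 𝒜) (p₀ : E) (ω : Ω) :
    ∃ (s : Set E) (bd : Θ → ℝ), s ∈ nhds p₀ ∧ Integrable bd ν ∧ (∀ θ, 0 ≤ bd θ) ∧
      ∀ θ, ∀ p ∈ s, |f A p (S.j ω θ)| ≤ bd θ := by
  obtain ⟨C, k, hC, hb⟩ := hf.bdd (I.N A)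
  refine ⟨{p | W.G p ω < W.G p₀ ω + 1}, fun θ => (C * (W.G p₀ ω + 1) ^ k) * S.w k θ, ?_,
    (S.hitg k).const_mul _, fun θ => ?_, fun θ p hp => ?_⟩
  · exact (isOpen_lt (W.G_cont ω) continuous_const).mem_nhds (by simp)
  · have := W.one_le p₀ ω
    have := S.w_nonneg k θ
    positivity
  · have h1 := (hb A A le_rfl le_rfl p (S.j ω θ)).1
    have h2 := S.wt_le k p ω θ
    have h3 : W.wt ε k p ω ≤ (W.G p₀ ω + 1) ^ k := by
      have h4 := W.one_le p ω
      have h5 := W.H_nonneg p ω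
      have h6 : Real.exp (-(ε * W.H p ω)) ≤ 1 := by
        rw [Real.exp_le_one_iff]; have := S.eps_nonneg; nlinarith
      have hp' : W.G p ω ≤ W.G p₀ ω + 1 := le_of_lt hp
      unfold Wt.wt
      calc _ ≤ W.G p ω ^ k * 1 := by gcongr
        _ ≤ _ := by rw [mul_one]; gcongr
    have := S.w_nonneg k θ
    calc _ ≤ C * W'.wt ε k p (S.j ω θ) := h1
      _ ≤ C * ((W.G p₀ ω + 1) ^ k * S.w k θ) := by
        gcongr
        exact h2.trans (by gcongr)
      _ = _ := by ring

lemma Fib.base (S : Fib W W' ε ν) (hf : Base I W' ε f) : Base I W ε (S.int f) := by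
  refine ⟨fun M => ?_, fun A ω => ?_, fun A p => ?_⟩
  · obtain ⟨C, k, hC, hb⟩ := hf.bdd M
    have hw0 : 0 ≤ ∫ θ, S.w k θ ∂ν := integral_nonneg fun θ => S.w_nonneg k θ
    refine ⟨C * ∫ θ, S.w k θ ∂ν, k, by positivity, fun A B hA hB p ω => ⟨?_, ?_⟩⟩
    · have := norm_integral_le_of_norm_le (f := fun θ => f A p (S.j ω θ))
        ((S.hitg k).const_mul (C * W.wt ε k p ω)) (ae_of_all _ fun θ => by
          have h1 := (hb A B hA hB p (S.j ω θ)).1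
          have h2 := S.wt_le k p ω θ
          rw [Real.norm_eq_abs, mul_assoc]
          exact h1.trans (by gcongr; exact h2))
      rw [integral_const_mul] at this
      calc _ ≤ _ := this
        _ = _ := by unfold Fib.w; ring
    · have hδ := I.δ_nonneg A B
      have := norm_integral_le_of_norm_le (f := fun θ => f A p (S.j ω θ) - f B p (S.j ω θ))
        ((S.hitg k).const_mul (C * I.δ A B * W.wt ε k p ω)) (ae_of_all _ fun θ => by
          have h1 := (hb A B hA hB p (S.j ω θ)).2
          have h2 := S.wt_le k p ω θ
          rw [Real.norm_eq_abs, mul_assoc (C * I.δ A B)]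
          exact h1.trans (by gcongr; exact h2))
      rw [integral_const_mul, integral_sub (S.integrable hf A p ω) (S.integrable hf B p ω)] at this
      calc _ ≤ _ := this
        _ = _ := by unfold Fib.w; ring
  · rw [continuous_iff_continuousAt]
    intro p₀
    obtain ⟨s, bd, hs, hbd, -, hle⟩ := S.local_dom hf A p₀ ω
    refine continuousAt_of_dominated (bound := bd) (Eventually.of_forall fun p =>
      ((hf.meas A p).comp (S.meas_fib ω)).aestronglyMeasurable) ?_ hbd
      (ae_of_all _ fun θ => (hf.cont A _).continuousAt)
    filter_upwards [hs] with p hp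
    exact ae_of_all _ fun θ => hle θ p hp
  · have : StronglyMeasurable (Function.uncurry fun ω θ => f A p (S.j ω θ)) :=
      ((hf.meas A p).comp S.j_meas).stronglyMeasurable
    exact this.integral_prod_right.measurable

lemma Fib.hasFDerivAt (S : Fib W W' ε ν) (hf : Good I W' ε (r+1) f) (A : 𝒜) (p₀ : E) (ω : Ω) :
    Integrable (fun θ => fderiv ℝ (fun q => f A q (S.j ω θ)) p₀) ν ∧
    HasFDerivAt (fun p => S.int f A p ω)
      (∫ θ, fderiv ℝ (fun q => f A q (S.j ω θ)) p₀ ∂ν) p₀ := by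
  classical
  let b := Module.finBasis ℝ E
  obtain ⟨K, hK, hKb⟩ := b.exists_opNorm_le (F := ℝ)
  have hd : ∀ i, Base I W' ε (dirD (b i) f) := fun i => (hf.2.2 (b i)).base
  choose s bd hs hbd hnn hle using fun i => S.local_dom (hd i) A p₀ ω
  have hmeas : ∀ p, AEStronglyMeasurable (fun θ => fderiv ℝ (fun q => f A q (S.j ω θ)) p) ν := by
    intro p
    have : (fun θ => fderiv ℝ (fun q => f A q (S.j ω θ)) p) = fun θ => ∑ i,
        dirD (b i) f A p (S.j ω θ) • (LinearMap.toContinuousLinearMap (b.coord i)) := by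
      funext θ
      refine ContinuousLinearMap.ext fun e => ?_
      conv_lhs => rw [← b.sum_repr e, map_sum]
      simp only [ContinuousLinearMap.sum_apply, ContinuousLinearMap.smul_apply, map_smul]
      refine Finset.sum_congr rfl fun i _ => ?_
      simp [dirD, mul_comm]
    rw [this]
    refine Finset.aestronglyMeasurable_fun_sum _ fun i _ => ?_
    exact (((hd i).meas A p).comp (S.meas_fib ω)).aestronglyMeasurable.smul_const _
  have hnorm : ∀ θ, ∀ p ∈ ⋂ i, s i, ‖fderiv ℝ (fun q => f A q (S.j ω θ)) p‖ ≤ K * ∑ i, bd i θ := by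
    intro θ p hp
    refine hKb (Finset.sum_nonneg fun i _ => hnn i θ) fun i => ?_
    calc _ ≤ bd i θ := hle i θ p (Set.mem_iInter.1 hp i)
      _ ≤ _ := Finset.single_le_sum (f := fun i => bd i θ) (fun i _ => hnn i θ) (Finset.mem_univ i)
  have hbi : Integrable (fun θ => K * ∑ i, bd i θ) ν :=
    (integrable_finset_sum _ fun i _ => hbd i).const_mul K
  have hsn : (⋂ i, s i) ∈ nhds p₀ := (Filter.iInter_mem).2 hs
  refine ⟨Integrable.mono' hbi (hmeas p₀)
    (ae_of_all _ fun θ => hnorm θ p₀ (mem_of_mem_nhds hsn)), ?_⟩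
  exact hasFDerivAt_integral_of_dominated_of_fderiv_le (bound := fun θ => K * ∑ i, bd i θ) hsn
    (Eventually.of_forall fun p =>
      ((hf.1.meas A p).comp (S.meas_fib ω)).aestronglyMeasurable)
    (S.integrable hf.1 A p₀ ω) (hmeas p₀) (ae_of_all _ fun θ p hp => hnorm θ p hp) hbi
    (ae_of_all _ fun θ p _ => (hf.2.1 A _ p).hasFDerivAt)

lemma Fib.dirD_int (S : Fib W W' ε ν) (hf : Good I W' ε (r+1) f) (e : E) :
    dirD e (S.int f) = S.int (dirD e f) := by
  funext A p ω
  obtain ⟨h1, h2⟩ := S.hasFDerivAt hf A p ω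
  simp only [dirD]
  rw [h2.fderiv, ContinuousLinearMap.integral_apply h1]
  rfl

lemma Fib.good (S : Fib W W' ε ν) (hf : Good I W' ε r f) : Good I W ε r (S.int f) := by
  induction r generalizing f with
  | zero => exact S.base hf
  | succ r ih =>
    refine ⟨S.base hf.1, fun A ω p => (S.hasFDerivAt hf A p ω).2.differentiableAt, fun e => ?_⟩
    rw [S.dirD_int hf e]
    exact ih (hf.2.2 e)

end goodint

/-! ## Part 2: from the calculus to the heat calculus spaces -/

lemma foldr_iter_pred {ι X : Type*} (P : ℕ → X → Prop) (op : ι → X → X)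
    (hop : ∀ i n x, P (n+1) x → P n (op i x)) (k : ι → ℕ) (l : List ι) (n : ℕ) (x : X)
    (h : P (n + (l.map k).sum) x) : P n (l.foldr (fun i g => (op i)^[k i] g) x) := by
  have hit : ∀ (m n : ℕ) (i : ι) (x : X), P (n + m) x → P n ((op i)^[m] x) := by
    intro m
    induction m with
    | zero => intro n i x h; simpa using h
    | succ m ih =>
      intro n i x h
      rw [Function.iterate_succ_apply]
      exact ih n i _ (hop i _ _ h)
  induction l generalizing n with
  | nil => simpa using h
  | cons i l ih =>
    rw [List.foldr_cons]
    refine hit _ _ _ _ (ih _ ?_)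
    rw [List.map_cons, List.sum_cons] at h
    rwa [add_assoc]

lemma foldr_iter_semiconj {ι X Y : Type*} (Φ : X → Y) (op : ι → X → X) (op' : ι → Y → Y)
    (h : ∀ i x, Φ (op i x) = op' i (Φ x)) (k : ι → ℕ) (l : List ι) (x : X) :
    Φ (l.foldr (fun i g => (op i)^[k i] g) x) = l.foldr (fun i g => (op' i)^[k i] g) (Φ x) := by
  have hit : ∀ (m : ℕ) (i : ι) (x : X), Φ ((op i)^[m] x) = (op' i)^[m] (Φ x) := by
    intro m
    induction m with
    | zero => intro i x; rfl
    | succ m ih =>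
      intro i x
      rw [Function.iterate_succ_apply, Function.iterate_succ_apply, ih, h]
  induction l with
  | nil => rfl
  | cons i l ih => rw [List.foldr_cons, List.foldr_cons, hit, ih]

lemma sum_finRange_map (k : Fin (d+1) → ℕ) : ((List.finRange (d+1)).map k).sum = ∑ i, k i := by
  rw [← List.ofFn_eq_map, List.sum_ofFn]

lemma sum_le_pdeg (k : Fin (d+1) → ℕ) : ∑ i, k i ≤ pdeg k := Nat.le_add_left _ _

section psi
variable {𝒜 Ω : Type*} [MeasurableSpace Ω]

/-- the weights `1 + ‖v‖` and `|v|²`. -/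
noncomputable def Wv (d : ℕ) (Ω : Type*) : Wt (Pt d × Pt d) Ω where
  G := fun p _ => 1 + ‖p.2‖
  H := fun p _ => ∑ l : Fin d, p.2 l.succ ^ 2
  one_le := fun p _ => by have := norm_nonneg p.2; linarith
  H_nonneg := fun p _ => by positivity
  G_cont := fun _ => by fun_prop

variable {I : Idx 𝒜} {ε : ℝ} {r : ℕ} {W : Wt (Pt d × Pt d) Ω} {F : 𝒜 → Pt d × Pt d → Ω → ℝ}

noncomputable def gpd1 {𝒜 : Type*} (i : Fin (d+1)) (F : 𝒜 → Pt d × Pt d → Ω → ℝ) : 𝒜 → Pt d × Pt d → Ω → ℝ :=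
  fun A p ω => pd i (fun w => F A (w, p.2) ω) p.1

noncomputable def gpd2 {𝒜 : Type*} (i : Fin (d+1)) (F : 𝒜 → Pt d × Pt d → Ω → ℝ) : 𝒜 → Pt d × Pt d → Ω → ℝ :=
  fun A p ω => pd i (fun v => F A (p.1, v) ω) p.2

lemma pd_fst {f : Pt d × Pt d → ℝ} (hf : Differentiable ℝ f) (i : Fin (d+1)) (p : Pt d × Pt d) :
    pd i (fun w => f (w, p.2)) p.1 = fderiv ℝ f p (Pi.single i 1, 0) := by
  have h1 : HasFDerivAt (fun w : Pt d => (w, p.2)) (ContinuousLinearMap.inl ℝ (Pt d) (Pt d)) p.1 :=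
    hasFDerivAt_prodMk_left p.1 p.2
  have h2 := (hf (p.1, p.2)).hasFDerivAt.comp p.1 h1
  have h3 : fderiv ℝ (fun w => f (w, p.2)) p.1 = _ := h2.fderiv
  unfold pd
  rw [h3]; simp

lemma pd_snd {f : Pt d × Pt d → ℝ} (hf : Differentiable ℝ f) (i : Fin (d+1)) (p : Pt d × Pt d) :
    pd i (fun w => f (p.1, w)) p.2 = fderiv ℝ f p (0, Pi.single i 1) := by
  have h1 : HasFDerivAt (fun w : Pt d => (p.1, w)) (ContinuousLinearMap.inr ℝ (Pt d) (Pt d)) p.2 :=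
    hasFDerivAt_prodMk_right p.1 p.2
  have h2 := (hf (p.1, p.2)).hasFDerivAt.comp p.2 h1
  have h3 : fderiv ℝ (fun w => f (p.1, w)) p.2 = _ := h2.fderiv
  unfold pd
  rw [h3]; simp

lemma Good.gpd1_eq (hF : Good I W ε (r+1) F) (i : Fin (d+1)) :
    gpd1 i F = dirD (Pi.single i 1, 0) F := by
  funext A p ω
  exact pd_fst (hF.2.1 A ω) i p

lemma Good.gpd2_eq (hF : Good I W ε (r+1) F) (i : Fin (d+1)) :
    gpd2 i F = dirD (0, Pi.single i 1) F := by
  funext A p ω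
  exact pd_snd (hF.2.1 A ω) i p

lemma Good.gpd1 (hF : Good I W ε (r+1) F) (i : Fin (d+1)) : Good I W ε r (gpd1 i F) := by
  rw [hF.gpd1_eq]; exact hF.2.2 _

lemma Good.gpd2 (hF : Good I W ε (r+1) F) (i : Fin (d+1)) : Good I W ε r (gpd2 i F) := by
  rw [hF.gpd2_eq]; exact hF.2.2 _

noncomputable def fold1 {𝒜 : Type*} (k : Fin (d+1) → ℕ) (F : 𝒜 → Pt d × Pt d → Ω → ℝ) : 𝒜 → Pt d × Pt d → Ω → ℝ :=
  (List.finRange (d + 1)).foldr (fun i g => (gpd1 i)^[k i] g) F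

noncomputable def fold2 {𝒜 : Type*} (k : Fin (d+1) → ℕ) (F : 𝒜 → Pt d × Pt d → Ω → ℝ) : 𝒜 → Pt d × Pt d → Ω → ℝ :=
  (List.finRange (d + 1)).foldr (fun i g => (gpd2 i)^[k i] g) F

lemma mderiv2_eq_fold (j m : Fin (d+1) → ℕ) (F : 𝒜 → Pt d × Pt d → Ω → ℝ) (A : 𝒜) (ω : Ω)
    (w uv : Pt d) :
    mderiv2 j m (fun w uv => F A (w, uv) ω) w uv = fold1 j (fold2 m F) A (w, uv) ω := by
  unfold mderiv2
  have h1 : ∀ z', mderiv m (fun v => F A (z', v) ω) = fun v => fold2 m F A (z', v) ω := by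
    intro z'
    exact (foldr_iter_semiconj (fun (F : 𝒜 → Pt d × Pt d → Ω → ℝ) (v : Pt d) => F A (z', v) ω)
      gpd2 pd (fun i x => rfl) m _ F).symm
  simp only [h1]
  have h2 : mderiv j (fun z' => fold2 m F A (z', uv) ω) = fun w => fold1 j (fold2 m F) A (w, uv) ω :=
    (foldr_iter_semiconj (fun (F : 𝒜 → Pt d × Pt d → Ω → ℝ) (v : Pt d) => F A (v, uv) ω)
      gpd1 pd (fun i x => rfl) j _ (fold2 m F)).symm
  rw [h2]

/-- difference family -/
def dif (F : 𝒜 → Pt d × Pt d → Ω → ℝ) : 𝒜 × 𝒜 → Pt d × Pt d → Ω → ℝ :=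
  fun A p ω => F A.1 p ω - F A.2 p ω

lemma Good.fold (hF : Good I W ε r F) (j m : Fin (d+1) → ℕ) (s : ℕ)
    (h : s + (∑ i, j i + ∑ i, m i) ≤ r) : Good I W ε s (fold1 j (fold2 m F)) := by
  refine foldr_iter_pred (Good I W ε) VarBPHZ.gpd1 (fun i n x hx => hx.gpd1 i) j _ s _ ?_
  refine foldr_iter_pred (Good I W ε) VarBPHZ.gpd2 (fun i n x hx => hx.gpd2 i) m _ _ _ ?_
  rw [sum_finRange_map, sum_finRange_map]
  exact hF.of_le (by omega)

lemma Good.dif_gpd1 (hF : Good I W ε (r+1) F) (i : Fin (d+1)) :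
    VarBPHZ.gpd1 i (dif F) = dif (VarBPHZ.gpd1 i F) := by
  funext A p ω
  unfold dif
  have := pd_fst (f := fun p => F A.1 p ω - F A.2 p ω) ((hF.2.1 A.1 ω).sub (hF.2.1 A.2 ω)) i p
  rw [hF.gpd1_eq]
  refine this.trans ?_
  rw [fderiv_fun_sub (hF.2.1 A.1 ω p) (hF.2.1 A.2 ω p)]; rfl

lemma Good.dif_gpd2 (hF : Good I W ε (r+1) F) (i : Fin (d+1)) :
    VarBPHZ.gpd2 i (dif F) = dif (VarBPHZ.gpd2 i F) := by
  funext A p ω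
  unfold dif
  have := pd_snd (f := fun p => F A.1 p ω - F A.2 p ω) ((hF.2.1 A.1 ω).sub (hF.2.1 A.2 ω)) i p
  rw [hF.gpd2_eq]
  refine this.trans ?_
  rw [fderiv_fun_sub (hF.2.1 A.1 ω p) (hF.2.1 A.2 ω p)]; rfl

lemma Good.dif_fold (hF : Good I W ε r F) (j m : Fin (d+1) → ℕ)
    (h : (∑ i, j i + ∑ i, m i) ≤ r) :
    fold1 j (fold2 m (dif F)) = dif (fold1 j (fold2 m F)) := by
  have key := foldr_iter_pred
    (fun n (x : (𝒜 → Pt d × Pt d → Ω → ℝ) × (𝒜 × 𝒜 → Pt d × Pt d → Ω → ℝ)) =>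
      Good I W ε n x.1 ∧ x.2 = dif x.1)
    (fun i x => (VarBPHZ.gpd2 i x.1, VarBPHZ.gpd2 i x.2))
    (fun i n x hx => ⟨hx.1.gpd2 i, by rw [hx.2]; exact hx.1.dif_gpd2 i⟩) m
    (List.finRange (d+1)) (∑ i, j i) (F, dif F)
    ⟨hF.of_le (by rw [sum_finRange_map]; exact h), rfl⟩
  have key2 := foldr_iter_pred
    (fun n (x : (𝒜 → Pt d × Pt d → Ω → ℝ) × (𝒜 × 𝒜 → Pt d × Pt d → Ω → ℝ)) =>
      Good I W ε n x.1 ∧ x.2 = dif x.1)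
    (fun i x => (VarBPHZ.gpd1 i x.1, VarBPHZ.gpd1 i x.2))
    (fun i n x hx => ⟨hx.1.gpd1 i, by rw [hx.2]; exact hx.1.dif_gpd1 i⟩) j
    (List.finRange (d+1)) 0 _ (by rw [sum_finRange_map, zero_add]; exact key)
  have h2 := key2.2
  rw [foldr_iter_semiconj Prod.fst _ VarBPHZ.gpd1 (fun i x => rfl),
    foldr_iter_semiconj Prod.snd _ VarBPHZ.gpd1 (fun i x => rfl),
    foldr_iter_semiconj Prod.fst _ VarBPHZ.gpd2 (fun i x => rfl),
    foldr_iter_semiconj Prod.snd _ VarBPHZ.gpd2 (fun i x => rfl)] at h2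
  exact h2

lemma Good.psiSmooth (hF : Good I W ε r F) (A : 𝒜) (ω : Ω) :
    PsiSmooth r (fun w uv => F A (w, uv) ω) := by
  constructor
  · intro j m h
    simp only [mderiv2_eq_fold]
    have := sum_le_pdeg j
    exact (hF.fold j m 1 (by omega)).2.1 A ω
  · intro j m h
    simp only [mderiv2_eq_fold]
    have := sum_le_pdeg j
    exact (hF.fold j m 0 (by omega)).base.cont A ω

lemma Good.psiSmooth_sub (hF : Good I W ε r F) (A B : 𝒜) (ω : Ω) :
    PsiSmooth r (fun w uv => F A (w, uv) ω - F B (w, uv) ω) := by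
  have e : ∀ j m, pdeg j + ∑ i, m i ≤ r → (fun p : Pt d × Pt d => mderiv2 j m
      (fun w uv => F A (w, uv) ω - F B (w, uv) ω) p.1 p.2) =
      fun p => fold1 j (fold2 m F) A p ω - fold1 j (fold2 m F) B p ω := by
    intro j m h
    have := sum_le_pdeg j
    funext p
    have h1 := mderiv2_eq_fold j m (dif F) (A, B) ω p.1 p.2
    rw [hF.dif_fold j m (by omega)] at h1
    exact h1
  constructor
  · intro j m h
    rw [e j m (by omega)]
    have := sum_le_pdeg j
    exact ((hF.fold j m 1 (by omega)).2.1 A ω).sub ((hF.fold j m 1 (by omega)).2.1 B ω)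
  · intro j m h
    rw [e j m h]
    have := sum_le_pdeg j
    exact ((hF.fold j m 0 (by omega)).base.cont A ω).sub ((hF.fold j m 0 (by omega)).base.cont B ω)

lemma gauss_bound {ε : ℝ} (hε : 0 < ε) (T : ℝ) (nn k : ℕ) : ∃ C : ℝ, 0 ≤ C ∧ ∀ uv : Pt d,
    0 ≤ uv 0 → uv 0 ≤ Real.sqrt T →
    (1 + Real.sqrt (∑ i : Fin d, uv i.succ ^ 2)) ^ nn *
      ((1 + ‖uv‖) ^ k * Real.exp (-(ε * ∑ i : Fin d, uv i.succ ^ 2))) ≤ C := by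
  set τ := Real.sqrt T
  have hτ : 0 ≤ τ := Real.sqrt_nonneg T
  refine ⟨(nn + k).factorial / ε ^ (nn + k) * Real.exp (ε * (1 + τ) + ε / 4), by positivity,
    fun uv h0 h1 => ?_⟩
  set s := Real.sqrt (∑ i : Fin d, uv i.succ ^ 2) with hs
  have hs0 : 0 ≤ s := Real.sqrt_nonneg _
  have hs2 : ∑ i : Fin d, uv i.succ ^ 2 = s ^ 2 :=
    (Real.sq_sqrt (Finset.sum_nonneg fun i _ => sq_nonneg _)).symm
  have hn : ‖uv‖ ≤ τ + s := by
    rw [pi_norm_le_iff_of_nonneg (by positivity)]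
    intro i
    refine Fin.cases ?_ (fun l => ?_) i
    · rw [Real.norm_eq_abs, abs_of_nonneg h0]; linarith
    · rw [Real.norm_eq_abs]
      have : |uv l.succ| ≤ s := by
        rw [← Real.sqrt_sq_eq_abs]
        apply Real.sqrt_le_sqrt
        exact Finset.single_le_sum (f := fun l : Fin d => uv l.succ ^ 2) (fun i _ => sq_nonneg _)
          (Finset.mem_univ l)
      linarith
  rw [hs2]
  set x := 1 + τ + s with hx
  have hx0 : 0 ≤ x := by positivity
  have hp : x ^ (nn + k) ≤ (nn + k).factorial / ε ^ (nn + k) * Real.exp (ε * x) := by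
    have := Real.pow_div_factorial_le_exp (ε * x) (by positivity) (nn + k)
    rw [div_le_iff₀ (by positivity), mul_pow] at this
    rw [div_mul_eq_mul_div, le_div_iff₀ (by positivity)]
    linarith
  calc _ ≤ x ^ nn * (x ^ k * Real.exp (-(ε * s ^ 2))) := by
        gcongr
        · linarith
        · linarith
    _ = x ^ (nn + k) * Real.exp (-(ε * s ^ 2)) := by rw [pow_add]; ring
    _ ≤ (nn + k).factorial / ε ^ (nn + k) * Real.exp (ε * x) * Real.exp (-(ε * s ^ 2)) := by gcongr
    _ = (nn + k).factorial / ε ^ (nn + k) * Real.exp (ε * x - ε * s ^ 2) := by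
        rw [mul_assoc, ← Real.exp_add]; rfl
    _ ≤ _ := by
        gcongr
        nlinarith [sq_nonneg (s - 1/2)]

lemma Good.psiBound {F : 𝒜 → Pt d × Pt d → Ω → ℝ} (hF : Good I (Wv d Ω) ε r F) (hε : 0 < ε)
    (M T : ℝ) (nn : ℕ) :
    ∃ C : ℝ, 0 ≤ C ∧ ∀ A B, I.N A ≤ M → I.N B ≤ M → ∀ ω,
      (∀ y ∈ psiSet r T nn (fun w uv => F A (w, uv) ω), y ≤ C) ∧
      (∀ y ∈ psiSet r T nn (fun w uv => F A (w, uv) ω - F B (w, uv) ω), y ≤ C * I.δ A B) := by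
  have h1 : ∀ jm : (Fin (d+1) → Fin (r+1)) × (Fin (d+1) → Fin (r+1)), ∃ C : ℝ, 0 ≤ C ∧
      ((∑ i, (jm.1 i : ℕ) + ∑ i, (jm.2 i : ℕ)) ≤ r → ∀ A B, I.N A ≤ M → I.N B ≤ M → ∀ ω (w uv : Pt d),
        0 ≤ uv 0 → uv 0 ≤ Real.sqrt T →
        (1 + Real.sqrt (∑ i : Fin d, uv i.succ ^ 2)) ^ nn *
          |fold1 (fun i => (jm.1 i : ℕ)) (fold2 (fun i => (jm.2 i : ℕ)) F) A (w, uv) ω| ≤ C ∧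
        (1 + Real.sqrt (∑ i : Fin d, uv i.succ ^ 2)) ^ nn *
          |dif (fold1 (fun i => (jm.1 i : ℕ)) (fold2 (fun i => (jm.2 i : ℕ)) F)) (A, B) (w, uv) ω|
            ≤ C * I.δ A B) := by
    intro jm
    by_cases h : (∑ i, (jm.1 i : ℕ) + ∑ i, (jm.2 i : ℕ)) ≤ r
    · obtain ⟨C, k, hC, hb⟩ := (hF.fold (fun i => (jm.1 i : ℕ)) (fun i => (jm.2 i : ℕ)) 0
        (by omega)).base.bdd M
      obtain ⟨D, hD, hg⟩ := gauss_bound (d := d) hε T nn k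
      refine ⟨C * D, by positivity, fun _ A B hA hB ω w uv h0 hT => ?_⟩
      have h1 := hb A B hA hB (w, uv) ω
      have h2 := hg uv h0 hT
      have hδ := I.δ_nonneg A B
      have hw : (Wv d Ω).wt ε k (w, uv) ω =
        (1 + ‖uv‖) ^ k * Real.exp (-(ε * ∑ i : Fin d, uv i.succ ^ 2)) := rfl
      rw [hw] at h1
      constructor
      · calc _ ≤ (1 + Real.sqrt (∑ i : Fin d, uv i.succ ^ 2)) ^ nn * (C * ((1 + ‖uv‖) ^ k *
              Real.exp (-(ε * ∑ i : Fin d, uv i.succ ^ 2)))) := by gcongr; exact h1.1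
          _ = C * ((1 + Real.sqrt (∑ i : Fin d, uv i.succ ^ 2)) ^ nn * ((1 + ‖uv‖) ^ k *
              Real.exp (-(ε * ∑ i : Fin d, uv i.succ ^ 2)))) := by ring
          _ ≤ _ := by gcongr
      · calc _ ≤ (1 + Real.sqrt (∑ i : Fin d, uv i.succ ^ 2)) ^ nn * (C * I.δ A B * ((1 + ‖uv‖) ^ k *
              Real.exp (-(ε * ∑ i : Fin d, uv i.succ ^ 2)))) := by gcongr; exact h1.2
          _ = C * I.δ A B * ((1 + Real.sqrt (∑ i : Fin d, uv i.succ ^ 2)) ^ nn * ((1 + ‖uv‖) ^ k *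
              Real.exp (-(ε * ∑ i : Fin d, uv i.succ ^ 2)))) := by ring
          _ ≤ C * I.δ A B * D := by gcongr
          _ = _ := by ring
    · exact ⟨0, le_rfl, fun h' => absurd h' h⟩
  choose C hC hb using h1
  refine ⟨∑ jm, C jm, Finset.sum_nonneg fun _ _ => hC _, fun A B hA hB ω => ?_⟩
  have hle : ∀ jm, C jm ≤ ∑ jm, C jm := fun jm =>
    Finset.single_le_sum (f := C) (fun _ _ => hC _) (Finset.mem_univ jm)
  have hlift : ∀ j m : Fin (d+1) → ℕ, pdeg j + ∑ i, m i ≤ r →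
      ∃ jm : (Fin (d+1) → Fin (r+1)) × (Fin (d+1) → Fin (r+1)),
        (fun i => (jm.1 i : ℕ)) = j ∧ (fun i => (jm.2 i : ℕ)) = m := by
    intro j m h
    have hs := sum_le_pdeg j
    have hj : ∀ i, j i < r + 1 := fun i => by
      have := Finset.single_le_sum (f := j) (fun _ _ => Nat.zero_le _) (Finset.mem_univ i); omega
    have hm : ∀ i, m i < r + 1 := fun i => by
      have := Finset.single_le_sum (f := m) (fun _ _ => Nat.zero_le _) (Finset.mem_univ i); omega
    exact ⟨(fun i => ⟨j i, hj i⟩, fun i => ⟨m i, hm i⟩), rfl, rfl⟩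
  constructor
  · rintro y ⟨j, m, w, uv, hjm, h0, hT, rfl⟩
    obtain ⟨jm, rfl, rfl⟩ := hlift j m hjm
    have hs := sum_le_pdeg (fun i => (jm.1 i : ℕ))
    beta_reduce at hjm hs
    rw [mderiv2_eq_fold]
    exact ((hb jm (by omega) A B hA hB ω w uv h0 hT).1).trans (hle jm)
  · rintro y ⟨j, m, w, uv, hjm, h0, hT, rfl⟩
    obtain ⟨jm, rfl, rfl⟩ := hlift j m hjm
    have hs := sum_le_pdeg (fun i => (jm.1 i : ℕ))
    beta_reduce at hjm hs
    have h1 := mderiv2_eq_fold (fun i => (jm.1 i : ℕ)) (fun i => (jm.2 i : ℕ)) (dif F) (A, B) ω w uv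
    rw [hF.dif_fold _ _ (by omega)] at h1
    have h2 := (hb jm (by omega) A B hA hB ω w uv h0 hT).2
    rw [← h1] at h2
    have hδ := I.δ_nonneg A B
    exact h2.trans (mul_le_mul_of_nonneg_right (hle jm) hδ)

end psi

/-! ## Part 3: coefficients -/

/-- unit multi-index -/
def eI (i : Fin (d+1)) : Fin (d+1) → ℕ := Pi.single i 1

/-- parabolic weight of a direction -/
def stp (i : Fin (d+1)) : ℕ := if i = 0 then 2 else 1

lemma stp_pos (i : Fin (d+1)) : 0 < stp i := by unfold stp; split_ifs <;> norm_num
lemma stp_le (i : Fin (d+1)) : stp i ≤ 2 := by unfold stp; split_ifs <;> norm_num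

lemma pdeg_add (k l : Fin (d+1) → ℕ) : pdeg (k + l) = pdeg k + pdeg l := by
  simp only [pdeg, Pi.add_apply, Finset.sum_add_distrib]; ring

lemma pdeg_eI (i : Fin (d+1)) : pdeg (eI i) = stp i := by
  unfold pdeg eI stp
  rw [Finset.sum_pi_single']
  by_cases h : i = 0
  · subst h; simp
  · have h2 : (0 : Fin (d+1)) ≠ i := fun e => h e.symm
    simp [h, h2]

lemma mderiv_zero (f : Pt d → ℝ) : mderiv 0 f = f := by
  unfold mderiv
  induction List.finRange (d+1) with
  | nil => rfl
  | cons i l ih => simpa using ih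

lemma mderiv_outer (k : Fin (d+1) → ℕ) (j : Fin (d+1)) (hk : ∀ l < j, k l = 0) (f : Pt d → ℝ) :
    mderiv (k + eI j) f = pd j (mderiv k f) := by
  unfold mderiv
  obtain ⟨l1, l2, hl⟩ := List.append_of_mem (List.mem_finRange j)
  have hs : (List.finRange (d+1)).Pairwise (· < ·) := List.pairwise_lt_finRange (d+1)
  rw [hl] at hs ⊢
  rw [List.pairwise_append, List.pairwise_cons] at hs
  have h1 : ∀ (k' : Fin (d+1) → ℕ) (g : Pt d → ℝ), (∀ l < j, k' l = 0) →
      l1.foldr (fun i g => (pd i)^[k' i] g) g = g := by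
    intro k' g hk'
    have hlt : ∀ a ∈ l1, a < j := fun a ha => hs.2.2 a ha j (by simp)
    clear hl hs
    induction l1 with
    | nil => rfl
    | cons a l ih =>
      rw [List.foldr_cons, hk' a (hlt a (by simp)), Function.iterate_zero_apply]
      exact ih (fun b hb => hlt b (by simp [hb]))
  have h2 : ∀ g : Pt d → ℝ, l2.foldr (fun i g => (pd i)^[(k + eI j) i] g) g =
      l2.foldr (fun i g => (pd i)^[k i] g) g := by
    intro g
    have hlt : ∀ a ∈ l2, j < a := hs.2.1.1
    clear hl hs
    induction l2 with
    | nil => rfl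
    | cons a l ih =>
      have : (k + eI j) a = k a := by
        have := hlt a (by simp)
        simp [eI, Pi.single_apply, this.ne']
      rw [List.foldr_cons, List.foldr_cons, ih (fun b hb => hlt b (by simp [hb])), this]
  rw [List.foldr_append, List.foldr_append, List.foldr_cons, List.foldr_cons, h2,
    h1 _ _ hk, h1 _ _ (fun l hl => by simp [eI, Pi.single_apply, hk l hl, hl.ne])]
  have : (k + eI j) j = k j + 1 := by simp [eI]
  rw [this, Function.iterate_succ_apply']

/-- decomposition of a nonzero multiindex through its outermost derivative -/
lemma exists_outer (k : Fin (d+1) → ℕ) (hk : k ≠ 0) : ∃ (k' : Fin (d+1) → ℕ) (j : Fin (d+1)),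
    k = k' + eI j ∧ ∀ l < j, k' l = 0 := by
  classical
  have hne : ∃ j, k j ≠ 0 := by
    by_contra h; push Not at h; exact hk (funext h)
  let S := Finset.univ.filter fun j => k j ≠ 0
  have hS : S.Nonempty := by obtain ⟨j, hj⟩ := hne; exact ⟨j, by simp [S, hj]⟩
  let j := S.min' hS
  have hj : k j ≠ 0 := by have := S.min'_mem hS; simpa [S] using this
  have hmin : ∀ l < j, k l = 0 := by
    intro l hl
    by_contra h
    exact absurd (S.min'_le l (by simp [S, h])) (not_le.2 hl)
  refine ⟨k - eI j, j, ?_, fun l hl => by simp [hmin l hl]⟩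
  funext l
  by_cases h : l = j
  · subst h; simp [eI]; omega
  · simp [eI, Pi.single_apply, h]

lemma sum_add_eI (k : Fin (d+1) → ℕ) (j : Fin (d+1)) : ∑ i, (k + eI j) i = ∑ i, k i + 1 := by
  simp [Finset.sum_add_distrib, eI]

lemma clm_eq_sum (L : Pt d →L[ℝ] ℝ) : L = ∑ i, L (Pi.single i 1) • ContinuousLinearMap.proj (R := ℝ) (φ := fun _ : Fin (d+1) => ℝ) i := by
  refine ContinuousLinearMap.ext fun v => ?_
  conv_lhs => rw [pi_eq_sum_single v, map_sum]
  simp [mul_comm]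

lemma pd_comm {g : Pt d → ℝ} (hg : Differentiable ℝ g) (hg' : ∀ l, Differentiable ℝ (pd l g))
    (i j : Fin (d+1)) : pd i (pd j g) = pd j (pd i g) := by
  funext x
  have hf' : DifferentiableAt ℝ (fderiv ℝ g) x := by
    have : fderiv ℝ g = fun y => ∑ l, pd l g y • ContinuousLinearMap.proj (R := ℝ) (φ := fun _ : Fin (d+1) => ℝ) l := by
      funext y; exact clm_eq_sum _
    rw [this]
    have : ∀ l ∈ (Finset.univ : Finset (Fin (d+1))), DifferentiableAt ℝ (fun y => pd l g y • ContinuousLinearMap.proj (R := ℝ) (φ := fun _ : Fin (d+1) => ℝ) l) x :=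
      fun l _ => (hg' l x).smul_const _
    exact DifferentiableAt.fun_sum this
  have hs := second_derivative_symmetric (fun y => (hg y).hasFDerivAt) hf'.hasFDerivAt
    (Pi.single i 1) (Pi.single j 1)
  have key : ∀ a b : Fin (d+1), pd a (pd b g) x = fderiv ℝ (fderiv ℝ g) x (Pi.single a 1) (Pi.single b 1) := by
    intro a b
    have := (hf'.hasFDerivAt.clm_apply (hasFDerivAt_const (Pi.single b (1:ℝ) : Pt d) x)).fderiv
    unfold pd
    rw [this]; simp
  rw [key, key, hs]

lemma MemCpar.pd_mderiv {ρ : ℕ} {f : Pt d → ℝ} (hf : MemCpar ρ f) (k : Fin (d+1) → ℕ)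
    (hk : pdeg k + 2 ≤ ρ) (i : Fin (d+1)) : pd i (mderiv k f) = mderiv (k + eI i) f := by
  induction hs : ∑ l, k l generalizing k i with
  | zero =>
    have : k = 0 := by
      funext l; have := Finset.single_le_sum (f := k) (fun _ _ => Nat.zero_le _) (Finset.mem_univ l)
      simp; omega
    subst this
    rw [mderiv_outer 0 i (by simp)]
  | succ s ih =>
    have hk0 : k ≠ 0 := by rintro rfl; simp at hs
    obtain ⟨k', j, rfl, hj⟩ := exists_outer k hk0
    rw [sum_add_eI] at hs
    have hp := stp_pos j
    rw [pdeg_add, pdeg_eI] at hk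
    by_cases hji : j < i
    · rw [mderiv_outer k' j hj]
      have hd : Differentiable ℝ (mderiv k' f) := hf.1 k' (by omega)
      have hd' : ∀ l, Differentiable ℝ (pd l (mderiv k' f)) := fun l => by
        rw [ih k' (by omega) l (by omega)]
        apply hf.1
        have := stp_le l
        rw [pdeg_add, pdeg_eI]; omega
      rw [pd_comm hd hd' i j, ih k' (by omega) i (by omega),
        ← mderiv_outer (k' + eI i) j (fun l hl => by
          simp [eI, Pi.single_apply, hj l hl, (hl.trans hji).ne])]
      congr 1; abel
    · rw [← mderiv_outer]
      intro l hl
      have : l < j := lt_of_lt_of_le hl (not_lt.1 hji)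
      simp [eI, Pi.single_apply, hj l this, this.ne]

lemma MemCpar.mderiv_sub {ρ : ℕ} {f g : Pt d → ℝ} (hf : MemCpar ρ f) (hg : MemCpar ρ g)
    (k : Fin (d+1) → ℕ) (hk : pdeg k ≤ ρ) :
    mderiv k (fun z => f z - g z) = fun z => mderiv k f z - mderiv k g z := by
  induction hs : ∑ l, k l generalizing k with
  | zero =>
    have : k = 0 := by
      funext l; have := Finset.single_le_sum (f := k) (fun _ _ => Nat.zero_le _) (Finset.mem_univ l)
      simp; omega
    subst this
    simp [mderiv_zero]
  | succ s ih =>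
    have hk0 : k ≠ 0 := by rintro rfl; simp at hs
    obtain ⟨k', j, rfl, hj⟩ := exists_outer k hk0
    rw [sum_add_eI] at hs
    have hp := stp_pos j
    rw [pdeg_add, pdeg_eI] at hk
    rw [mderiv_outer _ _ hj, mderiv_outer _ _ hj, mderiv_outer _ _ hj, ih k' (by omega) (by omega)]
    funext z
    simp only [pd]
    rw [fderiv_fun_sub (hf.1 k' (by omega) z) (hg.1 k' (by omega) z)]; rfl

lemma MemCpar.sub {ρ : ℕ} {f g : Pt d → ℝ} (hf : MemCpar ρ f) (hg : MemCpar ρ g) :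
    MemCpar ρ (fun z => f z - g z) := by
  constructor
  · intro k hk
    rw [hf.mderiv_sub hg k hk.le]
    exact (hf.1 k hk).sub (hg.1 k hk)
  · intro k hk
    rw [hf.mderiv_sub hg k hk]
    obtain ⟨h1, M, hM⟩ := hf.2 k hk
    obtain ⟨h2, M', hM'⟩ := hg.2 k hk
    exact ⟨h1.sub h2, M + M', fun z => (abs_sub _ _).trans (add_le_add (hM z) (hM' z))⟩

lemma pdeg_lift {ρ : ℕ} (k : Fin (d+1) → ℕ) (hk : pdeg k ≤ ρ) :
    ∃ k' : Fin (d+1) → Fin (ρ+1), (fun i => (k' i : ℕ)) = k := by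
  have hs := sum_le_pdeg k
  have hj : ∀ i, k i < ρ + 1 := fun i => by
    have := Finset.single_le_sum (f := k) (fun _ _ => Nat.zero_le _) (Finset.mem_univ i); omega
  exact ⟨fun i => ⟨k i, hj i⟩, rfl⟩

lemma MemCpar.bddAbove {ρ : ℕ} {f : Pt d → ℝ} (hf : MemCpar ρ f) :
    BddAbove {y | ∃ (k : Fin (d + 1) → ℕ) (z : Pt d), pdeg k ≤ ρ ∧ y = |mderiv k f z|} := by
  have : ∀ k : Fin (d+1) → Fin (ρ+1), ∃ M, 0 ≤ M ∧ (pdeg (fun i => (k i : ℕ)) ≤ ρ →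
      ∀ z, |mderiv (fun i => (k i : ℕ)) f z| ≤ M) := by
    intro k
    by_cases h : pdeg (fun i => (k i : ℕ)) ≤ ρ
    · obtain ⟨-, M, hM⟩ := hf.2 _ h
      exact ⟨M, (abs_nonneg _).trans (hM 0), fun _ => hM⟩
    · exact ⟨0, le_rfl, fun h' => absurd h' h⟩
  choose M hM hb using this
  refine ⟨∑ k, M k, ?_⟩
  rintro y ⟨k, z, hk, rfl⟩
  obtain ⟨k', rfl⟩ := pdeg_lift k hk
  exact (hb k' hk z).trans (Finset.single_le_sum (f := M) (fun _ _ => hM _) (Finset.mem_univ k'))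

lemma MemCpar.le_norm {ρ : ℕ} {f : Pt d → ℝ} (hf : MemCpar ρ f) (k : Fin (d+1) → ℕ)
    (hk : pdeg k ≤ ρ) (z : Pt d) : |mderiv k f z| ≤ cparNorm ρ f :=
  le_csSup hf.bddAbove ⟨k, z, hk, rfl⟩

lemma cparNorm_nonneg (ρ : ℕ) (f : Pt d → ℝ) : 0 ≤ cparNorm ρ f := by
  apply Real.sSup_nonneg
  rintro y ⟨k, z, -, rfl⟩
  exact abs_nonneg _

lemma cparNorm_le_add {ρ : ℕ} {f g : Pt d → ℝ} (hf : MemCpar ρ f) (hg : MemCpar ρ g) :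
    cparNorm ρ g ≤ cparNorm ρ f + cparNorm ρ (fun z => f z - g z) := by
  apply Real.sSup_le
  · rintro y ⟨k, z, hk, rfl⟩
    have h1 := hf.le_norm k hk z
    have h2 := (hf.sub hg).le_norm k hk z
    rw [hf.mderiv_sub hg k hk] at h2
    have : |mderiv k g z| ≤ |mderiv k f z| + |mderiv k f z - mderiv k g z| := by
      have := abs_sub (mderiv k f z) (mderiv k f z - mderiv k g z)
      rwa [sub_sub_cancel] at this
    linarith
  · have := cparNorm_nonneg ρ f
    have := cparNorm_nonneg ρ (fun z => f z - g z)
    positivity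

/-- index type for the components of the coefficient field -/
abbrev Cmp (d : ℕ) := (Fin d × Fin d) ⊕ (Fin d ⊕ Unit)

def cmp (A : Coeffs d) : Cmp d → Pt d → ℝ
  | .inl ij => fun z => A.a z ij.1 ij.2
  | .inr (.inl i) => fun z => A.b z i
  | .inr (.inr _) => A.c

lemma ParReg.cmp {lam : ℝ} {ρ : ℕ} {A : Coeffs d} (h : ParReg lam ρ A) (q : Cmp d) :
    MemCpar ρ (cmp A q) := by
  rcases q with ij | i | i
  exacts [h.areg _ _, h.breg _, h.creg]

lemma coeffNorm_cmp_le {ρ : ℕ} (A : Coeffs d) (q : Cmp d) : cparNorm ρ (cmp A q) ≤ coeffNorm ρ A := by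
  have ha0 : 0 ≤ sSup {y | ∃ i j, y = cparNorm ρ fun z => A.a z i j} :=
    Real.sSup_nonneg (by rintro y ⟨i, j, rfl⟩; exact cparNorm_nonneg _ _)
  have hb0 : 0 ≤ sSup {y | ∃ i, y = cparNorm ρ fun z => A.b z i} :=
    Real.sSup_nonneg (by rintro y ⟨i, rfl⟩; exact cparNorm_nonneg _ _)
  have hc0 := cparNorm_nonneg ρ A.c
  unfold coeffNorm
  rcases q with ij | i | i
  · have : cparNorm ρ (cmp A (.inl ij)) ≤ sSup {y | ∃ i j, y = cparNorm ρ fun z => A.a z i j} := by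
      refine le_csSup ?_ ⟨ij.1, ij.2, rfl⟩
      apply Set.Finite.bddAbove
      apply (Set.finite_range fun ij : Fin d × Fin d => cparNorm ρ fun z => A.a z ij.1 ij.2).subset
      rintro y ⟨i, j, rfl⟩
      exact ⟨(i, j), rfl⟩
    linarith
  · have : cparNorm ρ (cmp A (.inr (.inl i))) ≤ sSup {y | ∃ i, y = cparNorm ρ fun z => A.b z i} := by
      refine le_csSup ?_ ⟨i, rfl⟩
      apply Set.Finite.bddAbove
      apply (Set.finite_range fun i : Fin d => cparNorm ρ fun z => A.b z i).subset
      rintro y ⟨i, rfl⟩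
      exact ⟨i, rfl⟩
    linarith
  · have : cparNorm ρ (cmp A (.inr (.inr i))) = cparNorm ρ A.c := rfl
    linarith

lemma cmp_sub (A B : Coeffs d) (q : Cmp d) : cmp (coeffSub A B) q = fun z => cmp A q z - cmp B q z := by
  rcases q with ij | i | i <;> rfl

lemma coeffDist_nonneg (ρ : ℕ) (A B : Coeffs d) : 0 ≤ coeffDist ρ A B :=
  (cparNorm_nonneg ρ _).trans (coeffNorm_cmp_le (ρ := ρ) (coeffSub A B) (.inr (.inr ())))

/-- the index type of admissible coefficients -/
abbrev Adm (d : ℕ) (lam : ℝ) (ρ : ℕ) := {A : Coeffs d // ParReg lam ρ A}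

noncomputable def idx (d : ℕ) (lam : ℝ) (ρ : ℕ) : Idx (Adm d lam ρ) where
  N := fun A => ∑ q, cparNorm ρ (cmp A.1 q)
  δ := fun A B => coeffDist ρ A.1 B.1
  δ_nonneg := fun A B => coeffDist_nonneg ρ A.1 B.1

variable {lam : ℝ} {ρ : ℕ}

lemma idx_N_le (A B : Adm d lam ρ) :
    (idx d lam ρ).N B ≤ (idx d lam ρ).N A + Fintype.card (Cmp d) * coeffDist ρ A.1 B.1 := by
  simp only [idx]
  have : ∀ q ∈ (Finset.univ : Finset (Cmp d)), cparNorm ρ (cmp B.1 q) ≤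
      cparNorm ρ (cmp A.1 q) + coeffDist ρ A.1 B.1 := by
    intro q _
    have h1 := cparNorm_le_add (A.2.cmp q) (B.2.cmp q)
    have h2 := coeffNorm_cmp_le (ρ := ρ) (coeffSub A.1 B.1) q
    rw [cmp_sub] at h2
    unfold coeffDist
    linarith
  refine (Finset.sum_le_sum this).trans ?_
  rw [Finset.sum_add_distrib]; simp

/-- families of jets of the coefficients -/
noncomputable def jet (k : Fin (d+1) → ℕ) (q : Cmp d) : Adm d lam ρ → Pt d → ℝ :=
  fun A => mderiv k (cmp A.1 q)

lemma Cb_jet (k : Fin (d+1) → ℕ) (q : Cmp d) (h : ℕ) (hk : pdeg k + 2 * h ≤ ρ) :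
    Cb (idx d lam ρ) h (jet k q) := by
  have hB : ∀ k, pdeg k ≤ ρ → Base (idx d lam ρ) (trivWt (Pt d)) 0 (fun A p _ => jet k q A p) := by
    intro k hk
    refine ⟨fun M => ⟨|M| + 1, 0, by positivity, fun A B hA hB p ω => ?_⟩,
      fun A _ => ((A.2.cmp q).2 k hk).1, fun A p => measurable_const⟩
    have e : (trivWt (Pt d)).wt 0 0 p ω = 1 := by simp [Wt.wt]
    rw [e, mul_one, mul_one]
    have hd := coeffDist_nonneg ρ A.1 B.1
    constructor
    · have h1 := (A.2.cmp q).le_norm k hk p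
      have h2 : cparNorm ρ (cmp A.1 q) ≤ (idx d lam ρ).N A :=
        Finset.single_le_sum (f := fun q => cparNorm ρ (cmp A.1 q)) (fun _ _ => cparNorm_nonneg _ _)
          (Finset.mem_univ q)
      have := le_abs_self M
      unfold jet
      linarith
    · have h1 := ((A.2.cmp q).sub (B.2.cmp q)).le_norm k hk p
      rw [(A.2.cmp q).mderiv_sub (B.2.cmp q) k hk] at h1
      have h2 := coeffNorm_cmp_le (ρ := ρ) (coeffSub A.1 B.1) q
      rw [cmp_sub] at h2
      have h3 : |jet k q A p - jet k q B p| ≤ coeffDist ρ A.1 B.1 := h1.trans h2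
      refine h3.trans ?_
      show _ ≤ (|M| + 1) * coeffDist ρ A.1 B.1
      nlinarith [abs_nonneg M]
  induction h generalizing k with
  | zero => exact hB k (by omega)
  | succ h ih =>
    refine ⟨hB k (by omega), fun A _ => (A.2.cmp q).1 k (by omega), fun e => ?_⟩
    have := Good.sum (I := idx d lam ρ) (W := trivWt (Pt d)) (ε := 0) (r := h) Finset.univ
      (F := fun (i : Fin (d+1)) A p _ => e i * jet (k + eI i) q A p)
      (fun i _ => Good.cmul (e i) (ih (k + eI i) (by
        have := stp_le i
        rw [pdeg_add, pdeg_eI]; omega)))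
    convert this using 1
    funext A p ω
    simp only [dirD]
    rw [pi_eq_sum_single e, map_sum]
    refine Finset.sum_congr rfl fun i _ => ?_
    rw [map_smul, smul_eq_mul]
    unfold jet
    rw [← (A.2.cmp q).pd_mderiv k (by omega) i, ← pi_eq_sum_single e]
    rfl

/-! ## Part 3b: ellipticity, inverse matrix and determinant -/

section invlog
variable {𝒜 E Ω : Type*} [NormedAddCommGroup E] [NormedSpace ℝ E] [MeasurableSpace Ω]
variable {I : Idx 𝒜} {W : Wt E Ω} {ε ε' : ℝ} {r : ℕ} {f g : 𝒜 → E → Ω → ℝ}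

lemma Base.inv (hf : Base I W 0 f) {c : ℝ} (hc : 0 < c) (hlow : ∀ A p ω, c ≤ f A p ω) :
    Base I W 0 (fun A p ω => (f A p ω)⁻¹) := by
  refine ⟨fun M => ?_, fun A ω => (hf.cont A ω).inv₀ fun p => (hc.trans_le (hlow A p ω)).ne',
    fun A p => (hf.meas A p).inv⟩
  obtain ⟨C, k, hC, h⟩ := hf.bdd M
  refine ⟨c⁻¹ + C * (c⁻¹ * c⁻¹), k, by positivity, fun A B hA hB p ω => ?_⟩
  have h1 := (h A B hA hB p ω).2
  have hw : 1 ≤ W.wt 0 k p ω := by simpa [Wt.wt] using one_le_pow₀ (W.one_le p ω)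
  have hδ := I.δ_nonneg A B
  have hfA := hlow A p ω
  have hfB := hlow B p ω
  have pA := hc.trans_le hfA
  have pB := hc.trans_le hfB
  have iA : (f A p ω)⁻¹ ≤ c⁻¹ := inv_anti₀ hc hfA
  have iB : (f B p ω)⁻¹ ≤ c⁻¹ := inv_anti₀ hc hfB
  constructor
  · rw [abs_of_pos (by positivity)]
    calc _ ≤ c⁻¹ * 1 := by linarith
      _ ≤ (c⁻¹ + C * (c⁻¹ * c⁻¹)) * W.wt 0 k p ω := by
        gcongr
        have : 0 ≤ C * (c⁻¹ * c⁻¹) := by positivity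
        linarith
  · have e : (f A p ω)⁻¹ - (f B p ω)⁻¹ = -(f A p ω - f B p ω) * ((f A p ω)⁻¹ * (f B p ω)⁻¹) := by
      field_simp; ring
    rw [e, abs_mul, abs_neg, abs_of_pos (a := (f A p ω)⁻¹ * (f B p ω)⁻¹) (by positivity)]
    calc _ ≤ (C * I.δ A B * W.wt 0 k p ω) * (c⁻¹ * c⁻¹) := by gcongr
      _ = C * (c⁻¹ * c⁻¹) * I.δ A B * W.wt 0 k p ω := by ring
      _ ≤ _ := by
        gcongr
        have : 0 < c⁻¹ := by positivity
        linarith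

lemma Good.inv (hf : Good I W 0 r f) {c : ℝ} (hc : 0 < c) (hlow : ∀ A p ω, c ≤ f A p ω) :
    Good I W 0 r (fun A p ω => (f A p ω)⁻¹) := by
  induction r with
  | zero => exact Base.inv hf hc hlow
  | succ r ih =>
    have hne : ∀ A p ω, f A p ω ≠ 0 := fun A p ω => (hc.trans_le (hlow A p ω)).ne'
    refine ⟨hf.1.inv hc hlow, fun A ω => (hf.2.1 A ω).inv (fun p => hne A p ω), fun e => ?_⟩
    have := (((ih hf.of_succ).pow 2).mul0 (hf.2.2 e)).neg
    convert this using 1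
    funext A p ω
    simp only [dirD]
    have e2 := ((hasDerivAt_inv (hne A p ω)).comp_hasFDerivAt p (hf.2.1 A ω p).hasFDerivAt)
    have e3 : fderiv ℝ (fun q => (f A q ω)⁻¹) p = _ := e2.fderiv
    rw [e3]
    simp

lemma abs_log_sub_log_le {c x y : ℝ} (hc : 0 < c) (hx : c ≤ x) (hy : c ≤ y) :
    |Real.log x - Real.log y| ≤ c⁻¹ * |x - y| := by
  have key : ∀ x y : ℝ, c ≤ x → c ≤ y → Real.log x - Real.log y ≤ c⁻¹ * |x - y| := by
    intro x y hx hy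
    have px := hc.trans_le hx
    have py := hc.trans_le hy
    rw [← Real.log_div px.ne' py.ne']
    have h1 := Real.log_le_sub_one_of_pos (div_pos px py)
    have h2 : x / y - 1 = y⁻¹ * (x - y) := by field_simp
    have h3 : y⁻¹ * (x - y) ≤ y⁻¹ * |x - y| := by gcongr; exact le_abs_self _
    have h4 : y⁻¹ * |x - y| ≤ c⁻¹ * |x - y| := by gcongr
    linarith
  rw [abs_le]
  constructor
  · have := key y x hy hx
    rw [abs_sub_comm] at this
    linarith
  · exact key x y hx hy

lemma Base.log (hf : Base I W 0 f) {c : ℝ} (hc : 0 < c) (hlow : ∀ A p ω, c ≤ f A p ω) :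
    Base I W 0 (fun A p ω => Real.log (f A p ω)) := by
  refine ⟨fun M => ?_, fun A ω => (hf.cont A ω).log fun p => (hc.trans_le (hlow A p ω)).ne',
    fun A p => (hf.meas A p).log⟩
  obtain ⟨C, k, hC, h⟩ := hf.bdd M
  refine ⟨c⁻¹ + C + C * c⁻¹, k, by positivity, fun A B hA hB p ω => ?_⟩
  have h1 := (h A B hA hB p ω).2
  have h0 := (h A B hA hB p ω).1
  have hw : 1 ≤ W.wt 0 k p ω := by simpa [Wt.wt] using one_le_pow₀ (W.one_le p ω)
  have hδ := I.δ_nonneg A B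
  have hfA := hlow A p ω
  have hfB := hlow B p ω
  have pA := hc.trans_le hfA
  have hci : 0 < c⁻¹ := by positivity
  have iA : (f A p ω)⁻¹ ≤ c⁻¹ := inv_anti₀ hc hfA
  constructor
  · have u1 := Real.log_le_sub_one_of_pos pA
    have u2 := Real.log_le_sub_one_of_pos (inv_pos.2 pA)
    rw [Real.log_inv] at u2
    have u3 := le_abs_self (f A p ω)
    have : |Real.log (f A p ω)| ≤ c⁻¹ * 1 + |f A p ω| := by
      rw [abs_le]; constructor <;> linarith [abs_nonneg (f A p ω)]
    calc _ ≤ c⁻¹ * W.wt 0 k p ω + C * W.wt 0 k p ω := this.trans (by gcongr)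
      _ = (c⁻¹ + C) * W.wt 0 k p ω := by ring
      _ ≤ _ := by
        have : 0 ≤ C * c⁻¹ := by positivity
        apply mul_le_mul_of_nonneg_right _ (by linarith)
        linarith
  · refine (abs_log_sub_log_le hc hfA hfB).trans ?_
    calc _ ≤ c⁻¹ * (C * I.δ A B * W.wt 0 k p ω) := by gcongr
      _ = C * c⁻¹ * I.δ A B * W.wt 0 k p ω := by ring
      _ ≤ _ := by
        gcongr
        linarith

lemma Good.log (hf : Good I W 0 r f) {c : ℝ} (hc : 0 < c) (hlow : ∀ A p ω, c ≤ f A p ω) :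
    Good I W 0 r (fun A p ω => Real.log (f A p ω)) := by
  cases r with
  | zero => exact Base.log hf hc hlow
  | succ r =>
    have hne : ∀ A p ω, f A p ω ≠ 0 := fun A p ω => (hc.trans_le (hlow A p ω)).ne'
    refine ⟨hf.1.log hc hlow, fun A ω => (hf.2.1 A ω).log (fun p => hne A p ω), fun e => ?_⟩
    have := (hf.of_succ.inv hc hlow).mul0 (hf.2.2 e)
    convert this using 1
    funext A p ω
    simp only [dirD]
    rw [((hf.2.1 A ω p).hasFDerivAt.log (hne A p ω)).fderiv]
    simp

end invlog

/-- quadratic form -/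
def qf (M : Matrix (Fin d) (Fin d) ℝ) (ζ : Fin d → ℝ) : ℝ := ∑ i, ∑ j, M i j * ζ i * ζ j

lemma qf_eq (M : Matrix (Fin d) (Fin d) ℝ) (ζ : Fin d → ℝ) : qf M ζ = dotProduct ζ (M.mulVec ζ) := by
  simp only [qf, dotProduct, Matrix.mulVec, Finset.mul_sum]
  exact Finset.sum_congr rfl fun i _ => Finset.sum_congr rfl fun j _ => by ring

section ell
variable {lam : ℝ} {ρ : ℕ} {A : Coeffs d} (hl : 0 < lam) (h : ParReg lam ρ A) (w : Pt d)
include hl h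

lemma ParReg.posDef : (A.a w).PosDef := by
  refine Matrix.PosDef.of_dotProduct_mulVec_pos ?_ ?_
  · exact Matrix.isHermitian_iff_isSymm.2 (h.symm w)
  · intro x hx
    have h1 := h.lower w x
    have h2 := qf_eq (A.a w) x
    simp only [qf] at h2
    have : 0 < ∑ i, x i ^ 2 := by
      obtain ⟨i, hi⟩ := Function.ne_iff.1 hx
      exact Finset.sum_pos' (fun i _ => sq_nonneg _) ⟨i, Finset.mem_univ _, by have : x i ≠ 0 := hi; positivity⟩
    have : 0 < lam * ∑ i, x i ^ 2 := by positivity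
    simp only [star_trivial]
    linarith

lemma ParReg.det_pos : 0 < (A.a w).det := (h.posDef hl w).det_pos

lemma ParReg.mul_inv : A.a w * (A.a w)⁻¹ = 1 :=
  Matrix.mul_nonsing_inv _ (h.det_pos hl w).ne'.isUnit

lemma ParReg.qf_inv (ξ : Fin d → ℝ) : qf (A.a w) ((A.a w)⁻¹.mulVec ξ) = qf (A.a w)⁻¹ ξ := by
  rw [qf_eq, qf_eq, Matrix.mulVec_mulVec, h.mul_inv hl w, Matrix.one_mulVec, dotProduct_comm]

lemma ParReg.inv_symm (i j : Fin d) : (A.a w)⁻¹ i j = (A.a w)⁻¹ j i := by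
  have := (Matrix.transpose_nonsing_inv (A.a w))
  rw [(h.symm w).eq] at this
  conv_rhs => rw [← this]
  rfl

lemma ParReg.inv_lower (ξ : Fin d → ℝ) : lam * ∑ i, ξ i ^ 2 ≤ qf (A.a w)⁻¹ ξ := by
  set ζ := (A.a w)⁻¹.mulVec ξ with hζ
  have haζ : (A.a w).mulVec ζ = ξ := by
    rw [hζ, Matrix.mulVec_mulVec, h.mul_inv hl w, Matrix.one_mulVec]
  have hsym : dotProduct ζ ((A.a w).mulVec ξ) = dotProduct ξ ξ := by
    rw [Matrix.dotProduct_mulVec, ← Matrix.mulVec_transpose, (h.symm w).eq, haζ]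
  have h0 : 0 ≤ qf (A.a w) (ζ - lam • ξ) := by
    refine le_trans ?_ (h.lower w _)
    exact mul_nonneg hl.le (Finset.sum_nonneg fun _ _ => sq_nonneg _)
  have h1 : qf (A.a w) (ζ - lam • ξ) = qf (A.a w)⁻¹ ξ - 2 * lam * dotProduct ξ ξ
      + lam^2 * qf (A.a w) ξ := by
    rw [← h.qf_inv hl w, ← hζ, qf_eq, qf_eq, qf_eq]
    simp only [Matrix.mulVec_sub, Matrix.mulVec_smul, dotProduct_sub, sub_dotProduct,
      smul_dotProduct, dotProduct_smul, haζ, hsym, smul_eq_mul]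
    rw [haζ] at *
    ring
  have h2 : dotProduct ξ ξ = ∑ i, ξ i ^ 2 := by simp [dotProduct, sq]
  have h3 : qf (A.a w) ξ ≤ lam⁻¹ * ∑ i, ξ i ^ 2 := h.upper w ξ
  have h4 : lam^2 * qf (A.a w) ξ ≤ lam * ∑ i, ξ i ^ 2 := by
    calc _ ≤ lam^2 * (lam⁻¹ * ∑ i, ξ i ^ 2) := by gcongr
      _ = _ := by field_simp
  rw [h2] at h1
  linarith

lemma ParReg.inv_entry (i j : Fin d) : |(A.a w)⁻¹ i j| ≤ lam⁻¹ := by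
  have key : ∀ j, lam * ∑ i, (A.a w)⁻¹ i j ^ 2 ≤ (A.a w)⁻¹ j j := by
    intro j
    have h1 := h.lower w ((A.a w)⁻¹.mulVec (Pi.single j 1))
    have h2 := h.qf_inv hl w (Pi.single j 1)
    rw [qf_eq (A.a w)⁻¹] at h2
    simp only [qf] at h2
    rw [h2] at h1
    simpa using h1
  have k2 : ∀ i j, lam * (A.a w)⁻¹ i j ^ 2 ≤ (A.a w)⁻¹ j j := by
    intro i j
    refine le_trans ?_ (key j)
    gcongr
    exact Finset.single_le_sum (f := fun i => (A.a w)⁻¹ i j ^ 2) (fun _ _ => sq_nonneg _) (Finset.mem_univ i)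
  have k3 : (A.a w)⁻¹ j j ≤ lam⁻¹ := by
    have := k2 j j
    by_contra hc
    push Not at hc
    have hpos : 0 < (A.a w)⁻¹ j j := (by positivity : 0 < lam⁻¹).trans hc
    have : lam * (A.a w)⁻¹ j j ≤ 1 := by
      have h5 : lam * (A.a w)⁻¹ j j * (A.a w)⁻¹ j j ≤ 1 * (A.a w)⁻¹ j j := by nlinarith
      exact le_of_mul_le_mul_right h5 hpos
    have : (A.a w)⁻¹ j j ≤ lam⁻¹ := by
      rw [inv_eq_one_div lam, le_div_iff₀ hl]; linarith
    linarith
  apply abs_le_of_sq_le_sq _ (by positivity)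
  have := (k2 i j).trans k3
  calc (A.a w)⁻¹ i j ^ 2 = lam⁻¹ * (lam * (A.a w)⁻¹ i j ^ 2) := by field_simp
    _ ≤ lam⁻¹ * lam⁻¹ := by gcongr
    _ = _ := by ring

lemma ParReg.det_inv : ((A.a w).det)⁻¹ = ((A.a w)⁻¹).det := by
  rw [Matrix.det_nonsing_inv, Ring.inverse_eq_inv']

end ell

lemma exists_det_lower (d : ℕ) {lam : ℝ} (hl : 0 < lam) : ∃ c : ℝ, 0 < c ∧ ∀ (ρ : ℕ) (A : Coeffs d),
    ParReg lam ρ A → ∀ w, c ≤ (A.a w).det := by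
  have h0 : 0 < ((d.factorial : ℝ) * (lam⁻¹)^d) := by positivity
  refine ⟨((d.factorial : ℝ) * (lam⁻¹)^d)⁻¹, by positivity, fun ρ A h w => ?_⟩
  have h1 := Matrix.det_le (A := (A.a w)⁻¹) (abv := (IsAbsoluteValue.toAbsoluteValue (abs : ℝ → ℝ))) (x := lam⁻¹)
    (fun i j => h.inv_entry hl w i j)
  have h2 : |((A.a w)⁻¹).det| ≤ (d.factorial : ℝ) * (lam⁻¹)^d := by
    simpa [nsmul_eq_mul] using h1
  rw [← h.det_inv hl w] at h2
  have h3 := (le_abs_self _).trans h2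
  have h4 := h.det_pos hl w
  exact inv_le_of_inv_le₀ h4 h3

/-! ## Part 3c: algebra of jets -/

section jetalg
variable {lam : ℝ} {ρ r : ℕ}

noncomputable def pdF (i : Fin (d+1)) (g : Adm d lam ρ → Pt d → ℝ) : Adm d lam ρ → Pt d → ℝ :=
  fun A => pd i (g A)

noncomputable def JetAlg (d : ℕ) (lam : ℝ) (ρ r : ℕ) : Subalgebra ℝ (Adm d lam ρ → Pt d → ℝ) :=
  Algebra.adjoin ℝ {f | ∃ v : (Fin (d + 1) → ℕ) × CoeffVar d, pdeg v.1 ≤ r ∧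
    f = fun A w => coeffEval A.1 w v}

def J0 (r : ℕ) (g : Adm d lam ρ → Pt d → ℝ) : Prop :=
  Cb (idx d lam ρ) r g ∧ g ∈ JetAlg d lam ρ r

inductive JetGood (r : ℕ) : ℕ → (Adm d lam ρ → Pt d → ℝ) → Prop
  | mk (N : ℕ) (g : Adm d lam ρ → Pt d → ℝ) (h0 : J0 r g)
      (h1 : ∀ i, 0 < N → JetGood r (N - stp i) (pdF i g)) : JetGood r N g

variable {g g' : Adm d lam ρ → Pt d → ℝ} {N N' : ℕ}

lemma JetGood.j0 (h : JetGood r N g) : J0 r g := by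
  cases h; assumption

lemma JetGood.pdF (h : JetGood r N g) (i : Fin (d+1)) (hN : 0 < N) : JetGood r (N - stp i) (pdF i g) := by
  cases h with | mk _ _ h0 h1 => exact h1 i hN

lemma Cb.diff (h : Cb (idx d lam ρ) r g) (hr : 0 < r) (A : Adm d lam ρ) : Differentiable ℝ (g A) := by
  cases r with
  | zero => omega
  | succ r => exact h.2.1 A ()

lemma JetGood.diff (h : JetGood r N g) (hr : 0 < r) (A : Adm d lam ρ) : Differentiable ℝ (g A) :=
  h.j0.1.diff hr A

lemma JetGood.mono (h : JetGood r N g) (hN : N' ≤ N) : JetGood r N' g := by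
  induction h generalizing N' with
  | mk N g h0 h1 ih =>
    exact ⟨_, _, h0, fun i hi => ih i (by omega) (by omega)⟩

lemma J0.add (h : J0 r g) (h' : J0 r g') : J0 r (fun A w => g A w + g' A w) :=
  ⟨h.1.add h'.1, add_mem h.2 h'.2⟩

lemma J0.mul (h : J0 r g) (h' : J0 r g') : J0 r (fun A w => g A w * g' A w) :=
  ⟨h.1.mul0 h'.1, mul_mem h.2 h'.2⟩

lemma J0.const (c : ℝ) : J0 (lam := lam) (ρ := ρ) (d := d) r (fun _ _ => c) :=
  ⟨Good.const c, (JetAlg d lam ρ r).algebraMap_mem c⟩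

lemma JetGood.add (hr : 0 < r) (h : JetGood r N g) (h' : JetGood r N g') :
    JetGood r N (fun A w => g A w + g' A w) := by
  induction N using Nat.strong_induction_on generalizing g g' with
  | _ N ih =>
    refine ⟨_, _, h.j0.add h'.j0, fun i hi => ?_⟩
    have := stp_pos i
    convert ih (N - stp i) (by omega) (h.pdF i hi) (h'.pdF i hi) using 1
    funext A w
    simp only [VarBPHZ.pdF, pd]
    rw [fderiv_fun_add (h.diff hr A w) (h'.diff hr A w)]; rfl

lemma JetGood.mul (hr : 0 < r) (h : JetGood r N g) (h' : JetGood r N g') :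
    JetGood r N (fun A w => g A w * g' A w) := by
  induction N using Nat.strong_induction_on generalizing g g' with
  | _ N ih =>
    refine ⟨_, _, h.j0.mul h'.j0, fun i hi => ?_⟩
    have := stp_pos i
    convert (ih (N - stp i) (by omega) (h.mono (by omega)) (h'.pdF i hi)).add hr
      (ih (N - stp i) (by omega) (h.pdF i hi) (h'.mono (by omega))) using 1
    funext A w
    simp only [VarBPHZ.pdF, pd]
    rw [fderiv_fun_mul (h.diff hr A w) (h'.diff hr A w)]; simp [mul_comm]

lemma JetGood.const (c : ℝ) : JetGood (lam := lam) (ρ := ρ) (d := d) r N (fun _ _ => c) := by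
  induction N using Nat.strong_induction_on generalizing c with
  | _ N ih =>
    refine ⟨_, _, J0.const c, fun i hi => ?_⟩
    have := stp_pos i
    convert ih (N - stp i) (by omega) 0 using 1
    funext A w
    simp [VarBPHZ.pdF, pd]

lemma JetGood.sum (hr : 0 < r) {ι : Type*} (s : Finset ι) {F : ι → Adm d lam ρ → Pt d → ℝ}
    (h : ∀ i ∈ s, JetGood r N (F i)) : JetGood r N (fun A w => ∑ i ∈ s, F i A w) := by
  classical
  induction s using Finset.induction_on with
  | empty => simpa using JetGood.const 0
  | insert i s hi ih =>
    simp only [Finset.sum_insert hi]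
    exact (h i (by simp)).add hr (ih fun j hj => h j (by simp [hj]))

lemma JetGood.prod (hr : 0 < r) {ι : Type*} (s : Finset ι) {F : ι → Adm d lam ρ → Pt d → ℝ}
    (h : ∀ i ∈ s, JetGood r N (F i)) : JetGood r N (fun A w => ∏ i ∈ s, F i A w) := by
  classical
  induction s using Finset.induction_on with
  | empty => simpa using JetGood.const 1
  | insert i s hi ih =>
    simp only [Finset.prod_insert hi]
    exact (h i (by simp)).mul hr (ih fun j hj => h j (by simp [hj]))

lemma JetGood.det (hr : 0 < r) {m : ℕ} {F : Fin m → Fin m → Adm d lam ρ → Pt d → ℝ}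
    (h : ∀ i j, JetGood r N (F i j)) :
    JetGood r N (fun A w => (Matrix.of fun i j => F i j A w).det) := by
  simp only [Matrix.det_apply']
  exact JetGood.sum hr _ fun σ _ => (JetGood.const _).mul hr (JetGood.prod hr _ fun i _ => h _ _)

lemma mem_JetAlg_of (v : (Fin (d + 1) → ℕ) × CoeffVar d) (hv : pdeg v.1 ≤ r) :
    (fun A w => coeffEval A.1 w v) ∈ JetAlg d lam ρ r := Algebra.subset_adjoin ⟨v, hv, rfl⟩

/-- formal variable of a component -/
def cvar : Cmp d → CoeffVar d
  | .inl ij => .aa ij.1 ij.2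
  | .inr (.inl i) => .bb i
  | .inr (.inr _) => .cc

lemma jet_eq (k : Fin (d+1) → ℕ) (q : Cmp d) :
    (jet k q : Adm d lam ρ → Pt d → ℝ) = fun A w => coeffEval A.1 w (k, cvar q) := by
  rcases q with ij | i | i <;> rfl

lemma JetGood_jet (hρ : 3 * r ≤ ρ) (hr : 2 < r) (k : Fin (d+1) → ℕ) (q : Cmp d) (hk : pdeg k ≤ r)
    (hN : 0 < N → pdeg k + N + 1 ≤ r) : JetGood (lam := lam) (ρ := ρ) r N (jet k q) := by
  induction N using Nat.strong_induction_on generalizing k with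
  | _ N ih =>
    refine ⟨_, _, ⟨Cb_jet k q r (by omega), ?_⟩, fun i hi => ?_⟩
    · rw [jet_eq]; exact mem_JetAlg_of _ hk
    · have h1 := stp_pos i
      have h2 := stp_le i
      have h3 := hN hi
      have e : VarBPHZ.pdF i (jet k q : Adm d lam ρ → Pt d → ℝ) = jet (k + eI i) q := by
        funext A
        exact (A.2.cmp q).pd_mderiv k (by omega) i
      rw [e]
      apply ih _ (by omega) <;> rw [pdeg_add, pdeg_eI] <;> omega

lemma pdeg_zero' : pdeg (0 : Fin (d+1) → ℕ) = 0 := by simp [pdeg]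

lemma jet0_a (i j : Fin d) : (jet 0 (.inl (i, j)) : Adm d lam ρ → Pt d → ℝ) = fun A w => A.1.a w i j := by
  funext A w; simp [jet, mderiv_zero, cmp]
lemma jet0_b (i : Fin d) : (jet 0 (.inr (.inl i)) : Adm d lam ρ → Pt d → ℝ) = fun A w => A.1.b w i := by
  funext A w; simp [jet, mderiv_zero, cmp]
lemma jet0_c : (jet 0 (.inr (.inr ())) : Adm d lam ρ → Pt d → ℝ) = fun A w => A.1.c w := by
  funext A w; simp [jet, mderiv_zero, cmp]

variable (hl : 0 < lam) (hρ : 3 * r ≤ ρ) (hr : 2 < r)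
include hρ hr

lemma JetGood_cmp (q : Cmp d) : JetGood (lam := lam) (ρ := ρ) r (r-1) (fun A w => cmp A.1 q w) := by
  have := JetGood_jet (lam := lam) (N := r-1) hρ hr 0 q (by rw [pdeg_zero']; omega)
    (by rw [pdeg_zero']; omega)
  have e : (jet 0 q : Adm d lam ρ → Pt d → ℝ) = fun A w => cmp A.1 q w := by
    funext A w; simp [jet, mderiv_zero]
  rwa [e] at this

lemma JetGood_det : JetGood (lam := lam) (ρ := ρ) r (r-1) (fun (A : Adm d lam ρ) w => (A.1.a w).det) :=
  JetGood.det (d := d) (by omega) fun i j => JetGood_cmp hρ hr (.inl (i, j))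

include hl

lemma J0_D1 : J0 (lam := lam) (ρ := ρ) r (fun (A : Adm d lam ρ) w => ((A.1.a w).det)⁻¹) := by
  obtain ⟨c, hc, h⟩ := exists_det_lower d hl
  refine ⟨Good.inv (JetGood_det hρ hr).j0.1 hc fun A p _ => h ρ A.1 A.2 p, ?_⟩
  have e : (fun (A : Adm d lam ρ) w => ((A.1.a w).det)⁻¹) =
      ∑ σ : Equiv.Perm (Fin d), algebraMap ℝ (Adm d lam ρ → Pt d → ℝ) ((Equiv.Perm.sign σ : ℤ) : ℝ) *
      ∏ i, fun A w => coeffEval A.1 w (0, .ai (σ i) i) := by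
    funext A w
    rw [A.2.det_inv hl w, Matrix.det_apply']
    simp [coeffEval, mderiv_zero, Finset.sum_apply, Finset.prod_apply]
  rw [e]
  refine sum_mem fun σ _ => mul_mem (Subalgebra.algebraMap_mem _ _) (prod_mem fun i _ => ?_)
  exact mem_JetAlg_of _ (by simp [pdeg_zero'])

lemma JetGood_D1 (hN : N ≤ r - 1) :
    JetGood (lam := lam) (ρ := ρ) r N (fun (A : Adm d lam ρ) w => ((A.1.a w).det)⁻¹) := by
  induction N using Nat.strong_induction_on with
  | _ N ih =>
    refine ⟨_, _, J0_D1 hl hρ hr, fun i hi => ?_⟩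
    have h1 := stp_pos i
    have h2 := ih (N - stp i) (by omega) (by omega)
    have h3 := ((JetGood_det (lam := lam) (d := d) hρ hr).mono hN).pdF i hi
    have := (JetGood.const (-1)).mul (by omega) (((h2.mul (by omega) h2).mul (by omega) h3))
    convert this using 1
    funext A w
    have hd := (JetGood_det (lam := lam) (d := d) hρ hr).diff (by omega) A w
    have e2 := ((hasDerivAt_inv (A.2.det_pos hl w).ne').comp_hasFDerivAt w hd.hasFDerivAt)
    have e3 : fderiv ℝ (fun w => ((A.1.a w).det)⁻¹) w = _ := e2.fderiv
    simp only [VarBPHZ.pdF, pd]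
    rw [e3]
    simp [sq]

omit hl hρ hr in
noncomputable def AI (i j : Fin d) : Adm d lam ρ → Pt d → ℝ := fun A w => (A.1.a w)⁻¹ i j

lemma JetGood_AI (i j : Fin d) : JetGood (lam := lam) (ρ := ρ) r (r-1) (AI i j) := by
  have h1 : JetGood (lam := lam) (ρ := ρ) r (r-1) (fun A w => (A.1.a w).adjugate i j) := by
    have := JetGood.det (lam := lam) (ρ := ρ) (r := r) (N := r-1) (by omega)
      (F := fun i' j' A w => (A.1.a w).updateRow j (Pi.single i 1) i' j') (fun i' j' => by
        simp only [Matrix.updateRow_apply]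
        split_ifs
        · exact JetGood.const _
        · exact JetGood_cmp hρ hr (.inl (i', j')))
    simp only [Matrix.adjugate_apply]
    exact this
  have := (JetGood_D1 hl hρ hr le_rfl).mul (by omega) h1
  convert this using 1
  funext A w
  simp [AI, Matrix.inv_def]

omit hl hρ hr in
noncomputable def LD : Adm d lam ρ → Pt d → ℝ := fun A w => Real.log (A.1.a w).det

lemma Cb_LD : Cb (idx d lam ρ) r LD := by
  obtain ⟨c, hc, h⟩ := exists_det_lower d hl
  exact Good.log (JetGood_det hρ hr).j0.1 hc fun A p _ => h ρ A.1 A.2 p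

lemma JetGood_pdLD (i : Fin (d+1)) : JetGood (lam := lam) (ρ := ρ) r (r-3) (pdF i LD) := by
  have h1 := stp_le i
  have h3 := ((JetGood_det (lam := lam) (d := d) hρ hr).pdF i (by omega)).mono (N' := r-3) (by omega)
  convert (JetGood_D1 hl hρ hr (by omega)).mul (by omega) h3 using 1
  funext A w
  have hd := (JetGood_det (lam := lam) (d := d) hρ hr).diff (by omega) A w
  have e2 : fderiv ℝ (LD A) w = _ := (hd.hasFDerivAt.log (A.2.det_pos hl w).ne').fderiv
  simp only [pdF, pd]
  rw [e2]
  simp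

lemma JetGood_pdAI (i : Fin (d+1)) (j l : Fin d) :
    JetGood (lam := lam) (ρ := ρ) r (r-3) (pdF i (AI j l)) := by
  have h1 := stp_le i
  exact ((JetGood_AI hl hρ hr j l).pdF i (by omega)).mono (by omega)

omit hl in
lemma JetGood_pdcmp (i : Fin (d+1)) (q : Cmp d) :
    JetGood (lam := lam) (ρ := ρ) r (r-3) (pdF i (fun A w => cmp A.1 q w)) := by
  have h1 := stp_le i
  exact ((JetGood_cmp hρ hr q).pdF i (by omega)).mono (by omega)

end jetalg

/-! ## Part 4a: Taylor expansion operators -/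

section compx
variable {𝒜 E Ω Ω' : Type*} [NormedAddCommGroup E] [NormedSpace ℝ E] [MeasurableSpace Ω]
  [MeasurableSpace Ω']
variable {I : Idx 𝒜} {W : Wt E Ω} {W' : Wt E Ω'} {r : ℕ} {ε : ℝ}

lemma Good.comp' {g : 𝒜 → Pt d → ℝ} (hg : Cb I r g) (ℓ : E →L[ℝ] Pt d) {Y : E → Ω → Pt d}
    (hx : ∀ i, Good I W 0 r (fun _ p ω => Y p ω i)) [FiniteDimensional ℝ E] [Nonempty 𝒜] :
    Good I W 0 r (fun A p ω => g A (ℓ p + Y p ω)) := by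
  have A₀ : 𝒜 := Classical.arbitrary 𝒜
  have hcont : ∀ r, (∀ i, Good I W 0 r (fun (_ : 𝒜) p ω => Y p ω i)) → ∀ ω, Continuous fun p => ℓ p + Y p ω :=
    fun r hx ω => ℓ.continuous.add (continuous_pi fun i => (hx i).base.cont A₀ ω)
  have hmeas : ∀ r, (∀ i, Good I W 0 r (fun (_ : 𝒜) p ω => Y p ω i)) → ∀ p, Measurable fun ω => ℓ p + Y p ω :=
    fun r hx p => measurable_const.add (measurable_pi_lambda _ fun i => (hx i).base.meas A₀ p)
  induction r generalizing g with
  | zero => exact Base.comp hg (hcont _ hx) (hmeas _ hx)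
  | succ r ih =>
    refine ⟨Base.comp hg.1 (hcont _ hx) (hmeas _ hx), fun A ω => ?_, fun e => ?_⟩
    · exact (hg.2.1 A ()).comp (ℓ.differentiable.add (differentiable_pi.2 fun i => (hx i).2.1 A ω))
    · have := Good.sum (I := I) (W := W) (ε := 0) (r := r) Finset.univ (F := fun (i : Fin (d+1)) A p ω =>
          (ℓ e i + dirD e (fun (_ : 𝒜) p ω => Y p ω i) A p ω) * pd i (g A) (ℓ p + Y p ω))
        (fun i _ => ((Good.const _).add ((hx i).2.2 e)).mul0
          (ih (hg.2.2 (Pi.single i 1)) fun i => (hx i).of_succ))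
      convert this using 1
      funext A p ω
      simp only [dirD]
      have hd : DifferentiableAt ℝ (fun q => Y q ω) p :=
        differentiableAt_pi.2 fun i => (hx i).2.1 A ω p
      have h1 := (hg.2.1 A () (ℓ p + Y p ω)).hasFDerivAt.comp p (ℓ.hasFDerivAt.add hd.hasFDerivAt)
      have h2 : fderiv ℝ (fun q => g A (ℓ q + Y q ω)) p = _ := h1.fderiv
      rw [h2]
      simp only [ContinuousLinearMap.comp_apply]
      rw [pi_eq_sum_single ((ℓ + fderiv ℝ (fun q => Y q ω) p) e), map_sum]
      refine Finset.sum_congr rfl fun i _ => ?_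
      rw [map_smul, smul_eq_mul, fderiv_pi fun i => (hx i).2.1 A ω p]
      rfl

/-- pulling back along a measurable map -/
lemma Good.pull {f : 𝒜 → E → Ω → ℝ} (hf : Good I W ε r f) {π : Ω' → Ω} (hπ : Measurable π)
    (hG : ∀ p ω, W.G p (π ω) ≤ W'.G p ω) (hH : ∀ p ω, W'.H p ω ≤ W.H p (π ω)) (hε : 0 ≤ ε) :
    Good I W' ε r (fun A p ω => f A p (π ω)) := by
  have hB : ∀ f : 𝒜 → E → Ω → ℝ, Base I W ε f → Base I W' ε (fun A p ω => f A p (π ω)) := by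
    intro f hf
    refine ⟨fun M => ?_, fun A ω => hf.cont A (π ω), fun A p => (hf.meas A p).comp hπ⟩
    obtain ⟨C, k, hC, h⟩ := hf.bdd M
    refine ⟨C, k, hC, fun A B hA hB p ω => ?_⟩
    have hw : W.wt ε k p (π ω) ≤ W'.wt ε k p ω := by
      unfold Wt.wt
      have h1 := W.one_le p (π ω)
      have h2 := hG p ω
      have h3 := hH p ω
      have h4 : 0 ≤ W'.G p ω ^ k := by have := W'.one_le p ω; positivity
      gcongr
    have hδ := I.δ_nonneg A B
    obtain ⟨h1, h2⟩ := h A B hA hB p (π ω)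
    exact ⟨h1.trans (by gcongr), h2.trans (by gcongr)⟩
  induction r generalizing f with
  | zero => exact hB f hf
  | succ r ih => exact ⟨hB f hf.1, fun A ω => hf.2.1 A (π ω), fun e => ih (hf.2.2 e)⟩

def Wt.ext (W : Wt E Ω) (Θ : Type*) : Wt E (Ω × Θ) where
  G := fun p ω => W.G p ω.1
  H := fun p ω => W.H p ω.1
  one_le := fun p ω => W.one_le p ω.1
  H_nonneg := fun p ω => W.H_nonneg p ω.1
  G_cont := fun ω => W.G_cont ω.1

lemma Good.ext {Θ : Type*} [MeasurableSpace Θ] {f : 𝒜 → E → Ω → ℝ} (hf : Good I W ε r f) (hε : 0 ≤ ε) :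
    Good I (W.ext Θ) ε r (fun A p ω => f A p ω.1) :=
  hf.pull measurable_fst (fun _ _ => le_rfl) (fun _ _ => le_rfl) hε

noncomputable def Fib.ext (W : Wt E Ω) {Θ : Type*} [MeasurableSpace Θ] (ν : Measure Θ) [IsFiniteMeasure ν]
    (hε : 0 ≤ ε) : Fib W (W.ext Θ) ε ν where
  j := fun ω θ => (ω, θ)
  γ := fun _ => 0
  j_meas := measurable_id
  γ_nonneg := fun _ => le_rfl
  hG := fun p ω θ => by simp [Wt.ext]
  hH := fun p ω θ => by simp [Wt.ext]
  hitg := fun k => by simp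
  eps_nonneg := hε

lemma Good.integral {Θ : Type*} [MeasurableSpace Θ] (ν : Measure Θ) [IsFiniteMeasure ν] [FiniteDimensional ℝ E]
    {f : 𝒜 → E → Ω × Θ → ℝ} (hf : Good I (W.ext Θ) ε r f) (hε : 0 ≤ ε) :
    Good I W ε r (fun A p ω => ∫ θ, f A p (ω, θ) ∂ν) :=
  (Fib.ext W ν hε).good hf

lemma Good.integrable {Θ : Type*} [MeasurableSpace Θ] (ν : Measure Θ) [IsFiniteMeasure ν] [FiniteDimensional ℝ E]
    {f : 𝒜 → E → Ω × Θ → ℝ} (hf : Good I (W.ext Θ) ε r f) (hε : 0 ≤ ε) (A : 𝒜) (p : E) (ω : Ω) :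
    Integrable (fun θ => f A p (ω, θ)) ν :=
  (Fib.ext W ν hε).integrable hf.base A p ω

end compx

/-- Taylor remainder functional -/
noncomputable def Tay (m : ℕ) (φ : ℝ → ℝ) : ℝ :=
  match m with
  | 0 => φ 1
  | m + 1 => ∫ τ : unitInterval, (1 - (τ:ℝ)) ^ m / m.factorial * φ τ

lemma integral_unitInterval (φ : ℝ → ℝ) : ∫ τ : unitInterval, φ τ = ∫ τ in (0:ℝ)..1, φ τ := by
  have := integral_subtype_comap (μ := (volume : Measure ℝ)) measurableSet_Icc (s := Set.Icc (0:ℝ) 1) φ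
  rw [intervalIntegral.integral_of_le zero_le_one, ← integral_Icc_eq_integral_Ioc, ← this]
  rfl

lemma Tay_succ (m : ℕ) (φ φ' : ℝ → ℝ) (h : ∀ x, HasDerivAt φ (φ' x) x) (hc : Continuous φ') :
    Tay m φ = φ 0 / m.factorial + Tay (m+1) φ' := by
  cases m with
  | zero =>
    simp only [Tay]
    rw [integral_unitInterval (fun τ => (1 - (τ:ℝ)) ^ 0 / (Nat.factorial 0 : ℕ) * φ' τ)]
    simp only [pow_zero, Nat.factorial_zero, Nat.cast_one, div_one, one_mul]
    rw [intervalIntegral.integral_eq_sub_of_hasDerivAt (fun x _ => h x) (hc.intervalIntegrable _ _)]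
    ring
  | succ m =>
    simp only [Tay]
    rw [integral_unitInterval (fun τ => (1 - (τ:ℝ)) ^ m / m.factorial * φ τ),
      integral_unitInterval (fun τ => (1 - (τ:ℝ)) ^ (m+1) / (m+1).factorial * φ' τ)]
    have hf : (m.factorial : ℝ) ≠ 0 := by positivity
    have hu : ∀ x : ℝ, HasDerivAt (fun τ : ℝ => -((1 - τ) ^ (m+1) / (m+1).factorial))
        ((1 - x) ^ m / m.factorial) x := by
      intro x
      have h1 : HasDerivAt (fun τ : ℝ => (1 - τ) ^ (m+1)) _ x := ((hasDerivAt_id x).const_sub 1).pow (m+1)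
      refine (h1.div_const ((m+1).factorial : ℝ)).fun_neg.congr_deriv ?_
      rw [Nat.factorial_succ]
      push_cast
      field_simp
      simp
    have hcφ : Continuous φ := continuous_iff_continuousAt.2 fun x => (h x).continuousAt
    have := intervalIntegral.integral_deriv_mul_eq_sub (a := 0) (b := 1) (fun x _ => hu x) (fun x _ => h x)
      ((by fun_prop : Continuous fun x : ℝ => (1 - x) ^ m / (m.factorial:ℝ)).intervalIntegrable _ _)
      (hc.intervalIntegrable _ _)
    rw [intervalIntegral.integral_add ((by fun_prop : Continuous _).intervalIntegrable _ _)
      ((by fun_prop : Continuous _).intervalIntegrable _ _)] at this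
    simp only [neg_mul, intervalIntegral.integral_neg] at this
    simp at this
    simp only [Nat.factorial_succ, Nat.cast_mul, Nat.cast_add, Nat.cast_one] at this ⊢
    have e : φ 0 / ((m + 1) * m.factorial : ℝ) = ((m + 1) * m.factorial : ℝ)⁻¹ * φ 0 := by
      field_simp
    rw [e]
    linarith

lemma exp_taylor (m : ℕ) (x : ℝ) : Real.exp (-x) = ∑ k ∈ Finset.range m, (-x) ^ k / k.factorial +
    (-x) ^ m * Tay m (fun τ => Real.exp (-(τ * x))) := by
  induction m with
  | zero => simp [Tay]
  | succ m ih =>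
    rw [Finset.sum_range_succ, ih]
    have := Tay_succ m (fun τ => Real.exp (-(τ * x))) (fun τ => (-x) * Real.exp (-(τ * x)))
      (fun τ => by
        refine (((hasDerivAt_id τ).mul_const x).fun_neg.exp).congr_deriv ?_
        simp [mul_comm]) (by fun_prop)
    rw [this]
    have e : Tay (m+1) (fun τ => (-x) * Real.exp (-(τ * x))) = (-x) * Tay (m+1) (fun τ => Real.exp (-(τ * x))) := by
      simp only [Tay]
      rw [← integral_const_mul]
      congr 1; funext τ; ring
    rw [e]
    simp
    ring

section hf
variable {Ω : Type*} [MeasurableSpace Ω] {lam : ℝ} {ρ r : ℕ}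
  {W : Wt (Pt d × Pt d) Ω} {g : Adm d lam ρ → Pt d → ℝ}

lemma Good.tay {𝒜 E Ω : Type*} [NormedAddCommGroup E] [NormedSpace ℝ E] [FiniteDimensional ℝ E]
    [MeasurableSpace Ω] {I : Idx 𝒜} {W : Wt E Ω} {ε : ℝ} (hε : 0 ≤ ε) {r : ℕ} (m : ℕ) {f : 𝒜 → E → Ω → ℝ → ℝ}
    (hf : Good I (W.ext unitInterval) ε r (fun A p ω => f A p ω.1 ω.2)) :
    Good I W ε r (fun A p ω => Tay m (f A p ω)) := by
  cases m with
  | zero =>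
    have : Good I W ε r (fun A p ω => (fun A p (ω : Ω × unitInterval) => f A p ω.1 ω.2) A p (ω, (1 : unitInterval))) :=
      hf.pull (W' := W) (π := fun ω => (ω, (1 : unitInterval)))
      (by fun_prop) (fun _ _ => le_rfl) (fun _ _ => le_rfl) hε
    simpa [Tay] using this
  | succ m =>
    have h2 : Good I (W.ext unitInterval) 0 r (fun _ _ ω => (1 - (ω.2:ℝ)) ^ m / m.factorial) := by
      refine Good.omega (C := 1) (k := 0) (by fun_prop) zero_le_one fun p ω => ?_
      have h0 := ω.2.2.1
      have h1 := ω.2.2.2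
      rw [abs_of_nonneg (div_nonneg (pow_nonneg (by linarith) _) (by positivity))]
      simp only [pow_zero, mul_one]
      rw [div_le_one (by positivity)]
      calc _ ≤ (1:ℝ) := pow_le_one₀ (by linarith) (by linarith)
        _ ≤ _ := by exact_mod_cast Nat.one_le_iff_ne_zero.2 (Nat.factorial_ne_zero m)
    exact (h2.mul0 hf).integral volume hε

lemma good_theta (𝒜 : Type*) {E Ω : Type*} [NormedAddCommGroup E] [NormedSpace ℝ E] [MeasurableSpace Ω]
    {I : Idx 𝒜} (W : Wt E Ω) (r : ℕ) : Good I (W.ext unitInterval) 0 r (fun _ _ ω => (ω.2:ℝ)) := by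
  refine Good.omega (C := 1) (k := 0) (by fun_prop) zero_le_one fun p ω => ?_
  have h0 := ω.2.2.1
  have h1 := ω.2.2.2
  rw [abs_of_nonneg h0]; simpa using h1

noncomputable def Hf (m k : ℕ) (g : Adm d lam ρ → Pt d → ℝ) (Y D : Pt d × Pt d → Ω → Pt d) :
    Adm d lam ρ → Pt d × Pt d → Ω → ℝ := fun A p ω =>
  ∫ θ : unitInterval, (θ:ℝ) ^ k * Tay m (fun τ => g A (p.1 + τ • (Y p ω + (θ:ℝ) • D p ω)))

variable {Y D : Pt d × Pt d → Ω → Pt d} [Nonempty (Adm d lam ρ)]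
  (hY : ∀ i, Good (idx d lam ρ) W 0 r (fun _ p ω => Y p ω i))
  (hD : ∀ i, Good (idx d lam ρ) W 0 r (fun _ p ω => D p ω i))
include hY hD

lemma Good.hf_pre (hg : Cb (idx d lam ρ) r g) (m : ℕ) :
    Good (idx d lam ρ) (W.ext unitInterval) 0 r (fun A p ω =>
      Tay m (fun τ => g A (p.1 + τ • (Y p ω.1 + (ω.2:ℝ) • D p ω.1)))) := by
  refine Good.tay (f := fun A p (ω : Ω × unitInterval) τ => g A (p.1 + τ • (Y p ω.1 + (ω.2:ℝ) • D p ω.1))) le_rfl m ?_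
  refine Good.comp' (Y := fun p (ω : (Ω × unitInterval) × unitInterval) =>
    (ω.2:ℝ) • (Y p ω.1.1 + (ω.1.2:ℝ) • D p ω.1.1)) hg (ContinuousLinearMap.fst ℝ (Pt d) (Pt d)) fun i => ?_
  simp only [Pi.smul_apply, Pi.add_apply, smul_eq_mul]
  exact (good_theta _ _ _).mul0 ((((hY i).ext le_rfl).ext le_rfl).add
    (((good_theta _ _ _).ext le_rfl).mul0 (((hD i).ext le_rfl).ext le_rfl)))

lemma Good.hf_pre2 (hg : Cb (idx d lam ρ) r g) (m k : ℕ) :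
    Good (idx d lam ρ) (W.ext unitInterval) 0 r (fun A p ω => (ω.2:ℝ)^k *
      Tay m (fun τ => g A (p.1 + τ • (Y p ω.1 + (ω.2:ℝ) • D p ω.1)))) :=
  ((good_theta _ _ _).pow k).mul0 (Good.hf_pre hY hD hg m)

lemma Good.hf (hg : Cb (idx d lam ρ) r g) (m k : ℕ) : Good (idx d lam ρ) W 0 r (Hf m k g Y D) :=
  (Good.hf_pre2 hY hD hg m k).integral volume le_rfl

lemma Hf_rec (hg : Cb (idx d lam ρ) r g) (hr : 0 < r) (hpd : ∀ i, Cb (idx d lam ρ) r (pdF i g)) (m k : ℕ)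
    (A : Adm d lam ρ) (p : Pt d × Pt d) (ω : Ω) :
    Hf m k g Y D A p ω = (1 / (m.factorial * (k+1))) * g A p.1 +
      ∑ i, (Y p ω i * Hf (m+1) k (pdF i g) Y D A p ω + D p ω i * Hf (m+1) (k+1) (pdF i g) Y D A p ω) := by
  have h1 : ∀ y : Pt d, Tay m (fun τ => g A (p.1 + τ • y)) = g A p.1 / m.factorial +
      ∑ i, y i * Tay (m+1) (fun τ => pdF i g A (p.1 + τ • y)) := by
    intro y
    have hd : ∀ x : ℝ, HasDerivAt (fun τ : ℝ => g A (p.1 + τ • y))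
        (∑ i, y i * pdF i g A (p.1 + x • y)) x := by
      intro x
      have h2 := (hg.diff hr A (p.1 + x • y)).hasFDerivAt.comp_hasDerivAt x
        (((hasDerivAt_id x).smul_const y).const_add p.1)
      refine h2.congr_deriv ?_
      simp only [one_smul]
      conv_lhs => rw [pi_eq_sum_single y, map_sum]
      refine Finset.sum_congr rfl fun i _ => ?_
      rw [map_smul, smul_eq_mul, ← pi_eq_sum_single y]; rfl
    have hcont : ∀ i, Continuous fun x : ℝ => pdF i g A (p.1 + x • y) := fun i =>
      ((hpd i).base.cont A ()).comp (by fun_prop)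
    rw [Tay_succ m _ _ hd (by fun_prop)]
    simp only [zero_smul, add_zero]
    congr 1
    simp only [Tay]
    have : ∀ τ : unitInterval, (1 - (τ:ℝ)) ^ m / m.factorial * ∑ i, y i * pdF i g A (p.1 + (τ:ℝ) • y) =
        ∑ i, y i * ((1 - (τ:ℝ)) ^ m / m.factorial * pdF i g A (p.1 + (τ:ℝ) • y)) := by
      intro τ; rw [Finset.mul_sum]; exact Finset.sum_congr rfl fun i _ => by ring
    simp only [this]
    rw [integral_finsetSum]
    · exact Finset.sum_congr rfl fun i _ => integral_const_mul _ _
    · intro i _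
      apply Continuous.integrable_of_hasCompactSupport
      · have := (hcont i).comp (continuous_subtype_val (p := (· ∈ unitInterval)))
        exact continuous_const.mul ((by fun_prop : Continuous fun τ : unitInterval => (1 - (τ:ℝ)) ^ m / (m.factorial:ℝ)).mul this)
      · exact HasCompactSupport.of_compactSpace _
  unfold Hf
  have h3 : ∀ θ : unitInterval, (θ:ℝ)^k * Tay m (fun τ => g A (p.1 + τ • (Y p ω + (θ:ℝ) • D p ω))) =
      g A p.1 / m.factorial * (θ:ℝ)^k +
      ∑ i, (Y p ω i * ((θ:ℝ)^k * Tay (m+1) (fun τ => pdF i g A (p.1 + τ • (Y p ω + (θ:ℝ) • D p ω)))) +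
       D p ω i * ((θ:ℝ)^(k+1) * Tay (m+1) (fun τ => pdF i g A (p.1 + τ • (Y p ω + (θ:ℝ) • D p ω))))) := by
    intro θ
    rw [h1, mul_add, Finset.mul_sum]
    congr 1
    · ring
    · refine Finset.sum_congr rfl fun i _ => ?_
      simp only [Pi.add_apply, Pi.smul_apply, smul_eq_mul]
      ring
  simp only [h3]
  have hitg : ∀ i k, Integrable (fun θ : unitInterval =>
      (θ:ℝ)^k * Tay (m+1) (fun τ => pdF i g A (p.1 + τ • (Y p ω + (θ:ℝ) • D p ω)))) := fun i k =>
    (Good.hf_pre2 hY hD (hpd i) (m+1) k).integrable volume le_rfl A p ω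
  have hint0 : Integrable (fun θ : unitInterval => g A p.1 / m.factorial * (θ:ℝ)^k) :=
    Continuous.integrable_of_hasCompactSupport (by fun_prop) (HasCompactSupport.of_compactSpace _)
  have hint2 : ∀ i ∈ (Finset.univ : Finset (Fin (d+1))), Integrable (fun θ : unitInterval =>
      (Y p ω i * ((θ:ℝ)^k * Tay (m+1) (fun τ => pdF i g A (p.1 + τ • (Y p ω + (θ:ℝ) • D p ω)))) +
       D p ω i * ((θ:ℝ)^(k+1) * Tay (m+1) (fun τ => pdF i g A (p.1 + τ • (Y p ω + (θ:ℝ) • D p ω)))))) :=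
    fun i _ => ((hitg i k).const_mul _).add ((hitg i (k+1)).const_mul _)
  rw [integral_add hint0 (integrable_finsetSum _ hint2), integral_const_mul,
    integral_unitInterval (fun θ => θ^k), integral_pow, integral_finsetSum _ hint2]
  congr 1
  · simp; field_simp
  · refine Finset.sum_congr rfl fun i _ => ?_
    rw [integral_add ((hitg i k).const_mul _) ((hitg i (k+1)).const_mul _), integral_const_mul, integral_const_mul]

end hf

/-! ## Part 4b: expansion of the integrand -/

structure Chain (d n : ℕ) (Ω : Type*) [MeasurableSpace Ω] where
  σ : Fin (n+1) → Ω → ℝ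
  ξ0 : Fin (n+1) → Fin d → Ω → ℝ
  σ_meas : ∀ j, Measurable (σ j)
  ξ0_meas : ∀ j l, Measurable (ξ0 j l)
  σ_nonneg : ∀ j ω, 0 ≤ σ j ω
  σ_le : ∀ j ω, σ j ω ≤ 1
  sum_sq : ∀ ω, ∑ j, σ j ω ^ 2 = 1
  sum_cross : ∀ l ω, ∑ j, σ j ω * ξ0 j l ω = 0

section chain
variable {n : ℕ} {Ω : Type*} [MeasurableSpace Ω] (C : Chain d n Ω)

namespace Chain

def κ (ω : Ω) : ℝ := ∑ j, ∑ l, C.ξ0 j l ω ^ 2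

lemma κ_nonneg (ω : Ω) : 0 ≤ C.κ ω := Finset.sum_nonneg fun _ _ => Finset.sum_nonneg fun _ _ => sq_nonneg _

lemma κ_meas : Measurable C.κ :=
  Finset.measurable_sum _ fun j _ => Finset.measurable_sum _ fun l _ => (C.ξ0_meas j l).pow_const 2

noncomputable def W : Wt (Pt d × Pt d) Ω where
  G := fun p ω => 1 + ‖p.2‖ + C.κ ω
  H := fun p ω => ∑ l : Fin d, p.2 l.succ ^ 2 + C.κ ω
  one_le := fun p ω => by have := C.κ_nonneg ω; have := norm_nonneg p.2; linarith
  H_nonneg := fun p ω => add_nonneg (Finset.sum_nonneg fun _ _ => sq_nonneg _) (C.κ_nonneg ω)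
  G_cont := fun ω => by fun_prop

def U (j : Fin (n+1)) (p : Pt d × Pt d) (ω : Ω) : ℝ := p.2 0 * C.σ j ω
def ξ (j : Fin (n+1)) (l : Fin d) (p : Pt d × Pt d) (ω : Ω) : ℝ := C.σ j ω * p.2 l.succ + C.ξ0 j l ω

def Δ (j : Fin (n+1)) (p : Pt d × Pt d) (ω : Ω) : Pt d :=
  Fin.cons (C.U j p ω ^ 2) (fun l => C.U j p ω * C.ξ j l p ω)
def Yb (j : Fin (n+1)) (p : Pt d × Pt d) (ω : Ω) : Pt d := ∑ k ∈ Finset.Ioi j, C.Δ k p ω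
def Ya (j : Fin (n+1)) (p : Pt d × Pt d) (ω : Ω) : Pt d := C.Yb j p ω + C.Δ j p ω

lemma sum_ξ_sq (p : Pt d × Pt d) (ω : Ω) : ∑ j, ∑ l, C.ξ j l p ω ^ 2 = C.W.H p ω := by
  simp only [W, κ]
  rw [Finset.sum_comm, Finset.sum_comm (f := fun j l => C.ξ0 j l ω ^ 2), ← Finset.sum_add_distrib]
  refine Finset.sum_congr rfl fun l _ => ?_
  have h1 : ∀ j, C.ξ j l p ω ^ 2 = p.2 l.succ ^ 2 * C.σ j ω ^ 2 + 2 * p.2 l.succ * (C.σ j ω * C.ξ0 j l ω)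
      + C.ξ0 j l ω ^ 2 := fun j => by unfold ξ; ring
  simp only [h1]
  rw [Finset.sum_add_distrib, Finset.sum_add_distrib, ← Finset.mul_sum, ← Finset.mul_sum, C.sum_sq, C.sum_cross]
  ring

variable {𝒜 : Type*} {I : Idx 𝒜} {r : ℕ}

lemma good_coord (i : Fin (d+1)) : Good I C.W 0 r (fun _ p _ => p.2 i) := by
  refine Good.linear ((ContinuousLinearMap.proj (R := ℝ) (φ := fun _ : Fin (d+1) => ℝ) i).comp
    (ContinuousLinearMap.snd ℝ (Pt d) (Pt d))) (C := 1) (k := 1) zero_le_one fun p ω => ?_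
  have h1 := norm_le_pi_norm p.2 i
  have := C.κ_nonneg ω
  simp only [W, pow_one, one_mul, ContinuousLinearMap.comp_apply, ContinuousLinearMap.proj_apply,
    ContinuousLinearMap.coe_snd', ← Real.norm_eq_abs]
  linarith

lemma good_σ (j : Fin (n+1)) : Good I C.W 0 r (fun _ _ ω => C.σ j ω) := by
  refine Good.omega (C.σ_meas j) (C := 1) (k := 0) zero_le_one fun p ω => ?_
  rw [abs_of_nonneg (C.σ_nonneg j ω)]; simpa using C.σ_le j ω

lemma good_ξ0 (j : Fin (n+1)) (l : Fin d) : Good I C.W 0 r (fun _ _ ω => C.ξ0 j l ω) := by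
  refine Good.omega (C.ξ0_meas j l) (C := 1) (k := 1) zero_le_one fun p ω => ?_
  have h1 : C.ξ0 j l ω ^ 2 ≤ C.κ ω := by
    refine le_trans ?_ (Finset.single_le_sum (f := fun j => ∑ l, C.ξ0 j l ω ^ 2)
      (fun _ _ => Finset.sum_nonneg fun _ _ => sq_nonneg _) (Finset.mem_univ j))
    exact Finset.single_le_sum (f := fun l => C.ξ0 j l ω ^ 2) (fun _ _ => sq_nonneg _) (Finset.mem_univ l)
  have h2 : |C.ξ0 j l ω| ≤ 1 + C.ξ0 j l ω ^ 2 := by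
    rw [← sq_abs (C.ξ0 j l ω)]
    nlinarith [sq_nonneg (|C.ξ0 j l ω| - 1), abs_nonneg (C.ξ0 j l ω)]
  have := norm_nonneg p.2
  simp only [W, pow_one, one_mul]
  linarith

lemma good_U (j : Fin (n+1)) : Good I C.W 0 r (fun _ p ω => C.U j p ω) :=
  (C.good_coord 0).mul0 (C.good_σ j)

lemma good_ξ (j : Fin (n+1)) (l : Fin d) : Good I C.W 0 r (fun _ p ω => C.ξ j l p ω) :=
  ((C.good_σ j).mul0 (C.good_coord l.succ)).add (C.good_ξ0 j l)

end Chain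

variable {lam : ℝ} {ρ r : ℕ} [Nonempty (Adm d lam ρ)]

lemma Good.jetw {g : Adm d lam ρ → Pt d → ℝ} (hg : Cb (idx d lam ρ) r g) :
    Good (idx d lam ρ) C.W 0 r (fun A p _ => g A p.1) := by
  have := Good.comp' (W := C.W) (Y := fun _ _ => 0) hg (ContinuousLinearMap.fst ℝ (Pt d) (Pt d))
    (fun i => by simpa using Good.zero)
  simpa using this

/-- the algebra of leading terms -/
noncomputable def KT (lam : ℝ) (ρ r : ℕ) : Subalgebra ℝ (Adm d lam ρ → Pt d × Pt d → Ω → ℝ) :=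
  Algebra.adjoin ℝ ({f | ∃ g, J0 r g ∧ f = fun A p _ => g A p.1} ∪
    ({f | ∃ j, f = fun _ p ω => C.U j p ω} ∪ {f | ∃ j l, f = fun _ p ω => C.ξ j l p ω}))

variable {C} {P f f' : Adm d lam ρ → Pt d × Pt d → Ω → ℝ}

lemma KT_good (h : P ∈ KT C lam ρ r) : Good (idx d lam ρ) C.W 0 r P := by
  induction h using Algebra.adjoin_induction with
  | mem x hx =>
    rcases hx with ⟨g, hg, rfl⟩ | ⟨j, rfl⟩ | ⟨j, l, rfl⟩
    · exact Good.jetw C hg.1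
    · exact C.good_U j
    · exact C.good_ξ j l
  | algebraMap c => exact Good.const c
  | add x y _ _ hx hy => exact hx.add hy
  | mul x y _ _ hx hy => exact hx.mul0 hy

lemma KT_jet {g : Adm d lam ρ → Pt d → ℝ} (hg : J0 r g) : (fun A p _ => g A p.1) ∈ KT C lam ρ r :=
  Algebra.subset_adjoin (Or.inl ⟨g, hg, rfl⟩)
lemma KT_U (j : Fin (n+1)) : (fun _ p ω => C.U j p ω) ∈ KT C lam ρ r :=
  Algebra.subset_adjoin (Or.inr (Or.inl ⟨j, rfl⟩))
lemma KT_ξ (j : Fin (n+1)) (l : Fin d) : (fun _ p ω => C.ξ j l p ω) ∈ KT C lam ρ r :=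
  Algebra.subset_adjoin (Or.inr (Or.inr ⟨j, l, rfl⟩))

variable (C) in
/-- leading term plus remainder of order `M` -/
def EE (r M : ℕ) (f : Adm d lam ρ → Pt d × Pt d → Ω → ℝ) : Prop :=
  ∃ P ∈ KT C lam ρ r, ∃ g, Good (idx d lam ρ) C.W 0 r g ∧
    f = fun A p ω => P A p ω + p.2 0 ^ M * g A p ω

variable {M : ℕ}

lemma EE.of_KT (h : f ∈ KT C lam ρ r) : EE C r M f := ⟨f, h, _, Good.zero, by simp⟩

lemma EE.good (h : EE C r M f) : Good (idx d lam ρ) C.W 0 r f := by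
  obtain ⟨P, hP, g, hg, rfl⟩ := h
  exact (KT_good hP).add (((C.good_coord 0).pow M).mul0 hg)

lemma EE.add (h : EE C r M f) (h' : EE C r M f') : EE C r M (fun A p ω => f A p ω + f' A p ω) := by
  obtain ⟨P, hP, g, hg, rfl⟩ := h
  obtain ⟨P', hP', g', hg', rfl⟩ := h'
  exact ⟨_, add_mem hP hP', _, hg.add hg', by funext A p ω; simp; ring⟩

lemma EE.mul (h : EE C r M f) (h' : EE C r M f') : EE C r M (fun A p ω => f A p ω * f' A p ω) := by
  obtain ⟨P, hP, g, hg, rfl⟩ := h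
  obtain ⟨P', hP', g', hg', rfl⟩ := h'
  refine ⟨_, mul_mem hP hP', _, ((KT_good hP).mul0 hg').add (((KT_good hP').mul0 hg).add
    (((C.good_coord 0).pow M).mul0 (hg.mul0 hg'))), ?_⟩
  funext A p ω; simp; ring

lemma EE.const (c : ℝ) : EE (lam := lam) (ρ := ρ) C r M (fun _ _ _ => c) :=
  EE.of_KT ((KT C lam ρ r).algebraMap_mem c)

lemma EE.sum {ι : Type*} (s : Finset ι) {F : ι → Adm d lam ρ → Pt d × Pt d → Ω → ℝ}
    (h : ∀ i ∈ s, EE C r M (F i)) : EE C r M (fun A p ω => ∑ i ∈ s, F i A p ω) := by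
  classical
  induction s using Finset.induction_on with
  | empty => simpa using EE.const 0
  | insert i s hi ih =>
    simp only [Finset.sum_insert hi]
    exact (h i (by simp)).add (ih fun j hj => h j (by simp [hj]))

lemma EE.prod {ι : Type*} (s : Finset ι) {F : ι → Adm d lam ρ → Pt d × Pt d → Ω → ℝ}
    (h : ∀ i ∈ s, EE C r M (F i)) : EE C r M (fun A p ω => ∏ i ∈ s, F i A p ω) := by
  classical
  induction s using Finset.induction_on with
  | empty => simpa using EE.const 1
  | insert i s hi ih =>
    simp only [Finset.prod_insert hi]
    exact (h i (by simp)).mul (ih fun j hj => h j (by simp [hj]))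

lemma EE.pow (h : EE C r M f) (k : ℕ) : EE C r M (fun A p ω => f A p ω ^ k) := by
  simpa using EE.prod (Finset.range k) (F := fun _ => f) fun _ _ => h

/-- admissible displacements -/
def DispOK (C : Chain d n Ω) (lam : ℝ) (ρ r : ℕ) (Y : Pt d × Pt d → Ω → Pt d) : Prop :=
  ∀ i, (fun _ p ω => Y p ω i) ∈ KT C lam ρ r ∧ ∃ y : Pt d × Pt d → Ω → ℝ,
    Good (idx d lam ρ) C.W 0 r (fun _ p ω => y p ω) ∧ ∀ p ω, Y p ω i = p.2 0 ^ stp i * y p ω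

variable {Y D : Pt d × Pt d → Ω → Pt d}

lemma DispOK.good (h : DispOK C lam ρ r Y) (i : Fin (d+1)) :
    Good (idx d lam ρ) C.W 0 r (fun _ p ω => Y p ω i) := KT_good (h i).1

lemma DispOK.zero : DispOK C lam ρ r (fun _ _ => 0) := fun i =>
  ⟨(KT C lam ρ r).algebraMap_mem 0, fun _ _ => 0, Good.zero, by simp⟩

lemma DispOK.add (h : DispOK C lam ρ r Y) (h' : DispOK C lam ρ r D) :
    DispOK C lam ρ r (fun p ω => Y p ω + D p ω) := by
  intro i
  obtain ⟨h1, y, hy, hy'⟩ := h i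
  obtain ⟨h2, y2, hy2, hy2'⟩ := h' i
  exact ⟨add_mem h1 h2, fun p ω => y p ω + y2 p ω, hy.add hy2, fun p ω => by simp [hy', hy2']; ring⟩

lemma DispOK.sum {ι : Type*} (s : Finset ι) {F : ι → Pt d × Pt d → Ω → Pt d}
    (h : ∀ i ∈ s, DispOK C lam ρ r (F i)) : DispOK C lam ρ r (fun p ω => ∑ i ∈ s, F i p ω) := by
  classical
  induction s using Finset.induction_on with
  | empty => simpa using DispOK.zero
  | insert i s hi ih =>
    simp only [Finset.sum_insert hi]
    exact (h i (by simp)).add (ih fun j hj => h j (by simp [hj]))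

lemma DispOK_Δ (j : Fin (n+1)) : DispOK C lam ρ r (C.Δ j) := by
  intro i
  refine Fin.cases ?_ (fun l => ?_) i
  · refine ⟨pow_mem (KT_U j) 2, fun _ ω => C.σ j ω ^ 2, (C.good_σ j).pow 2, fun p ω => ?_⟩
    simp [Chain.Δ, Chain.U, stp]; ring
  · refine ⟨mul_mem (KT_U j) (KT_ξ j l), fun p ω => C.σ j ω * C.ξ j l p ω, (C.good_σ j).mul0 (C.good_ξ j l), fun p ω => ?_⟩
    simp [Chain.Δ, Chain.U, stp]; ring

lemma DispOK_Yb (j : Fin (n+1)) : DispOK C lam ρ r (C.Yb j) := DispOK.sum _ fun k _ => DispOK_Δ k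
lemma DispOK_Ya (j : Fin (n+1)) : DispOK C lam ρ r (C.Ya j) := (DispOK_Yb j).add (DispOK_Δ j)

lemma EE.disp_mul (h : DispOK C lam ρ r Y) (i : Fin (d+1)) (hf : EE C r (M - stp i) f) :
    EE C r M (fun A p ω => Y p ω i * f A p ω) := by
  obtain ⟨h1, y, hy, hy'⟩ := h i
  obtain ⟨P, hP, g, hg, rfl⟩ := hf
  refine ⟨_, mul_mem h1 hP, _, ((C.good_coord 0).pow (M - stp i + stp i - M)).mul0 (hy.mul0 hg), ?_⟩
  funext A p ω
  have e : p.2 0 ^ M * p.2 0 ^ (M - stp i + stp i - M) = p.2 0 ^ (M - stp i) * p.2 0 ^ stp i := by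
    rw [← pow_add, ← pow_add]; congr 1; omega
  simp only [Pi.mul_apply]
  linear_combination (-y p ω * g A p ω) * e + g A p ω * p.2 0 ^ (M - stp i) * hy' p ω

lemma EE_Hf (hr : 0 < r) {g : Adm d lam ρ → Pt d → ℝ} (hg : JetGood r M g) (hY : DispOK C lam ρ r Y)
    (hD : DispOK C lam ρ r D) (m k : ℕ) : EE C r M (Hf m k g Y D) := by
  induction M using Nat.strong_induction_on generalizing g m k with
  | _ M ih =>
    rcases Nat.eq_zero_or_pos M with rfl | hM
    · exact ⟨_, (KT C lam ρ r).algebraMap_mem 0, _, Good.hf hY.good hD.good hg.j0.1 m k, by simp⟩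
    · have e := Hf_rec hY.good hD.good hg.j0.1 hr (fun i => (hg.pdF i hM).j0.1) m k
      have e' := (funext fun A => funext fun p => funext fun ω => e A p ω)
      refine e'.symm ▸ ?_
      refine ((EE.const _).mul (EE.of_KT (KT_jet hg.j0))).add (EE.sum _ fun i _ => ?_)
      have := stp_pos i
      exact (EE.disp_mul hY i (ih _ (by omega) (hg.pdF i hM) _ _)).add
        (EE.disp_mul hD i (ih _ (by omega) (hg.pdF i hM) _ _))

lemma Hf_zero (g : Adm d lam ρ → Pt d → ℝ) (A : Adm d lam ρ) (p : Pt d × Pt d) (ω : Ω) :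
    Hf 0 0 g Y (fun _ _ => 0) A p ω = g A (p.1 + Y p ω) := by
  simp [Hf, Tay]

lemma EE_eval (hr : 0 < r) {g : Adm d lam ρ → Pt d → ℝ} (hg : JetGood r M g) (hY : DispOK C lam ρ r Y) :
    EE C r M (fun A p ω => g A (p.1 + Y p ω)) := by
  have := EE_Hf hr hg hY DispOK.zero 0 0
  convert this using 1
  funext A p ω
  rw [Hf_zero]

lemma sub_eq_Hf (hr : 0 < r) {g : Adm d lam ρ → Pt d → ℝ} (hg : Cb (idx d lam ρ) r g)
    (hpd : ∀ i, Cb (idx d lam ρ) r (pdF i g)) (hY : DispOK C lam ρ r Y)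
    (A : Adm d lam ρ) (p : Pt d × Pt d) (ω : Ω) :
    g A (p.1 + Y p ω) - g A p.1 = ∑ i, Y p ω i * Hf 1 0 (pdF i g) Y (fun _ _ => 0) A p ω := by
  rw [← Hf_zero (Y := Y) g A p ω, Hf_rec hY.good (D := fun _ _ => 0) (DispOK.zero (C := C) (lam := lam) (ρ := ρ)).good hg hr hpd]
  simp

end chain

/-! ## Part 4c: the integrand -/

section integrand
variable {n : ℕ} {Ω : Type*} [MeasurableSpace Ω] (C : Chain d n Ω)
variable {lam : ℝ} {ρ r : ℕ}

namespace Chain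

/-- exponent of a single factor, evaluated at a point `y` -/
noncomputable def qat (j : Fin (n+1)) (A : Adm d lam ρ) (y : Pt d) (p : Pt d × Pt d) (ω : Ω) : ℝ :=
  1/2 * LD A y + 1/4 * ∑ l, ∑ l', AI l l' A y * (C.ξ j l p ω * C.ξ j l' p ω)

noncomputable def QW (A : Adm d lam ρ) (p : Pt d × Pt d) (ω : Ω) : ℝ := ∑ j, C.qat j A p.1 p ω
noncomputable def QF (A : Adm d lam ρ) (p : Pt d × Pt d) (ω : Ω) : ℝ :=
  ∑ j, C.qat j A (p.1 + C.Yb j p ω) p ω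

/-- `(A ξ)_i` -/
noncomputable def Av (j : Fin (n+1)) (i : Fin d) (A : Adm d lam ρ) (p : Pt d × Pt d) (ω : Ω) : ℝ :=
  ∑ m, AI i m A (p.1 + C.Yb j p ω) * C.ξ j m p ω

def dl (j : Fin (n+1)) (k : Fin (d+1)) (p : Pt d × Pt d) (ω : Ω) : ℝ :=
  (Fin.cons (C.U j p ω) (fun l => C.ξ j l p ω) : Pt d) k

def cf (q : Cmp d) : Adm d lam ρ → Pt d → ℝ := fun A w => cmp A.1 q w

/-- the polynomial factor of `-E` -/
noncomputable def Bt (j : Fin (n+1)) (A : Adm d lam ρ) (p : Pt d × Pt d) (ω : Ω) : ℝ :=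
  (∑ i, ∑ l, (∑ k, C.dl j k p ω * Hf 0 0 (pdF k (cf (.inl (i, l)))) (C.Yb j) (C.Δ j) A p ω) *
      (1/4 * (C.Av j i A p ω * C.Av j l A p ω) + (-1/2) * AI i l A (p.1 + C.Yb j p ω)))
    + (-1/2) * (∑ l, cf (.inr (.inl l)) A (p.1 + C.Ya j p ω) * C.Av j l A p ω)
    + C.U j p ω * cf (.inr (.inr ())) A (p.1 + C.Ya j p ω)

end Chain

variable [Nonempty (Adm d lam ρ)] {C}
variable {M : ℕ} {Y D : Pt d × Pt d → Ω → Pt d}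

lemma EE.U (j : Fin (n+1)) : EE C r M (fun (_ : Adm d lam ρ) p ω => C.U j p ω) := EE.of_KT (KT_U j)
lemma EE.ξ (j : Fin (n+1)) (l : Fin d) : EE C r M (fun (_ : Adm d lam ρ) p ω => C.ξ j l p ω) := EE.of_KT (KT_ξ j l)

lemma EE.diff (hr : 0 < r) {g : Adm d lam ρ → Pt d → ℝ} (hg : Cb (idx d lam ρ) r g)
    (hpd : ∀ i, JetGood r M (pdF i g)) (hY : DispOK C lam ρ r Y) :
    EE C r M (fun A p ω => g A (p.1 + Y p ω) - g A p.1) ∧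
    ∃ s, Good (idx d lam ρ) C.W 0 r s ∧ ∀ A p ω, g A (p.1 + Y p ω) - g A p.1 = p.2 0 * s A p ω := by
  simp only [sub_eq_Hf hr hg (fun i => (hpd i).j0.1) hY]
  refine ⟨EE.sum _ fun i _ => EE.disp_mul hY i (EE_Hf hr ((hpd i).mono (by omega)) hY DispOK.zero 1 0), ?_⟩
  choose y hy hy' using fun i => (hY i).2
  refine ⟨_, Good.sum Finset.univ fun i _ => ((C.good_coord 0).pow (stp i - 1)).mul0 ((hy i).mul0
    (Good.hf hY.good (DispOK.zero (C := C) (lam := lam) (ρ := ρ) (r := r)).good (hpd i).j0.1 1 0)), fun A p ω => ?_⟩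
  rw [Finset.mul_sum]
  refine Finset.sum_congr rfl fun i _ => ?_
  rw [hy' i]
  have : p.2 0 ^ stp i = p.2 0 * p.2 0 ^ (stp i - 1) := by
    rw [← pow_succ']; congr 1; have := stp_pos i; omega
  rw [this]; ring

variable (hl : 0 < lam) (hρ : 3 * r ≤ ρ) (hr : 2 < r)

section
include hl hρ hr

lemma EE_AI {Y : Pt d × Pt d → Ω → Pt d} (hY : DispOK C lam ρ r Y) (i j : Fin d) :
    EE C r (r-3) (fun (A : Adm d lam ρ) p ω => AI i j A (p.1 + Y p ω)) :=
  EE_eval (by omega) ((JetGood_AI hl hρ hr i j).mono (by omega)) hY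

lemma EE_Av (j : Fin (n+1)) (i : Fin d) : EE (lam := lam) (ρ := ρ) C r (r-3) (C.Av j i) :=
  EE.sum _ fun m _ => (EE_AI hl hρ hr (DispOK_Yb j) i m).mul (EE.ξ j m)

lemma EE_Bt (j : Fin (n+1)) : EE (lam := lam) (ρ := ρ) C r (r-3) (C.Bt j) := by
  refine ((EE.sum _ fun i _ => EE.sum _ fun l _ => (EE.sum _ fun k _ => ?_).mul
    (((EE.const _).mul ((EE_Av hl hρ hr j i).mul (EE_Av hl hρ hr j l))).add
      ((EE.const _).mul (EE_AI hl hρ hr (DispOK_Yb j) i l)))).add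
    ((EE.const _).mul (EE.sum _ fun l _ => EE.mul ?_ (EE_Av hl hρ hr j l)))).add
    (EE.mul (EE.U j) ?_)
  · refine EE.mul ?_ (EE_Hf (by omega) (JetGood_pdcmp hρ hr k (.inl (i, l))) (DispOK_Yb j) (DispOK_Δ j) 0 0)
    refine Fin.cases ?_ (fun l => ?_) k
    · exact EE.U j
    · exact EE.ξ j l
  · exact EE_eval (by omega) ((JetGood_cmp hρ hr _).mono (by omega)) (DispOK_Ya j)
  · exact EE_eval (by omega) ((JetGood_cmp hρ hr _).mono (by omega)) (DispOK_Ya j)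

lemma QF_sub_QW : EE (lam := lam) (ρ := ρ) C r (r-3) (fun A p ω => C.QF A p ω - C.QW A p ω) ∧
    ∃ s, Good (idx d lam ρ) C.W 0 r s ∧ ∀ A p ω, C.QF A p ω - C.QW A p ω = p.2 0 * s A p ω := by
  have e : ∀ (A : Adm d lam ρ) p ω, C.QF A p ω - C.QW A p ω = ∑ j,
      (1/2 * (LD A (p.1 + C.Yb j p ω) - LD A p.1) + 1/4 * ∑ l, ∑ l',
        (AI l l' A (p.1 + C.Yb j p ω) - AI l l' A p.1) * (C.ξ j l p ω * C.ξ j l' p ω)) := by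
    intro A p ω
    simp only [Chain.QF, Chain.QW, Chain.qat, ← Finset.sum_sub_distrib, sub_mul]
    refine Finset.sum_congr rfl fun j _ => ?_
    simp only [Finset.sum_sub_distrib]
    ring
  simp only [e]
  have h1 := fun j => EE.diff (M := r-3) (by omega) (Cb_LD (d := d) hl hρ hr) (fun i => JetGood_pdLD hl hρ hr i) (DispOK_Yb (C := C) j)
  have h2 := fun j l l' => EE.diff (M := r-3) (by omega) (JetGood_AI (d := d) hl hρ hr l l').j0.1 (fun i => JetGood_pdAI hl hρ hr i l l') (DispOK_Yb (C := C) j)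
  refine ⟨EE.sum _ fun j _ => ((EE.const _).mul (h1 j).1).add ((EE.const _).mul (EE.sum _ fun l _ =>
    EE.sum _ fun l' _ => (h2 j l l').1.mul ((EE.ξ j l).mul (EE.ξ j l')))), ?_⟩
  choose s1 hs1 es1 using fun j => (h1 j).2
  choose s2 hs2 es2 using fun j l l' => (h2 j l l').2
  refine ⟨_, Good.sum Finset.univ fun j _ => ((hs1 j).cmul (1/2)).add ((Good.sum Finset.univ fun l _ =>
    Good.sum Finset.univ fun l' _ => (hs2 j l l').mul0 ((C.good_ξ j l).mul0 (C.good_ξ j l'))).cmul (1/4)), fun A p ω => ?_⟩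
  simp only [es1, es2, Finset.mul_sum, mul_add]
  refine Finset.sum_congr rfl fun j _ => ?_
  congr 1
  · ring
  · refine Finset.sum_congr rfl fun l _ => Finset.sum_congr rfl fun l' _ => ?_
    ring

lemma good_QW : Good (idx d lam ρ) C.W 0 r C.QW := by
  refine Good.sum _ fun j _ => ((Good.jetw C (Cb_LD hl hρ hr)).cmul _).add (Good.cmul _ (Good.sum _ fun l _ =>
    Good.sum _ fun l' _ => (Good.jetw C (JetGood_AI hl hρ hr l l').j0.1).mul0 ((C.good_ξ j l).mul0 (C.good_ξ j l'))))

lemma good_QX : Good (idx d lam ρ) C.W 0 r (fun A p ω => C.QF A p ω - C.QW A p ω) :=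
  (QF_sub_QW hl hρ hr).1.good
end

section
include hl
lemma exists_qat_lower (d : ℕ) : ∃ c : ℝ, ∀ (ρ n : ℕ) (Ω : Type) [MeasurableSpace Ω] (C : Chain d n Ω)
    (A : Adm d lam ρ) (Y : Fin (n+1) → Pt d) (p : Pt d × Pt d) (ω : Ω),
    lam / 4 * C.W.H p ω - (n+1) * c ≤ ∑ j, C.qat j A (Y j) p ω := by
  obtain ⟨c, hc, h⟩ := exists_det_lower d hl
  refine ⟨-(1/2 * Real.log c), fun ρ n Ω _ C A Y p ω => ?_⟩
  have h1 : ∀ j, lam / 4 * ∑ l, C.ξ j l p ω ^ 2 + 1/2 * Real.log c ≤ C.qat j A (Y j) p ω := by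
    intro j
    have h2 := A.2.inv_lower hl (Y j) (fun l => C.ξ j l p ω)
    have h3 := Real.log_le_log hc (h ρ A.1 A.2 (Y j))
    simp only [qf] at h2
    have e : ∀ l l', (A.1.a (Y j))⁻¹ l l' * C.ξ j l p ω * C.ξ j l' p ω = AI l l' A (Y j) * (C.ξ j l p ω * C.ξ j l' p ω) :=
      fun l l' => by rw [mul_assoc]; rfl
    simp only [e] at h2
    unfold Chain.qat LD
    linarith
  have h4 := Finset.sum_le_sum fun j (_ : j ∈ Finset.univ) => h1 j
  rw [Finset.sum_add_distrib, ← Finset.mul_sum, C.sum_ξ_sq] at h4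
  simp at h4 ⊢
  linarith
end

variable {Ω : Type} [MeasurableSpace Ω] {C : Chain d n Ω}
include hl hρ hr

lemma exists_decomp : ∃ (P fR : Adm d lam ρ → Pt d × Pt d → Ω → ℝ), P ∈ KT C lam ρ r ∧
    Good (idx d lam ρ) C.W (lam/4) r fR ∧
    Good (idx d lam ρ) C.W (lam/4) r (fun A p ω => (∏ j : Fin n, C.Bt j.succ A p ω) * Real.exp (-C.QF A p ω)) ∧
    ∀ A p ω, p.2 0 ^ n * (∏ j : Fin n, C.Bt j.succ A p ω) * Real.exp (-C.QF A p ω) =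
      p.2 0 ^ n * P A p ω * Real.exp (-C.QW A p ω) + p.2 0 ^ (r-2) * fR A p ω := by
  obtain ⟨c, hc⟩ := exists_qat_lower hl d
  have hQF : ∀ (A : Adm d lam ρ) p ω, lam/4 * C.W.H p ω - (n+1) * c ≤ C.QF A p ω := fun A p ω =>
    hc ρ n Ω C A (fun j => p.1 + C.Yb j p ω) p ω
  have hQW : ∀ (A : Adm d lam ρ) p ω, lam/4 * C.W.H p ω - (n+1) * c ≤ C.QW A p ω := fun A p ω =>
    hc ρ n Ω C A (fun j => p.1) p ω
  have gQW := good_QW (C := C) hl hρ hr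
  obtain ⟨hX, s, hs, es⟩ := QF_sub_QW (C := C) hl hρ hr
  have hB := EE.prod (C := C) Finset.univ (F := fun j : Fin n => C.Bt j.succ) fun j _ => EE_Bt hl hρ hr j.succ
  have gQF : Good (idx d lam ρ) C.W 0 r C.QF := by
    have := gQW.add hX.good
    simpa using this
  have hfull := hB.good.mul0 (gQF.exp (ε := lam/4) fun M => ⟨(n+1) * c, fun A _ p ω => hQF A p ω⟩)
  rcases Nat.eq_zero_or_pos n with rfl | hn
  · refine ⟨fun _ _ _ => 1, fun _ _ _ => 0, (KT C lam ρ r).algebraMap_mem 1, Good.zero, hfull, fun A p ω => ?_⟩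
    have : C.QF A p ω = C.QW A p ω := by
      simp [Chain.QF, Chain.QW, Chain.Yb]
    simp [this]
  have hS := hB.mul (EE.sum (Finset.range (r-3)) (F := fun k A p ω => (-1)^k / k.factorial * (C.QF A p ω - C.QW A p ω)^k)
    fun k _ => (EE.const _).mul (hX.pow k))
  obtain ⟨P, hP, g, hg, e⟩ := hS
  have hT : Good (idx d lam ρ) C.W (lam/4) r (fun A p ω =>
      Tay (r-3) (fun τ => Real.exp (-(C.QW A p ω + τ * (C.QF A p ω - C.QW A p ω))))) := by
    refine Good.tay (f := fun A p ω τ => Real.exp (-(C.QW A p ω + τ * (C.QF A p ω - C.QW A p ω)))) (by positivity) _ ?_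
    refine Good.exp (f := fun A p (ω : Ω × unitInterval) => C.QW A p ω.1 + (ω.2 : ℝ) * (C.QF A p ω.1 - C.QW A p ω.1))
      ((gQW.ext le_rfl).add (Good.mul0 ?_ (hX.good.ext le_rfl))) fun M => ⟨(n+1) * c, fun A _ p ω => ?_⟩
    · refine Good.omega (C := 1) (k := 0) (by fun_prop) zero_le_one fun p ω => ?_
      rw [abs_of_nonneg ω.2.2.1]; simpa using ω.2.2.2
    · have h0 := ω.2.2.1
      have h1 := ω.2.2.2
      have h3 := hQF A p ω.1
      have h4 := hQW A p ω.1
      simp only [Wt.ext]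
      nlinarith [mul_le_mul_of_nonneg_left h3 h0, mul_le_mul_of_nonneg_left h4 (sub_nonneg.2 h1)]
  refine ⟨P, _, hP, ((C.good_coord 0).pow (n-1)).mul0 ((hg.mul0 (gQW.exp (ε := lam/4) fun M => ⟨(n+1) * c, fun A _ p ω => hQW A p ω⟩)).add
    (hB.good.mul0 ((hs.neg.pow (r-3)).mul0 hT))), hfull, fun A p ω => ?_⟩
  have e1 := congrFun (congrFun (congrFun e A) p) ω
  have hexp := exp_taylor (r-3) (C.QF A p ω - C.QW A p ω)
  have e2 : Real.exp (-C.QF A p ω) = Real.exp (-C.QW A p ω) * Real.exp (-(C.QF A p ω - C.QW A p ω)) := by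
    rw [← Real.exp_add]; congr 1; ring
  have e3 : Tay (r-3) (fun τ => Real.exp (-(C.QW A p ω + τ * (C.QF A p ω - C.QW A p ω)))) =
      Real.exp (-C.QW A p ω) * Tay (r-3) (fun τ => Real.exp (-(τ * (C.QF A p ω - C.QW A p ω)))) := by
    have : ∀ τ, Real.exp (-(C.QW A p ω + τ * (C.QF A p ω - C.QW A p ω))) =
      Real.exp (-C.QW A p ω) * Real.exp (-(τ * (C.QF A p ω - C.QW A p ω))) := fun τ => by
        rw [← Real.exp_add]; congr 1; ring
    simp only [this]
    cases r - 3 with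
    | zero => rfl
    | succ m =>
      simp only [Tay]
      rw [← integral_const_mul]
      congr 1; funext τ; ring
  have e4 : ∑ k ∈ Finset.range (r-3), (-(C.QF A p ω - C.QW A p ω)) ^ k / (k.factorial : ℝ) =
      ∑ k ∈ Finset.range (r-3), (-1)^k / (k.factorial : ℝ) * (C.QF A p ω - C.QW A p ω)^k := by
    refine Finset.sum_congr rfl fun k _ => ?_
    rw [neg_pow]; ring
  rw [e4] at hexp
  have e5 : (-(C.QF A p ω - C.QW A p ω)) ^ (r-3) = p.2 0 ^ (r-3) * (- s A p ω) ^ (r-3) := by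
    rw [es, ← mul_pow]; congr 1; ring
  rw [e5] at hexp
  have e6 : p.2 0 ^ n * p.2 0 ^ (r-3) = p.2 0 ^ (r-2) * p.2 0 ^ (n-1) := by
    rw [← pow_add, ← pow_add]; congr 1; omega
  rw [e2, hexp, e3]
  set E := Real.exp (-C.QW A p ω)
  set S := ∑ k ∈ Finset.range (r-3), (-1)^k / (k.factorial : ℝ) * (C.QF A p ω - C.QW A p ω)^k
  set B := ∏ j : Fin n, C.Bt j.succ A p ω
  set T := Tay (r-3) (fun τ => Real.exp (-(τ * (C.QF A p ω - C.QW A p ω))))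
  linear_combination (p.2 0 ^ n * E) * e1 + (g A p ω * E + B * (- s A p ω) ^ (r-3) * E * T) * e6

end integrand

/-! ## Part 5a: the chain on configuration space -/

section conf
variable {n : ℕ}

noncomputable def pos (ζ : Pt d) (y : Fin n → Pt d) : Fin (n+2) → Pt d := Fin.cons ζ (Fin.snoc y 0)

lemma sum_Ioi_sub (f : Fin (n+2) → Pt d) (j : Fin (n+1)) :
    ∑ k ∈ Finset.Ioi j, (f k.castSucc - f k.succ) = f j.succ - f (Fin.last (n+1)) := by
  induction j using Fin.reverseInduction with
  | last =>
    have : Finset.Ioi (Fin.last n) = ∅ := by ext x; simp [Fin.le_last]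
    rw [this]; simp
  | cast j ih =>
    have : Finset.Ioi j.castSucc = insert j.succ (Finset.Ioi j.succ) := by
      ext x
      simp only [Finset.mem_Ioi, Finset.mem_insert, Fin.lt_def, Fin.ext_iff, Fin.val_castSucc, Fin.val_succ]; omega
    rw [this, Finset.sum_insert (by simp), ih]
    simp

lemma pos_last (ζ : Pt d) (y : Fin n → Pt d) : pos ζ y (Fin.last (n+1)) = 0 := by
  rw [← Fin.succ_last]; simp [pos]

lemma sum_Ioi_chainDiff (ζ : Pt d) (y : Fin n → Pt d) (j : Fin (n+1)) :
    ∑ k ∈ Finset.Ioi j, chainDiff ζ y k = pos ζ y j.succ := by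
  have := sum_Ioi_sub (pos ζ y) j
  rw [pos_last, sub_zero] at this
  exact this

lemma sum_chainDiff (ζ : Pt d) (y : Fin n → Pt d) : ∑ k, chainDiff ζ y k = ζ := by
  have : (Finset.univ : Finset (Fin (n+1))) = insert 0 (Finset.Ioi 0) := by
    ext x
    simp only [Finset.mem_Ioi, Finset.mem_insert, Finset.mem_univ, Fin.lt_def, Fin.ext_iff, Fin.val_zero, true_iff]; omega
  rw [this, Finset.sum_insert (by simp), sum_Ioi_chainDiff]
  simp [chainDiff, pos]

noncomputable def e0 : Pt d := Pi.single 0 1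

/-- ordered configurations -/
def Sset (d n : ℕ) : Set (Fin n → Pt d) := {ω | ∀ j, 0 < chainDiff (e0 : Pt d) ω j 0}

lemma measurable_chainDiff (ζ : Pt d) (j : Fin (n+1)) : Measurable fun y : Fin n → Pt d => chainDiff ζ y j := by
  have h : ∀ i : Fin (n+2), Measurable fun y : Fin n → Pt d => pos ζ y i := by
    intro i
    refine Fin.cases ?_ (fun i => ?_) i
    · simpa [pos] using measurable_const
    · refine Fin.lastCases ?_ (fun i => ?_) i
      · simpa [pos] using measurable_const
      · simpa [pos] using measurable_pi_apply i
  exact (h _).sub (h _)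

lemma measurableSet_Sset : MeasurableSet (Sset d n) := by
  have : Sset d n = ⋂ j, {ω | 0 < chainDiff (e0 : Pt d) ω j 0} := by ext; simp [Sset]
  rw [this]
  refine MeasurableSet.iInter fun j => measurableSet_lt measurable_const ?_
  exact (measurable_pi_apply 0).comp (measurable_chainDiff _ j)

noncomputable def sg (j : Fin (n+1)) (ω : Fin n → Pt d) : ℝ := Real.sqrt (chainDiff e0 ω j 0)

lemma sg_pos {ω : Fin n → Pt d} (h : ω ∈ Sset d n) (j : Fin (n+1)) : 0 < sg j ω := Real.sqrt_pos.2 (h j)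
lemma sg_sq {ω : Fin n → Pt d} (h : ω ∈ Sset d n) (j : Fin (n+1)) : sg j ω ^ 2 = chainDiff e0 ω j 0 :=
  Real.sq_sqrt (h j).le
lemma measurable_sg (j : Fin (n+1)) : Measurable (sg (d := d) j) :=
  ((measurable_pi_apply 0).comp (measurable_chainDiff _ j)).sqrt

abbrev Om (d n : ℕ) : Type := Sset d n

noncomputable def chn (d n : ℕ) : Chain d n (Om d n) where
  σ := fun j ω => sg j ω.1
  ξ0 := fun j l ω => chainDiff e0 ω.1 j l.succ / sg j ω.1
  σ_meas := fun j => (measurable_sg j).comp measurable_subtype_coe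
  ξ0_meas := fun j l => ((((measurable_pi_apply l.succ).comp (measurable_chainDiff _ j)).div (measurable_sg j))).comp measurable_subtype_coe
  σ_nonneg := fun j ω => Real.sqrt_nonneg _
  σ_le := fun j ω => by
    have h1 : ∑ j, sg j ω.1 ^ 2 = 1 := by
      simp only [sg_sq ω.2, ← Finset.sum_apply, sum_chainDiff]; simp [e0]
    have h2 := Finset.single_le_sum (f := fun j => sg j ω.1 ^ 2) (fun _ _ => sq_nonneg _) (Finset.mem_univ j)
    simp only [h1] at h2
    nlinarith [Real.sqrt_nonneg (chainDiff e0 ω.1 j 0)]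
  sum_sq := fun ω => by
    simp only [sg_sq ω.2, ← Finset.sum_apply, sum_chainDiff]; simp [e0]
  sum_cross := fun l ω => by
    have : ∀ j, sg j ω.1 * (chainDiff e0 ω.1 j l.succ / sg j ω.1) = chainDiff e0 ω.1 j l.succ := fun j => by
      have := (sg_pos ω.2 j).ne'
      field_simp
    simp only [this, ← Finset.sum_apply, sum_chainDiff]; simp [e0]

/-- rescaling map -/
noncomputable def psi (uv : Pt d) : Pt d →ₗ[ℝ] Pt d :=
  LinearMap.pi (Fin.cons ((uv 0 ^ 2) • LinearMap.proj 0)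
    (fun l => uv 0 • (uv l.succ • LinearMap.proj 0 + LinearMap.proj l.succ)))

@[simp] lemma psi_zero (uv z : Pt d) : psi uv z 0 = uv 0 ^ 2 * z 0 := by simp [psi]
@[simp] lemma psi_succ (uv z : Pt d) (l : Fin d) : psi uv z l.succ = uv 0 * (uv l.succ * z 0 + z l.succ) := by simp [psi]; ring

lemma pos_psi (uv ζ : Pt d) (y : Fin n → Pt d) (i : Fin (n+2)) :
    pos (psi uv ζ) (fun i => psi uv (y i)) i = psi uv (pos ζ y i) := by
  refine Fin.cases ?_ (fun i => ?_) i
  · simp [pos]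
  · refine Fin.lastCases ?_ (fun i => ?_) i <;> simp [pos]

lemma chainDiff_psi (uv ζ : Pt d) (y : Fin n → Pt d) (j : Fin (n+1)) :
    chainDiff (psi uv ζ) (fun i => psi uv (y i)) j = psi uv (chainDiff ζ y j) := by
  have := pos_psi uv ζ y
  unfold chainDiff
  rw [map_sub]
  exact congrArg₂ _ (this _) (this _)

lemma chn_Δ (j : Fin (n+1)) (p : Pt d × Pt d) (ω : Om d n) :
    (chn d n).Δ j p ω = psi p.2 (chainDiff e0 ω.1 j) := by
  have h0 := sg_sq ω.2 j
  have h1 := (sg_pos ω.2 j).ne'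
  funext i
  refine Fin.cases ?_ (fun l => ?_) i
  · simp only [Chain.Δ, Chain.U, chn, Fin.cons_zero, psi_zero, ← h0]; ring
  · simp only [Chain.Δ, Chain.U, Chain.ξ, chn, Fin.cons_succ, psi_succ, ← h0]; field_simp

lemma chn_Yb (j : Fin (n+1)) (p : Pt d × Pt d) (ω : Om d n) :
    (chn d n).Yb j p ω = psi p.2 (pos e0 ω.1 j.succ) := by
  simp only [Chain.Yb, chn_Δ, ← map_sum, sum_Ioi_chainDiff]

lemma chn_Ya (j : Fin (n+1)) (p : Pt d × Pt d) (ω : Om d n) :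
    (chn d n).Ya j p ω = psi p.2 (pos e0 ω.1 j.castSucc) := by
  simp only [Chain.Ya, chn_Yb, chn_Δ, ← map_add]
  congr 1
  simp [chainDiff, pos]

lemma psi_det (uv : Pt d) : LinearMap.det (psi uv) = uv 0 ^ (d+2) := by
  rw [← LinearMap.det_toMatrix', Matrix.det_of_isLowerTriangular]
  · rw [Fin.prod_univ_succ]
    simp [LinearMap.toMatrix'_apply, Fin.succ_ne_zero]
    ring
  · intro i j hij
    simp only [OrderDual.toDual_lt_toDual] at hij
    revert hij
    refine Fin.cases ?_ (fun i => ?_) i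
    · intro hij
      have hj : j ≠ 0 := by rintro rfl; simp at hij
      simp [LinearMap.toMatrix'_apply, Pi.single_apply, hj.symm]
    · intro hij
      have hj : j ≠ 0 := by rintro rfl; simp at hij
      simp [LinearMap.toMatrix'_apply, Pi.single_apply, hj.symm, hij.ne]

lemma psi_det_ne {uv : Pt d} (h : 0 < uv 0) : LinearMap.det (psi uv) ≠ 0 := by rw [psi_det]; positivity

/-- rescaling of configurations -/
noncomputable def psiE {uv : Pt d} (h : 0 < uv 0) : Pt d ≃ᵐ Pt d :=
  ((LinearMap.equivOfDetNeZero (psi uv) (psi_det_ne h)).toContinuousLinearEquiv).toHomeomorph.toMeasurableEquiv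

lemma psiE_apply {uv : Pt d} (h : 0 < uv 0) (z : Pt d) : psiE h z = psi uv z := rfl

noncomputable def PsiE (n : ℕ) {uv : Pt d} (h : 0 < uv 0) : (Fin n → Pt d) ≃ᵐ (Fin n → Pt d) :=
  MeasurableEquiv.piCongrRight fun _ => psiE h

lemma PsiE_apply {uv : Pt d} (h : 0 < uv 0) (ω : Fin n → Pt d) : PsiE n h ω = fun i => psi uv (ω i) := rfl

lemma pi_smul_volume (c : ℝ≥0∞) (hc : c ≠ ∞) :
    (Measure.pi fun _ : Fin n => c • (volume : Measure (Pt d))) = c ^ n • volume := by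
  have : SigmaFinite (c • (volume : Measure (Pt d))) := by
    lift c to NNReal using hc
    exact inferInstanceAs (SigmaFinite (c • (volume : Measure (Pt d))))
  refine Measure.pi_eq fun s hs => ?_
  rw [Measure.smul_apply, volume_pi, Measure.pi_pi]
  simp [Finset.prod_mul_distrib]

lemma PsiE_mp {uv : Pt d} (h : 0 < uv 0) :
    MeasurePreserving (PsiE n h) (ENNReal.ofReal (uv 0 ^ (d+2)) ^ n • volume) volume := by
  have hd : 0 < uv 0 ^ (d+2) := by positivity
  have h1 : MeasurePreserving (psiE h) (ENNReal.ofReal (uv 0 ^ (d+2)) • volume) volume := by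
    refine ⟨(psiE h).measurable, ?_⟩
    rw [Measure.map_smul]
    have := Real.map_linearMap_volume_pi_eq_smul_volume_pi (psi_det_ne h)
    rw [psi_det] at this
    have e : Measure.map (psiE h) volume = Measure.map (psi uv) volume := rfl
    rw [e, this, smul_smul, ← ENNReal.ofReal_mul hd.le, abs_of_pos (inv_pos.2 hd), mul_inv_cancel₀ hd.ne']
    simp
  have : SigmaFinite (ENNReal.ofReal (uv 0 ^ (d+2)) • (volume : Measure (Pt d))) := by
    exact inferInstanceAs (SigmaFinite ((uv 0 ^ (d+2)).toNNReal • (volume : Measure (Pt d))))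
  have := measurePreserving_pi (fun _ : Fin n => _) (fun _ : Fin n => volume) (fun _ => h1)
  rw [pi_smul_volume _ ENNReal.ofReal_ne_top] at this
  exact this

/-- density -/
noncomputable def dens (ω : Fin n → Pt d) : ℝ := ∏ j, (sg j ω ^ (d+1))⁻¹

lemma dens_nonneg (ω : Fin n → Pt d) : 0 ≤ dens ω :=
  Finset.prod_nonneg fun j _ => inv_nonneg.2 (pow_nonneg (Real.sqrt_nonneg _) _)

lemma measurable_dens : Measurable (dens (d := d) (n := n)) :=
  Finset.measurable_prod _ fun j _ => ((measurable_sg j).pow_const _).inv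

noncomputable def mu (d n : ℕ) : Measure (Om d n) :=
  (Measure.comap Subtype.val volume).withDensity (fun ω => ENNReal.ofReal (dens ω.1))

lemma integral_mu (g : Om d n → ℝ) (g' : (Fin n → Pt d) → ℝ)
    (hg : ∀ ω, g' ω.1 = dens ω.1 * g ω) (hg' : ∀ ω, ω ∉ Sset d n → g' ω = 0) :
    ∫ ω, g ω ∂(mu d n) = ∫ ω, g' ω := by
  unfold mu
  rw [integral_withDensity_eq_integral_toReal_smul (by
    exact (measurable_dens.comp measurable_subtype_coe).ennreal_ofReal) (by simp)]
  rw [← setIntegral_eq_integral_of_forall_compl_eq_zero (s := Sset d n) hg',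
    ← integral_subtype_comap measurableSet_Sset]
  refine integral_congr_ae (ae_of_all _ fun ω => ?_)
  simp only [ENNReal.toReal_ofReal (dens_nonneg _), smul_eq_mul, hg]

lemma integrable_mu (g : Om d n → ℝ) (g' : (Fin n → Pt d) → ℝ)
    (hg : ∀ ω, g' ω.1 = dens ω.1 * g ω) (hg' : ∀ ω, ω ∉ Sset d n → g' ω = 0) :
    Integrable g (mu d n) ↔ Integrable g' volume := by
  unfold mu
  rw [integrable_withDensity_iff_integrable_smul' (by
    exact (measurable_dens.comp measurable_subtype_coe).ennreal_ofReal) (by simp)]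
  rw [← integrableOn_iff_integrable_of_support_subset (s := Sset d n) (f := g') (by
      intro ω h; by_contra hc; exact h (hg' ω hc))]
  rw [IntegrableOn, ← map_comap_subtype_coe measurableSet_Sset,
    (MeasurableEmbedding.subtype_coe (measurableSet_Sset (d := d) (n := n))).integrable_map_iff]
  refine integrable_congr (ae_of_all _ fun ω => ?_)
  simp only [ENNReal.toReal_ofReal (dens_nonneg _), smul_eq_mul, Function.comp, hg]

/-- change of variables for functions of configurations -/
lemma cov {uv : Pt d} (h : 0 < uv 0) (F : (Fin n → Pt d) → ℝ) (c : ℝ) (g : Om d n → ℝ)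
    (hF : ∀ ω : Om d n, F (fun i => psi uv (ω.1 i)) = c * dens ω.1 * g ω)
    (hF' : ∀ ω : Fin n → Pt d, ω ∉ Sset d n → F (fun i => psi uv (ω i)) = 0) (hg : Integrable g (mu d n)) :
    Integrable F volume ∧ ∫ y, F y = (uv 0 ^ (d+2)) ^ n * c * ∫ ω, g ω ∂(mu d n) := by
  have hd : 0 < uv 0 ^ (d+2) := by positivity
  have hcg : Integrable (fun ω => c * g ω) (mu d n) := hg.const_mul c
  have e : ∀ ω : Om d n, F (fun i => psi uv (ω.1 i)) = dens ω.1 * (c * g ω) := fun ω => by rw [hF]; ring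
  have i1 := (integrable_mu (fun ω => c * g ω) (fun ω : Fin n → Pt d => F (fun i => psi uv (ω i))) e hF').1 hcg
  have i2 := integral_mu (fun ω => c * g ω) (fun ω : Fin n → Pt d => F (fun i => psi uv (ω i))) e hF'
  have mp := PsiE_mp (n := n) h
  have hne : ENNReal.ofReal (uv 0 ^ (d+2)) ^ n ≠ ∞ := ENNReal.pow_ne_top ENNReal.ofReal_ne_top
  constructor
  · rw [← mp.integrable_comp_emb (PsiE n h).measurableEmbedding]
    exact i1.smul_measure hne
  · rw [← mp.integral_comp (PsiE n h).measurableEmbedding, integral_smul_measure]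
    have : ∫ ω, F (PsiE n h ω) = ∫ ω : Fin n → Pt d, F (fun i => psi uv (ω i)) := rfl
    rw [this, ← i2, integral_const_mul, ENNReal.toReal_pow, ENNReal.toReal_ofReal hd.le, smul_eq_mul]
    ring

end conf

/-! ## Part 5b: integrability on configuration space -/

section integ
variable {n : ℕ}

lemma gauss_lint {b : ℝ} (hb : 0 < b) (m : Fin d → ℝ) :
    ∫⁻ y : Fin d → ℝ, ENNReal.ofReal (Real.exp (-b * ∑ l, (y l - m l) ^ 2)) =
      ENNReal.ofReal (Real.sqrt (Real.pi / b) ^ d) := by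
  have h1 : ∀ y : Fin d → ℝ, Real.exp (-b * ∑ l, (y l - m l) ^ 2) = ∏ l, Real.exp (-b * (y l - m l) ^ 2) := by
    intro y; rw [← Real.exp_sum, Finset.mul_sum]
  have h2 : ∀ l, Integrable fun x : ℝ => Real.exp (-b * (x - m l) ^ 2) := fun l =>
    (integrable_exp_neg_mul_sq hb).comp_sub_right (m l)
  have h3 : ∀ l, ∫ x : ℝ, Real.exp (-b * (x - m l) ^ 2) = Real.sqrt (Real.pi / b) := fun l => by
    rw [integral_sub_right_eq_self (fun x => Real.exp (-b * x ^ 2)), integral_gaussian]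
  simp only [h1]
  have hI : Integrable (fun y : Fin d → ℝ => ∏ l, Real.exp (-b * (y l - m l) ^ 2)) volume :=
    Integrable.fintype_prod h2
  rw [← ofReal_integral_eq_lintegral_ofReal hI
    (ae_of_all _ fun y => Finset.prod_nonneg fun _ _ => (Real.exp_pos _).le)]
  rw [integral_fintype_prod_volume_eq_prod (fun l x => Real.exp (-b * (x - m l) ^ 2))]
  simp only [h3, Finset.prod_const, Finset.card_univ, Fintype.card_fin]

lemma lint_rpow {t : ℝ} (ht : 0 < t) : ∫⁻ s in Set.Ioo 0 t, ENNReal.ofReal ((Real.sqrt s)⁻¹) = ENNReal.ofReal (2 * Real.sqrt t) := by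
  have e : ∀ s : ℝ, (Real.sqrt s)⁻¹ = s ^ (-(1/2) : ℝ) ∨ s < 0 := by
    intro s
    rcases lt_or_ge s 0 with h | h
    · exact Or.inr h
    · left; rw [Real.sqrt_eq_rpow, Real.rpow_neg h]
  have hi := intervalIntegral.intervalIntegrable_rpow' (a := 0) (b := t) (r := -(1/2)) (by norm_num)
  rw [intervalIntegrable_iff_integrableOn_Ioo_of_le ht.le] at hi
  have hi2 : ∫ s in Set.Ioo 0 t, s ^ (-(1/2) : ℝ) = 2 * Real.sqrt t := by
    rw [← integral_Ioc_eq_integral_Ioo, ← intervalIntegral.integral_of_le ht.le, integral_rpow (by left; norm_num)]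
    rw [Real.sqrt_eq_rpow]; norm_num; ring
  rw [← hi2, ofReal_integral_eq_lintegral_ofReal hi]
  · refine setLIntegral_congr_fun measurableSet_Ioo fun s hs => ?_
    rcases e s with h | h
    · simp only [h]
    · exact absurd h (not_lt.2 hs.1.le)
  · filter_upwards [ae_restrict_mem measurableSet_Ioo] with s hs
    exact Real.rpow_nonneg hs.1.le _

lemma lint_beta {t : ℝ} (ht : 0 < t) :
    ∫⁻ s in Set.Ioo 0 t, ENNReal.ofReal ((Real.sqrt (t - s) * Real.sqrt s)⁻¹) ≤ ENNReal.ofReal 8 := by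
  have hpt : ∀ s ∈ Set.Ioo 0 t, (Real.sqrt (t - s) * Real.sqrt s)⁻¹ ≤
      (2 * (Real.sqrt t)⁻¹) * ((Real.sqrt s)⁻¹ + (Real.sqrt (t-s))⁻¹) := by
    intro s hs
    have ha : 0 < Real.sqrt s := Real.sqrt_pos.2 hs.1
    have hb : 0 < Real.sqrt (t - s) := Real.sqrt_pos.2 (sub_pos.2 hs.2)
    have hc : 0 < Real.sqrt t := Real.sqrt_pos.2 ht
    have hle : Real.sqrt t ≤ Real.sqrt s + Real.sqrt (t - s) := by
      rw [Real.sqrt_le_left (by positivity), add_sq, Real.sq_sqrt hs.1.le, Real.sq_sqrt (sub_pos.2 hs.2).le]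
      nlinarith [mul_pos ha hb]
    rw [← sub_nonneg]
    have : 2 * (Real.sqrt t)⁻¹ * ((Real.sqrt s)⁻¹ + (Real.sqrt (t-s))⁻¹) - (Real.sqrt (t - s) * Real.sqrt s)⁻¹ =
      (2 * (Real.sqrt s + Real.sqrt (t-s)) - Real.sqrt t) / (Real.sqrt t * Real.sqrt s * Real.sqrt (t-s)) := by
      field_simp; ring
    rw [this]
    apply div_nonneg _ (by positivity)
    linarith
  have hrefl : ∫⁻ s in Set.Ioo 0 t, ENNReal.ofReal ((Real.sqrt (t-s))⁻¹) = ENNReal.ofReal (2 * Real.sqrt t) := by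
    rw [← lint_rpow ht, ← lintegral_indicator measurableSet_Ioo, ← lintegral_indicator measurableSet_Ioo,
      ← lintegral_sub_left_eq_self _ t]
    refine lintegral_congr fun s => ?_
    have : t - s ∈ Set.Ioo 0 t ↔ s ∈ Set.Ioo 0 t := by
      simp only [Set.mem_Ioo]; constructor <;> rintro ⟨h1, h2⟩ <;> constructor <;> linarith
    by_cases h : s ∈ Set.Ioo 0 t
    · rw [Set.indicator_of_mem h, Set.indicator_of_mem (this.2 h)]; simp
    · rw [Set.indicator_of_notMem h, Set.indicator_of_notMem (fun hh => h (this.1 hh))]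
  calc _ ≤ ∫⁻ s in Set.Ioo 0 t, ENNReal.ofReal (2 * (Real.sqrt t)⁻¹) * (ENNReal.ofReal ((Real.sqrt s)⁻¹) + ENNReal.ofReal ((Real.sqrt (t-s))⁻¹)) := by
        refine setLIntegral_mono' measurableSet_Ioo fun s hs => ?_
        rw [← ENNReal.ofReal_add (by positivity) (by positivity), ← ENNReal.ofReal_mul (by positivity)]
        exact ENNReal.ofReal_le_ofReal (hpt s hs)
    _ = ENNReal.ofReal (2 * (Real.sqrt t)⁻¹) * (ENNReal.ofReal (2 * Real.sqrt t) + ENNReal.ofReal (2 * Real.sqrt t)) := by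
        rw [lintegral_const_mul _ (by fun_prop), lintegral_add_left (by fun_prop), lint_rpow ht, hrefl]
    _ = ENNReal.ofReal 8 := by
        rw [← ENNReal.ofReal_add (by positivity) (by positivity), ← ENNReal.ofReal_mul (by positivity)]
        congr 1
        have : Real.sqrt t ≠ 0 := (Real.sqrt_pos.2 ht).ne'
        field_simp; norm_num

/-- comparison kernel -/
noncomputable def kk (ε : ℝ) (z : Pt d) : ℝ :=
  if 0 < z 0 then ((Real.sqrt (z 0)) ^ (d+1))⁻¹ * Real.exp (-ε * ((∑ l : Fin d, z l.succ ^ 2) / z 0)) else 0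

lemma kk_nonneg (ε : ℝ) (z : Pt d) : 0 ≤ kk ε z := by
  unfold kk; split_ifs <;> positivity

lemma kk_meas (ε : ℝ) : Measurable (kk (d := d) ε) := by
  unfold kk
  refine Measurable.ite (measurableSet_lt measurable_const (measurable_pi_apply 0)) ?_ measurable_const
  fun_prop

lemma piFin_symm {β : Type*} [MeasurableSpace β] {m : ℕ} (s : β) (y : Fin m → β) :
    (MeasurableEquiv.piFinSuccAbove (fun _ : Fin (m+1) => β) 0).symm (s, y) = Fin.cons s y := by
  simp [MeasurableEquiv.piFinSuccAbove, MeasurableEquiv.symm, Fin.insertNthEquiv]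

lemma lint_cons (f : Pt d → ℝ≥0∞) (hf : Measurable f) :
    ∫⁻ y, f y = ∫⁻ s : ℝ, ∫⁻ y' : Fin d → ℝ, f (Fin.cons s y') := by
  have := (volume_preserving_piFinSuccAbove (fun _ : Fin (d+1) => ℝ) 0).symm
  rw [← this.lintegral_comp_emb (MeasurableEquiv.measurableEmbedding _), Measure.volume_eq_prod, lintegral_prod]
  · simp only [piFin_symm]
  · exact (hf.comp (MeasurableEquiv.measurable _)).aemeasurable

set_option maxHeartbeats 2000000 in
lemma kk_conv {ε : ℝ} (hε : 0 < ε) : ∃ C : ℝ, 0 ≤ C ∧ ∀ ζ : Pt d, ζ 0 ≤ 1 →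
    ∫⁻ y, ENNReal.ofReal (kk ε (ζ - y)) * ENNReal.ofReal (kk ε y) ≤ ENNReal.ofReal C * ENNReal.ofReal (kk ε ζ) := by
  refine ⟨Real.sqrt (Real.pi / ε) ^ d * 8, by positivity, fun ζ hζ => ?_⟩
  rcases le_or_gt (ζ 0) 0 with h0 | h0
  · have : ∀ y, ENNReal.ofReal (kk ε (ζ - y)) * ENNReal.ofReal (kk ε y) = 0 := by
      intro y
      by_cases hy : 0 < y 0
      · have : kk ε (ζ - y) = 0 := by
          unfold kk; rw [if_neg]; simp only [Pi.sub_apply]; linarith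
        simp [this]
      · simp [kk, hy]
    simp [this]
  set t := ζ 0 with ht
  rw [lint_cons (fun y => ENNReal.ofReal (kk ε (ζ - y)) * ENNReal.ofReal (kk ε y)) (((kk_meas ε).comp (measurable_const.sub measurable_id)).ennreal_ofReal.mul (kk_meas ε).ennreal_ofReal)]
  have hin : ∀ s : ℝ, ∫⁻ y' : Fin d → ℝ, ENNReal.ofReal (kk ε (ζ - Fin.cons s y')) * ENNReal.ofReal (kk ε (Fin.cons s y' : Pt d)) =
      Set.indicator (Set.Ioo 0 t) (fun s => ENNReal.ofReal (Real.sqrt (Real.pi / ε) ^ d * Real.sqrt t * kk ε ζ) *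
        ENNReal.ofReal ((Real.sqrt (t - s) * Real.sqrt s)⁻¹)) s := by
    intro s
    by_cases hs : s ∈ Set.Ioo 0 t
    swap
    · rw [Set.indicator_of_notMem hs]
      rw [← lintegral_zero]
      refine lintegral_congr fun y => ?_
      by_cases h : 0 < s
      · have : ¬ (0 < t - s) := fun hh => hs ⟨h, by linarith⟩
        have : kk ε (ζ - (Fin.cons s y : Pt d)) = 0 := by
          simp only [kk, Pi.sub_apply, Fin.cons_zero]
          rw [if_neg this]
        rw [this]; simp
      · simp [kk, h]
    rw [Set.indicator_of_mem hs]
    obtain ⟨hs0, hst⟩ := hs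
    have hts : 0 < t - s := sub_pos.2 hst
    set a := Real.sqrt (t - s) with ha
    set b := Real.sqrt s with hb
    have ha0 : 0 < a := Real.sqrt_pos.2 hts
    have hb0 : 0 < b := Real.sqrt_pos.2 hs0
    have hc0 : 0 < Real.sqrt t := Real.sqrt_pos.2 h0
    have ha2 : a ^ 2 = t - s := Real.sq_sqrt hts.le
    have hb2 : b ^ 2 = s := Real.sq_sqrt hs0.le
    set β := ε * t / (s * (t - s)) with hβ
    have hβ0 : 0 < β := by positivity
    have hpt : ∀ y : Fin d → ℝ, ENNReal.ofReal (kk ε (ζ - Fin.cons s y)) * ENNReal.ofReal (kk ε (Fin.cons s y : Pt d)) =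
        ENNReal.ofReal ((a ^ (d+1))⁻¹ * (b ^ (d+1))⁻¹ * Real.exp (-ε * ((∑ l : Fin d, ζ l.succ ^ 2) / t))) *
          ENNReal.ofReal (Real.exp (-β * ∑ l, (y l - s / t * ζ l.succ) ^ 2)) := by
      intro y
      rw [← ENNReal.ofReal_mul (kk_nonneg _ _), ← ENNReal.ofReal_mul (by positivity)]
      congr 1
      simp only [kk, Pi.sub_apply, Fin.cons_zero, Fin.cons_succ, ← ht]
      rw [if_pos hts, if_pos hs0, ← ha, ← hb]
      have : Real.exp (-ε * ((∑ l : Fin d, (ζ l.succ - y l) ^ 2) / (t - s))) * Real.exp (-ε * ((∑ l : Fin d, y l ^ 2) / s)) =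
        Real.exp (-ε * ((∑ l : Fin d, ζ l.succ ^ 2) / t)) * Real.exp (-β * ∑ l, (y l - s / t * ζ l.succ) ^ 2) := by
        rw [← Real.exp_add, ← Real.exp_add]
        congr 1
        simp only [Finset.sum_div, Finset.mul_sum, ← Finset.sum_add_distrib]
        refine Finset.sum_congr rfl fun l _ => ?_
        have h1 := hts.ne'
        have h2 := hs0.ne'
        have h3 := h0.ne'
        rw [hβ]
        field_simp
        ring
      linear_combination ((a ^ (d+1))⁻¹ * (b ^ (d+1))⁻¹) * this
    simp only [hpt]
    rw [lintegral_const_mul _ (by fun_prop), gauss_lint hβ0, ← ENNReal.ofReal_mul (by positivity),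
      ← ENNReal.ofReal_mul (mul_nonneg (by positivity) (kk_nonneg _ _))]
    congr 1
    have hsq : Real.sqrt (Real.pi / β) = Real.sqrt (Real.pi / ε) * (a * b / Real.sqrt t) := by
      rw [Real.sqrt_eq_iff_mul_self_eq (by positivity) (by positivity)]
      have h1 : Real.sqrt (Real.pi / ε) ^ 2 = Real.pi / ε := Real.sq_sqrt (by positivity)
      have h2 : Real.sqrt t ^ 2 = t := Real.sq_sqrt h0.le
      have : (Real.sqrt (Real.pi / ε) * (a * b / Real.sqrt t)) * (Real.sqrt (Real.pi / ε) * (a * b / Real.sqrt t)) =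
        Real.sqrt (Real.pi / ε) ^ 2 * (a ^ 2 * b ^ 2 / Real.sqrt t ^ 2) := by ring
      rw [this, h1, h2, ha2, hb2, hβ]
      have h1 := hts.ne'
      field_simp
    rw [hsq]
    simp only [kk, ← ht]
    rw [if_pos h0, mul_pow, div_pow, mul_pow]
    field_simp
    ring
  simp only [hin]
  rw [lintegral_indicator measurableSet_Ioo, lintegral_const_mul _ (by fun_prop)]
  calc _ ≤ ENNReal.ofReal (Real.sqrt (Real.pi / ε) ^ d * Real.sqrt t * kk ε ζ) * ENNReal.ofReal 8 := by
        gcongr; exact lint_beta h0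
    _ ≤ _ := by
        rw [← ENNReal.ofReal_mul (mul_nonneg (by positivity) (kk_nonneg _ _)), ← ENNReal.ofReal_mul (by positivity)]
        apply ENNReal.ofReal_le_ofReal
        have h1 : Real.sqrt t ≤ 1 := Real.sqrt_le_one.2 hζ
        have h2 := kk_nonneg ε ζ
        calc _ = (Real.sqrt (Real.pi / ε) ^ d * kk ε ζ * 8) * Real.sqrt t := by ring
          _ ≤ (Real.sqrt (Real.pi / ε) ^ d * kk ε ζ * 8) * 1 := by gcongr
          _ = _ := by ring

lemma chainDiff_cons_zero (ζ y : Pt d) (ω : Fin n → Pt d) : chainDiff ζ (Fin.cons y ω) 0 = ζ - y := by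
  unfold chainDiff
  have : (Fin.snoc (Fin.cons y ω : Fin (n+1) → Pt d) 0 : Fin (n+2) → Pt d) 0 = y := by
    rw [show (0 : Fin (n+2)) = Fin.castSucc 0 from rfl, Fin.snoc_castSucc]; rfl
  simp [this]

lemma chainDiff_cons_succ (ζ y : Pt d) (ω : Fin n → Pt d) (j : Fin (n+1)) :
    chainDiff ζ (Fin.cons y ω) j.succ = chainDiff y ω j := by
  unfold chainDiff
  rw [← Fin.cons_snoc_eq_snoc_cons]
  simp

lemma kk_chain {ε C : ℝ} (hC : ∀ ζ : Pt d, ζ 0 ≤ 1 →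
    ∫⁻ y, ENNReal.ofReal (kk ε (ζ - y)) * ENNReal.ofReal (kk ε y) ≤ ENNReal.ofReal C * ENNReal.ofReal (kk ε ζ))
    (n : ℕ) (ζ : Pt d) (hζ : ζ 0 ≤ 1) :
    ∫⁻ ω : Fin n → Pt d, ∏ j, ENNReal.ofReal (kk ε (chainDiff ζ ω j)) ≤ ENNReal.ofReal C ^ n * ENNReal.ofReal (kk ε ζ) := by
  induction n generalizing ζ with
  | zero =>
    rw [volume_pi, Measure.pi_of_empty, lintegral_dirac]
    have : chainDiff ζ (fun a : Fin 0 => a.elim0) 0 = ζ := by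
      have : (Fin.snoc (fun a : Fin 0 => a.elim0) 0 : Fin 1 → Pt d) 0 = 0 := rfl
      simp [chainDiff, this]
    simp
    refine le_of_eq ?_
    congr 2
  | succ n ih =>
    have mp := (volume_preserving_piFinSuccAbove (fun _ : Fin (n+1) => Pt d) 0).symm
    have hm : ∀ (ζ : Pt d) m, Measurable fun ω : Fin m → Pt d => ∏ j, ENNReal.ofReal (kk ε (chainDiff ζ ω j)) := fun ζ m =>
      Finset.measurable_prod _ fun j _ => ((kk_meas ε).comp (measurable_chainDiff ζ j)).ennreal_ofReal
    rw [← mp.lintegral_comp_emb (MeasurableEquiv.measurableEmbedding _), Measure.volume_eq_prod, lintegral_prod]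
    swap
    · exact ((hm ζ _).comp (MeasurableEquiv.measurable _)).aemeasurable
    calc _ = ∫⁻ y : Pt d, ∫⁻ ω : Fin n → Pt d, ENNReal.ofReal (kk ε (ζ - y)) * ∏ j, ENNReal.ofReal (kk ε (chainDiff y ω j)) := by
          refine lintegral_congr fun y => lintegral_congr fun ω => ?_
          have e : (MeasurableEquiv.piFinSuccAbove (fun _ : Fin (n+1) => Pt d) 0).symm (y, ω) = Fin.cons y ω := piFin_symm _ _
          rw [e, Fin.prod_univ_succ, chainDiff_cons_zero]
          simp only [chainDiff_cons_succ]
      _ ≤ ∫⁻ y : Pt d, ENNReal.ofReal C ^ n * (ENNReal.ofReal (kk ε (ζ - y)) * ENNReal.ofReal (kk ε y)) := by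
          refine lintegral_mono fun y => ?_
          by_cases hy : y 0 ≤ 1
          · rw [lintegral_const_mul _ (hm y n)]
            calc _ ≤ ENNReal.ofReal (kk ε (ζ - y)) * (ENNReal.ofReal C ^ n * ENNReal.ofReal (kk ε y)) := by
                  gcongr; exact ih y hy
              _ = _ := by ring
          · have : kk ε (ζ - y) = 0 := by
              unfold kk
              rw [if_neg]
              simp only [Pi.sub_apply]; linarith
            simp [this]
      _ ≤ _ := by
          have hm2 : Measurable fun y : Pt d => ENNReal.ofReal (kk ε (ζ - y)) * ENNReal.ofReal (kk ε y) :=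
            ((kk_meas ε).comp (measurable_const.sub measurable_id)).ennreal_ofReal.mul (kk_meas ε).ennreal_ofReal
          rw [lintegral_const_mul _ hm2,
            pow_succ, mul_assoc]
          gcongr
          exact hC ζ hζ

lemma chn_int {ε : ℝ} (hε : 0 < ε) (k : ℕ) :
    Integrable (fun ω => (1 + (chn d n).κ ω) ^ k * Real.exp (-(ε * (chn d n).κ ω))) (mu d n) := by
  have hm := (chn d n).κ_meas
  have h1 : Integrable (fun ω => Real.exp (-(ε/2 * (chn d n).κ ω))) (mu d n) := by
    rw [integrable_mu _ (fun ω => ∏ j, kk (ε/2) (chainDiff e0 ω j))]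
    · obtain ⟨C, hC, h⟩ := kk_conv (d := d) (half_pos hε)
      have hc := kk_chain h n e0 (by simp [e0])
      refine ⟨(Finset.measurable_prod _ fun j _ => (kk_meas _).comp (measurable_chainDiff _ j)).aestronglyMeasurable, ?_⟩
      unfold HasFiniteIntegral
      refine lt_of_le_of_lt (le_of_eq_of_le ?_ hc) (ENNReal.mul_lt_top (ENNReal.pow_lt_top ENNReal.ofReal_lt_top) ENNReal.ofReal_lt_top)
      refine lintegral_congr fun ω => ?_
      rw [Real.enorm_eq_ofReal (Finset.prod_nonneg fun j _ => kk_nonneg _ _), ENNReal.ofReal_prod_of_nonneg fun j _ => kk_nonneg _ _]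
    · intro ω
      simp only [kk, ω.2 _, if_true]
      rw [Finset.prod_mul_distrib, ← Real.exp_sum]
      congr 2
      simp only [Chain.κ, chn, div_pow, sg_sq ω.2, Finset.mul_sum, Finset.sum_div, ← Finset.sum_neg_distrib]
      refine Finset.sum_congr rfl fun j _ => Finset.sum_congr rfl fun l _ => ?_
      ring
    · intro ω hω
      simp only [Sset, Set.mem_setOf_eq, not_forall] at hω
      obtain ⟨j, hj⟩ := hω
      refine Finset.prod_eq_zero (Finset.mem_univ j) ?_
      simp [kk, hj]
  obtain ⟨C, hC⟩ : ∃ C : ℝ, ∀ x : ℝ, 0 ≤ x → (1 + x) ^ k * Real.exp (-(ε/2 * x)) ≤ C := by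
    have h2 : Tendsto (fun x : ℝ => Real.exp (ε/2) * ((1 + x) ^ k * Real.exp (-(ε/2) * (1 + x)))) atTop (nhds (Real.exp (ε/2) * 0)) := by
      refine Tendsto.const_mul _ ?_
      have := tendsto_rpow_mul_exp_neg_mul_atTop_nhds_zero k (ε/2) (half_pos hε)
      have := this.comp (tendsto_atTop_add_const_left atTop (1:ℝ) tendsto_id)
      refine this.congr fun x => ?_
      simp
    have h3 : Tendsto (fun x : ℝ => (1 + x) ^ k * Real.exp (-(ε/2 * x))) atTop (nhds 0) := by
      rw [mul_zero] at h2
      refine h2.congr fun x => ?_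
      rw [mul_left_comm, ← Real.exp_add]; congr 2; ring
    have hc : ContinuousOn (fun x : ℝ => (1 + x) ^ k * Real.exp (-(ε/2 * x))) (Set.Ici 0) := by fun_prop
    obtain ⟨R, hR⟩ := (h3.eventually (ge_mem_nhds (zero_lt_one))).exists_forall_of_atTop
    obtain ⟨B, hB⟩ := (isCompact_Icc (a := (0:ℝ)) (b := R)).bddAbove_image (f := fun x : ℝ => (1 + x) ^ k * Real.exp (-(ε/2 * x))) (by fun_prop)
    refine ⟨max B 1, fun x hx => ?_⟩
    rcases le_total x R with h | h
    · exact (hB ⟨x, ⟨hx, h⟩, rfl⟩).trans (le_max_left _ _)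
    · exact (hR x h).trans (le_max_right _ _)
  refine (h1.const_mul C).mono' ?_ (ae_of_all _ fun ω => ?_)
  · have : Measurable fun ω => (1 + (chn d n).κ ω) ^ k * Real.exp (-(ε * (chn d n).κ ω)) := by fun_prop
    exact this.aestronglyMeasurable
  · have h0 := (chn d n).κ_nonneg ω
    rw [Real.norm_of_nonneg (by positivity)]
    have : Real.exp (-(ε * (chn d n).κ ω)) = Real.exp (-(ε/2 * (chn d n).κ ω)) * Real.exp (-(ε/2 * (chn d n).κ ω)) := by
      rw [← Real.exp_add]; congr 1; ring
    rw [this, ← mul_assoc]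
    gcongr
    exact hC _ h0

instance : SFinite (mu d n) := by
  unfold mu
  have : SFinite (Measure.comap (Subtype.val : Om d n → _) (volume : Measure (Fin n → Pt d))) := by
    have : SigmaFinite (Measure.comap (Subtype.val : Om d n → _) (volume : Measure (Fin n → Pt d))) := by
      refine SigmaFinite.of_map _ (f := (Subtype.val : Om d n → _)) measurable_subtype_coe.aemeasurable ?_
      rw [map_comap_subtype_coe measurableSet_Sset]
      infer_instance
    infer_instance
  infer_instance

end integ

/-! ## Part 6: the frozen kernel and the kernel `E` -/

lemma pd_eq {i : Fin (d+1)} {f : Pt d → ℝ} {z : Pt d} {v : ℝ} (hf : DifferentiableAt ℝ f z)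
    (h : HasDerivAt (fun s : ℝ => f (z + s • (Pi.single i 1 : Pt d))) v 0) : pd i f z = v := by
  have h1 : HasDerivAt (fun s : ℝ => z + s • (Pi.single i 1 : Pt d)) ((1:ℝ) • (Pi.single i 1 : Pt d)) 0 :=
    ((hasDerivAt_id (0:ℝ)).smul_const _).const_add z
  have h2 : HasFDerivAt f (fderiv ℝ f z) (z + (0:ℝ) • (Pi.single i 1 : Pt d)) := by
    simpa using hf.hasFDerivAt
  have h3 := h2.comp_hasDerivAt (0:ℝ) h1
  rw [one_smul] at h3
  exact h3.unique h

lemma pd_zero_of_le {c : ℝ} (i : Fin d) {f : Pt d → ℝ} {z : Pt d} (hf : ∀ y : Pt d, y 0 ≤ c → f y = 0) (hz : z 0 ≤ c) :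
    pd i.succ f z = 0 := by
  by_cases h : DifferentiableAt ℝ f z
  · refine pd_eq h ?_
    have : (fun s : ℝ => f (z + s • (Pi.single i.succ 1 : Pt d))) = fun _ => 0 := by
      funext s
      apply hf
      simp [Pi.single_apply, hz, (Fin.succ_ne_zero i).symm]
    rw [this]; exact hasDerivAt_const _ _
  · simp [pd, fderiv_zero_of_not_differentiableAt h]

/-- normalization constant -/
noncomputable def c0 (d : ℕ) : ℝ := (4 * Real.pi) ^ (-(d : ℝ) / 2)

lemma Wker_eq {lam : ℝ} {ρ : ℕ} {A : Coeffs d} (h : ParReg lam ρ A) (hl : 0 < lam) (w z : Pt d) (hz : 0 < z 0) :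
    Wker A w z = c0 d * (Real.sqrt (z 0) ^ d)⁻¹ * Real.exp (-(1/2 * Real.log (A.a w).det +
      1/4 * ∑ l, ∑ l', (A.a w)⁻¹ l l' * ((z l.succ / Real.sqrt (z 0)) * (z l'.succ / Real.sqrt (z 0))))) := by
  have hd := h.det_pos hl w
  have hs : Real.sqrt (z 0) ^ 2 = z 0 := Real.sq_sqrt hz.le
  have hs0 : 0 < Real.sqrt (z 0) := Real.sqrt_pos.2 hz
  unfold Wker
  rw [if_pos hz, neg_add, Real.exp_add]
  have e1 : (A.a w).det ^ (-(1:ℝ)/2) = Real.exp (-(1/2 * Real.log (A.a w).det)) := by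
    rw [Real.rpow_def_of_pos hd]; congr 1; ring
  have e2 : z 0 ^ (-(d:ℝ)/2) = (Real.sqrt (z 0) ^ d)⁻¹ := by
    rw [neg_div, Real.rpow_neg hz.le, Real.sqrt_eq_rpow, ← Real.rpow_natCast, ← Real.rpow_mul hz.le]
    congr 2; ring
  have e3 : -(∑ i, ∑ j, (A.a w)⁻¹ i j * z i.succ * z j.succ) / (4 * z 0) =
     -(1/4 * ∑ l, ∑ l', (A.a w)⁻¹ l l' * ((z l.succ / Real.sqrt (z 0)) * (z l'.succ / Real.sqrt (z 0)))) := by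
    rw [neg_div]; congr 1
    rw [Finset.sum_div, Finset.mul_sum]
    refine Finset.sum_congr rfl fun i _ => ?_
    rw [Finset.sum_div, Finset.mul_sum]
    refine Finset.sum_congr rfl fun j _ => ?_
    rw [div_mul_div_comm, ← sq, hs]
    field_simp
  rw [e1, e2, e3, c0]; ring

section kernel
variable {lam : ℝ} {ρ : ℕ} {A : Coeffs d}

lemma Zker_zero (z zb : Pt d) (h : z 0 ≤ zb 0) : Zker A z zb = 0 := by
  unfold Zker Wker
  rw [if_neg]; simp only [Pi.sub_apply]; linarith

/-- the vector `a⁻¹ x` -/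
noncomputable def avec (A : Coeffs d) (zb z : Pt d) (i : Fin d) : ℝ := ∑ m, (A.a zb)⁻¹ i m * (z m.succ - zb m.succ)

lemma Zker_diff (z zb : Pt d) (h : zb 0 < z 0) : DifferentiableAt ℝ (fun y => Zker A y zb) z := by
  have hpos : 0 < z 0 - zb 0 := sub_pos.2 h
  have : (fun y => Zker A y zb) =ᶠ[nhds z] fun y => (4 * Real.pi) ^ (-(d : ℝ) / 2) * (A.a zb).det ^ (-(1 : ℝ) / 2) *
      (y 0 - zb 0) ^ (-(d : ℝ) / 2) *
      Real.exp (-(∑ i, ∑ j, (A.a zb)⁻¹ i j * (y i.succ - zb i.succ) * (y j.succ - zb j.succ)) / (4 * (y 0 - zb 0))) := by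
    have ho : IsOpen {y : Pt d | zb 0 < y 0} := isOpen_lt continuous_const (continuous_apply 0)
    filter_upwards [ho.mem_nhds h] with y hy
    unfold Zker Wker
    rw [if_pos]; rfl
    simpa using hy
  refine DifferentiableAt.congr_of_eventuallyEq ?_ this
  have h1 : DifferentiableAt ℝ (fun y : Pt d => y 0 - zb 0) z := by fun_prop
  have h2 : DifferentiableAt ℝ (fun y : Pt d => (y 0 - zb 0) ^ (-(d : ℝ) / 2)) z := h1.rpow_const (Or.inl hpos.ne')
  have h3 : DifferentiableAt ℝ (fun y : Pt d => -(∑ i, ∑ j, (A.a zb)⁻¹ i j * (y i.succ - zb i.succ) * (y j.succ - zb j.succ)) / (4 * (y 0 - zb 0))) z := by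
    simp only [div_eq_mul_inv]
    refine DifferentiableAt.mul (by fun_prop) (DifferentiableAt.inv (by fun_prop) (by positivity))
  exact (h2.const_mul _).mul h3.exp

lemma qf_line (M : Matrix (Fin d) (Fin d) ℝ) (hM : ∀ i j, M i j = M j i) (x : Fin d → ℝ) (i : Fin d) (s : ℝ) :
    ∑ k, ∑ j, M k j * (x k + s * Pi.single (M := fun _ => ℝ) i 1 k) * (x j + s * Pi.single (M := fun _ => ℝ) i 1 j) =
      ∑ k, ∑ j, M k j * x k * x j + 2 * s * ∑ m, M i m * x m + s ^ 2 * M i i := by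
  have h1 : ∀ k j, M k j * (x k + s * Pi.single (M := fun _ => ℝ) i 1 k) * (x j + s * Pi.single (M := fun _ => ℝ) i 1 j) =
    M k j * x k * x j + (s * (M k j * x j)) * Pi.single (M := fun _ => ℝ) i 1 k + (s * (M k j * x k)) * Pi.single (M := fun _ => ℝ) i 1 j
     + (s ^ 2 * M k j * Pi.single (M := fun _ => ℝ) i 1 j) * Pi.single (M := fun _ => ℝ) i 1 k := by intros; ring
  simp only [h1, Finset.sum_add_distrib]
  have h2 : ∀ f : Fin d → ℝ, ∑ k, f k * Pi.single (M := fun _ => ℝ) i 1 k = f i := by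
    intro f; simp [Pi.single_apply]
  simp only [← Finset.sum_mul, h2]
  rw [← Finset.mul_sum, ← Finset.mul_sum]
  have : ∑ k, M k i * x k = ∑ k, M i k * x k := Finset.sum_congr rfl fun k _ => by rw [hM]
  rw [this]; ring

lemma single_succ (i k : Fin d) : (Pi.single i.succ 1 : Pt d) k.succ = Pi.single (M := fun _ => ℝ) i 1 k := by
  simp [Pi.single_apply]

lemma Zker_line (h : ParReg lam ρ A) (hl : 0 < lam) (z zb : Pt d) (hz : zb 0 < z 0) (i : Fin d) :
    HasDerivAt (fun s : ℝ => Zker A (z + s • (Pi.single i.succ 1 : Pt d)) zb)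
      (-(1/2) * (avec A zb z i / (z 0 - zb 0)) * Zker A z zb) 0 := by
  have hpos : 0 < z 0 - zb 0 := sub_pos.2 hz
  set t := z 0 - zb 0 with ht
  set q := ∑ k, ∑ j, (A.a zb)⁻¹ k j * (z k.succ - zb k.succ) * (z j.succ - zb j.succ) with hq
  set K := (4 * Real.pi) ^ (-(d : ℝ) / 2) * (A.a zb).det ^ (-(1 : ℝ) / 2) * t ^ (-(d : ℝ) / 2) with hK
  have e : ∀ s : ℝ, Zker A (z + s • (Pi.single i.succ 1 : Pt d)) zb = K * Real.exp (-(q + 2 * s * avec A zb z i + s ^ 2 * (A.a zb)⁻¹ i i) / (4 * t)) := by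
    intro s
    have e0 : (z + s • (Pi.single i.succ 1 : Pt d) - zb) 0 = t := by
      simp [Pi.single_apply, (Fin.succ_ne_zero i).symm, ht]
    unfold Zker Wker
    rw [e0, if_pos hpos, hK, hq, avec, ← qf_line _ (fun a b => h.inv_symm hl zb a b)]
    congr 3
    congr 1
    refine Finset.sum_congr rfl fun k _ => Finset.sum_congr rfl fun j _ => ?_
    simp only [Pi.sub_apply, Pi.add_apply, Pi.smul_apply, single_succ, smul_eq_mul]
    ring
  have e1 : Zker A z zb = K * Real.exp (-q / (4 * t)) := by
    have := e 0; simpa using this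
  simp only [e]
  have hd : HasDerivAt (fun s : ℝ => -(q + 2 * s * avec A zb z i + s ^ 2 * (A.a zb)⁻¹ i i) / (4 * t)) (-(2 * avec A zb z i) / (4 * t)) 0 := by
    have h1 := ((((hasDerivAt_id (0:ℝ)).const_mul 2).mul_const (avec A zb z i)).const_add q).add
      (((hasDerivAt_id (0:ℝ)).pow 2).mul_const ((A.a zb)⁻¹ i i))
    have := (h1.neg.div_const (4 * t))
    refine this.congr_deriv ?_
    simp
  refine (hd.exp.const_mul K).congr_deriv ?_
  rw [e1]
  simp only [mul_zero, zero_mul, add_zero, ne_eq, OfNat.ofNat_ne_zero, not_false_eq_true, zero_pow]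
  field_simp
  ring

lemma ZkerD_eq (h : ParReg lam ρ A) (hl : 0 < lam) (z zb : Pt d) (hz : zb 0 < z 0) (i : Fin d) :
    ZkerD A i z zb = -(1/2) * (avec A zb z i / (z 0 - zb 0)) * Zker A z zb :=
  pd_eq (Zker_diff z zb hz) (Zker_line h hl z zb hz i)

lemma ZkerD_zero (z zb : Pt d) (hz : z 0 ≤ zb 0) (i : Fin d) : ZkerD A i z zb = 0 :=
  pd_zero_of_le (c := zb 0) i (fun y hy => Zker_zero y zb hy) hz

lemma ZkerDD_zero (z zb : Pt d) (hz : z 0 ≤ zb 0) (i j : Fin d) : ZkerDD A i j z zb = 0 :=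
  pd_zero_of_le (c := zb 0) i (fun y hy => ZkerD_zero y zb hy j) hz

lemma ZkerDD_eq (h : ParReg lam ρ A) (hl : 0 < lam) (z zb : Pt d) (hz : zb 0 < z 0) (i j : Fin d) :
    ZkerDD A i j z zb = (1/4 * (avec A zb z i / (z 0 - zb 0)) * (avec A zb z j / (z 0 - zb 0)) -
      1/2 * (A.a zb)⁻¹ i j / (z 0 - zb 0)) * Zker A z zb := by
  have hpos : 0 < z 0 - zb 0 := sub_pos.2 hz
  have ho : IsOpen {y : Pt d | zb 0 < y 0} := isOpen_lt continuous_const (continuous_apply 0)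
  have hev : (fun y => pd j.succ (fun y' => Zker A y' zb) y) =ᶠ[nhds z]
      fun y => -(1/2) * (avec A zb y j / (y 0 - zb 0)) * Zker A y zb := by
    filter_upwards [ho.mem_nhds hz] with y hy using ZkerD_eq h hl y zb hy j
  have hda : Differentiable ℝ fun y => avec A zb y j := by unfold avec; fun_prop
  unfold ZkerDD
  have hpd : ∀ f g : Pt d → ℝ, f =ᶠ[nhds z] g → pd i.succ f z = pd i.succ g z := by
    intro f g hfg; unfold pd; rw [hfg.fderiv_eq]
  rw [hpd _ _ hev]
  refine pd_eq ?_ ?_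
  · refine DifferentiableAt.mul ?_ (Zker_diff z zb hz)
    simp only [div_eq_mul_inv]
    refine DifferentiableAt.const_mul (DifferentiableAt.mul (hda z) (DifferentiableAt.inv (by fun_prop) hpos.ne')) _
  · have e1 : ∀ s : ℝ, -(1/2) * (avec A zb (z + s • (Pi.single i.succ 1 : Pt d)) j / ((z + s • (Pi.single i.succ 1 : Pt d)) 0 - zb 0)) =
      -(1/2) * ((avec A zb z j + s * (A.a zb)⁻¹ i j) / (z 0 - zb 0)) := by
      intro s
      have e0 : (z + s • (Pi.single i.succ 1 : Pt d)) 0 = z 0 := by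
        simp [Pi.single_apply, (Fin.succ_ne_zero i).symm]
      have e2 : avec A zb (z + s • (Pi.single i.succ 1 : Pt d)) j = avec A zb z j + s * (A.a zb)⁻¹ i j := by
        rw [h.inv_symm hl zb i j]
        unfold avec
        have : ∀ m, (A.a zb)⁻¹ j m * ((z + s • (Pi.single i.succ 1 : Pt d)) m.succ - zb m.succ) =
          (A.a zb)⁻¹ j m * (z m.succ - zb m.succ) + (s * (A.a zb)⁻¹ j m) * Pi.single (M := fun _ => ℝ) i 1 m := by
          intro m
          simp only [Pi.add_apply, Pi.smul_apply, single_succ, smul_eq_mul]; ring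
        simp only [this, Finset.sum_add_distrib]
        congr 1
        simp [Pi.single_apply]
      rw [e0, e2]
    simp only [e1]
    have h1 : HasDerivAt (fun s : ℝ => -(1/2) * ((avec A zb z j + s * (A.a zb)⁻¹ i j) / (z 0 - zb 0)))
      (-(1/2) * ((A.a zb)⁻¹ i j / (z 0 - zb 0))) 0 := by
      have := ((((hasDerivAt_id (0:ℝ)).mul_const ((A.a zb)⁻¹ i j)).const_add (avec A zb z j)).div_const (z 0 - zb 0)).const_mul (-(1/2))
      simpa using this
    refine (h1.mul (Zker_line h hl z zb hz i)).congr_deriv ?_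
    simp only [zero_smul, add_zero, zero_mul]
    ring

lemma Eker_zero (z zb : Pt d) (hz : z 0 ≤ zb 0) : Eker A z zb = 0 := by
  simp [Eker, ZkerDD_zero z zb hz, ZkerD_zero z zb hz, Zker_zero z zb hz]

lemma Eker_eq (h : ParReg lam ρ A) (hl : 0 < lam) (z zb : Pt d) (U : ℝ) (ξ : Fin d → ℝ) (hU : 0 < U) (hz : z 0 - zb 0 = U ^ 2)
    (hx : ∀ l, z l.succ - zb l.succ = U * ξ l) :
    -Eker A z zb = U⁻¹ * ((∑ i, ∑ l, ((A.a z i l - A.a zb i l) / U) * (1/4 * ((∑ m, (A.a zb)⁻¹ i m * ξ m) * (∑ m, (A.a zb)⁻¹ l m * ξ m))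
      + (-1/2) * (A.a zb)⁻¹ i l)) + (-1/2) * (∑ l, A.b z l * (∑ m, (A.a zb)⁻¹ l m * ξ m)) + U * A.c z) * Zker A z zb := by
  have hpos : zb 0 < z 0 := by have : 0 < U ^ 2 := by positivity
                               linarith
  have ha : ∀ i, avec A zb z i / (z 0 - zb 0) = U⁻¹ * ∑ m, (A.a zb)⁻¹ i m * ξ m := by
    intro i
    unfold avec
    rw [hz, Finset.sum_div, Finset.mul_sum]
    refine Finset.sum_congr rfl fun m _ => ?_
    rw [hx]; field_simp
  unfold Eker
  simp only [ZkerDD_eq h hl z zb hpos, ZkerD_eq h hl z zb hpos, ha]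
  set a := fun i => ∑ m, (A.a zb)⁻¹ i m * ξ m with hadef
  have ha' : ∀ i, ∑ m, (A.a zb)⁻¹ i m * ξ m = a i := fun i => rfl
  simp only [ha', hz]
  have e1 : ∑ i, ∑ j, (A.a zb i j - A.a z i j) * ((1/4 * (U⁻¹ * a i) * (U⁻¹ * a j) - 1/2 * (A.a zb)⁻¹ i j / U ^ 2) * Zker A z zb) =
    -(U⁻¹ * (∑ i, ∑ l, ((A.a z i l - A.a zb i l) / U) * (1/4 * (a i * a l) + (-1/2) * (A.a zb)⁻¹ i l)) * Zker A z zb) := by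
    simp only [Finset.mul_sum, Finset.sum_mul, ← Finset.sum_neg_distrib]
    refine Finset.sum_congr rfl fun i _ => Finset.sum_congr rfl fun j _ => ?_
    field_simp
    ring
  have e2 : ∑ i, A.b z i * (-(1/2) * (U⁻¹ * a i) * Zker A z zb) = U⁻¹ * ((-1/2) * ∑ l, A.b z l * a l) * Zker A z zb := by
    simp only [Finset.mul_sum, Finset.sum_mul]
    refine Finset.sum_congr rfl fun i _ => ?_
    ring
  rw [e1, e2]
  have : U⁻¹ * U = 1 := inv_mul_cancel₀ hU.ne'
  linear_combination (-(A.c z * Zker A z zb)) * this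

end kernel

/-! ## Part 7: the Volterra terms as chain integrals -/

section volt
variable {n : ℕ}

/-- absolute positions of a chain -/
def pts (z : Pt d) (y : Fin n → Pt d) (zb : Pt d) : Fin (n+2) → Pt d := Fin.cons z (Fin.snoc y zb)

noncomputable def Jn (A : Coeffs d) (n : ℕ) (z zb : Pt d) (y : Fin n → Pt d) : ℝ :=
  Zker A (pts z y zb 0) (pts z y zb 1) *
    ∏ j : Fin n, -Eker A (pts z y zb j.succ.castSucc) (pts z y zb j.succ.succ)

lemma Jn_zero (A : Coeffs d) (z zb : Pt d) (y : Fin n → Pt d) (j : Fin (n+1))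
    (h : pts z y zb j.castSucc 0 ≤ pts z y zb j.succ 0) : Jn A n z zb y = 0 := by
  unfold Jn
  revert h
  refine Fin.cases (fun h => ?_) (fun j h => ?_) j
  · have : Zker A (pts z y zb 0) (pts z y zb 1) = 0 := Zker_zero _ _ h
    rw [this, zero_mul]
  · rw [Finset.prod_eq_zero (Finset.mem_univ j), mul_zero]
    rw [Eker_zero _ _ h, neg_zero]

lemma Jn_zero' (A : Coeffs d) (z zb : Pt d) (h : z 0 ≤ zb 0) (y : Fin n → Pt d) : Jn A n z zb y = 0 := by
  by_contra hne
  have h1 : ∀ j : Fin (n+1), pts z y zb j.succ 0 < pts z y zb j.castSucc 0 := by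
    intro j
    by_contra hj
    exact hne (Jn_zero A z zb y j (not_lt.1 hj))
  have h2 : StrictAnti (fun i : Fin (n+2) => pts z y zb i 0) := Fin.strictAnti_iff_succ_lt.2 h1
  have h3 : pts z y zb (Fin.last (n+1)) 0 < pts z y zb 0 0 := h2 (Fin.last_pos)
  have h4 : pts z y zb (Fin.last (n+1)) = zb := by rw [← Fin.succ_last]; simp [pts]
  have h5 : pts z y zb 0 = z := by simp [pts]
  rw [h4, h5] at h3
  linarith

lemma Jn_snoc (A : Coeffs d) (z zb ζ : Pt d) (y : Fin n → Pt d) :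
    Jn A (n+1) z zb (Fin.snoc y ζ) = Jn A n z ζ y * -Eker A ζ zb := by
  have h1 : ∀ i : Fin (n+2), pts z (Fin.snoc y ζ : Fin (n+1) → Pt d) zb i.castSucc = pts z y ζ i := by
    intro i
    refine Fin.cases ?_ (fun i => ?_) i
    · simp [pts]
    · unfold pts
      rw [← Fin.succ_castSucc, Fin.cons_succ, Fin.cons_succ, Fin.snoc_castSucc]
  have h2 : pts z (Fin.snoc y ζ : Fin (n+1) → Pt d) zb (Fin.last (n+2)) = zb := by
    rw [← Fin.succ_last]; simp [pts]
  have h3 : pts z y ζ (Fin.last (n+1)) = ζ := by rw [← Fin.succ_last]; simp [pts]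
  unfold Jn
  rw [Fin.prod_univ_castSucc, ← mul_assoc]
  congr 1
  · congr 1
    · refine Finset.prod_congr rfl fun j _ => ?_
      rw [show (j.castSucc.succ.castSucc : Fin (n+3)) = (j.succ.castSucc).castSucc from rfl,
        show (j.castSucc.succ.succ : Fin (n+3)) = (j.succ.succ).castSucc from rfl, h1, h1]
  · rw [show ((Fin.last n).succ.castSucc : Fin (n+3)) = (Fin.last (n+1)).castSucc from rfl, h1, h3,
      show ((Fin.last n).succ.succ : Fin (n+3)) = Fin.last (n+2) from rfl, h2]

lemma piFin_last_symm {β : Type*} [MeasurableSpace β] {m : ℕ} (s : β) (y : Fin m → β) :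
    (MeasurableEquiv.piFinSuccAbove (fun _ : Fin (m+1) => β) (Fin.last m)).symm (s, y) = Fin.snoc y s := by
  simp [MeasurableEquiv.piFinSuccAbove, MeasurableEquiv.symm, Fin.insertNthEquiv, Fin.insertNth_last']

lemma volterra_eq (A : Coeffs d) (hJ : ∀ n z zb, Integrable (Jn A n z zb) volume) (n : ℕ) (z zb : Pt d) :
    volterra A n z zb = ∫ y, Jn A n z zb y := by
  induction n generalizing zb with
  | zero =>
    rw [volume_pi, Measure.pi_of_empty, integral_dirac]
    simp only [Jn, volterra, Finset.univ_eq_empty, Finset.prod_empty, mul_one]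
    rfl
  | succ n ih =>
    have mp := (volume_preserving_piFinSuccAbove (fun _ : Fin (n+1) => Pt d) (Fin.last n)).symm
    rw [← mp.integral_comp (MeasurableEquiv.measurableEmbedding _), Measure.volume_eq_prod, integral_prod]
    · simp only [volterra, conv, ih]
      refine integral_congr_ae (ae_of_all _ fun ζ => ?_)
      simp only [piFin_last_symm, Jn_snoc, integral_mul_const]
    · exact (mp.integrable_comp_emb (MeasurableEquiv.measurableEmbedding _)).2 (hJ (n+1) z zb)

end volt

section bridge
variable {n : ℕ} {lam : ℝ} {ρ r : ℕ} [Nonempty (Adm d lam ρ)]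

lemma ftc_Hf {Ω : Type*} [MeasurableSpace Ω] (hr : 0 < r) {g : Adm d lam ρ → Pt d → ℝ} (hg : Cb (idx d lam ρ) r g)
    (hpd : ∀ i, Cb (idx d lam ρ) r (pdF i g)) (Y D : Pt d × Pt d → Ω → Pt d)
    (A : Adm d lam ρ) (p : Pt d × Pt d) (ω : Ω) :
    ∑ k, D p ω k * Hf 0 0 (pdF k g) Y D A p ω = g A (p.1 + (Y p ω + D p ω)) - g A (p.1 + Y p ω) := by
  have hdif : Differentiable ℝ (g A) := hg.diff hr A
  have hc : ∀ k, Continuous (pdF k g A) := fun k => (hpd k).base.cont A ()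
  set γ : ℝ → Pt d := fun θ => p.1 + (Y p ω + θ • D p ω) with hγ
  have hγc : Continuous γ := by fun_prop
  have hH : ∀ k, Hf 0 0 (pdF k g) Y D A p ω = ∫ θ in (0:ℝ)..1, pdF k g A (γ θ) := by
    intro k
    rw [← integral_unitInterval]
    unfold Hf
    refine integral_congr_ae (ae_of_all _ fun θ => ?_)
    simp [Tay, hγ]
  simp only [hH, ← intervalIntegral.integral_const_mul]
  have hitg : ∀ k ∈ Finset.univ, IntervalIntegrable (fun θ => D p ω k * pdF k g A (γ θ)) volume 0 1 :=
    fun k _ => (continuous_const.mul ((hc k).comp hγc)).intervalIntegrable _ _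
  rw [← intervalIntegral.integral_finset_sum hitg]
  have hder : ∀ θ : ℝ, HasDerivAt (fun θ => g A (γ θ)) (∑ k, D p ω k * pdF k g A (γ θ)) θ := by
    intro θ
    have h1 : HasDerivAt γ ((1:ℝ) • D p ω) θ :=
      (((hasDerivAt_id θ).smul_const (D p ω)).const_add (Y p ω)).const_add p.1
    have h2 := (hdif (γ θ)).hasFDerivAt.comp_hasDerivAt θ h1
    refine h2.congr_deriv ?_
    rw [one_smul]
    conv_lhs => rw [pi_eq_sum_single (D p ω)]
    rw [map_sum]
    refine Finset.sum_congr rfl fun k _ => ?_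
    rw [map_smul]; rfl
  rw [intervalIntegral.integral_eq_sub_of_hasDerivAt (fun θ _ => hder θ)]
  · simp [hγ]
  · exact (continuous_finset_sum _ fun k _ => continuous_const.mul ((hc k).comp hγc)).intervalIntegrable _ _

lemma pts_eq (zb uv : Pt d) (ω : Fin n → Pt d) (i : Fin (n+2)) :
    pts (zb + psi uv e0) (fun i => zb + psi uv (ω i)) zb i = zb + psi uv (pos e0 ω i) := by
  refine Fin.cases ?_ (fun i => ?_) i
  · simp [pts, pos]
  · refine Fin.lastCases ?_ (fun i => ?_) i <;> simp [pts, pos]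

lemma chn_U (j : Fin (n+1)) (p : Pt d × Pt d) (ω : Om d n) : (chn d n).U j p ω = p.2 0 * sg j ω.1 := rfl

lemma Δ_zero (j : Fin (n+1)) (p : Pt d × Pt d) (ω : Om d n) : (chn d n).Δ j p ω 0 = (chn d n).U j p ω ^ 2 := rfl
lemma Δ_succ (j : Fin (n+1)) (l : Fin d) (p : Pt d × Pt d) (ω : Om d n) :
    (chn d n).Δ j p ω l.succ = (chn d n).U j p ω * (chn d n).ξ j l p ω := rfl

lemma Wker_chn (hl : 0 < lam) (A : Adm d lam ρ) (w : Pt d) (j : Fin (n+1)) (p : Pt d × Pt d) (ω : Om d n) (hu : 0 < p.2 0) :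
    Wker A.1 w ((chn d n).Δ j p ω) = c0 d * ((chn d n).U j p ω ^ d)⁻¹ * Real.exp (-(chn d n).qat j A w p ω) := by
  have hU : 0 < (chn d n).U j p ω := mul_pos hu (sg_pos ω.2 j)
  rw [Wker_eq A.2 hl w _ (by rw [Δ_zero]; positivity)]
  simp only [Δ_zero, Δ_succ, Real.sqrt_sq hU.le, mul_div_cancel_left₀ _ hU.ne']
  rfl

lemma Zker_chn (hl : 0 < lam) (A : Adm d lam ρ) (j : Fin (n+1)) (p : Pt d × Pt d) (ω : Om d n) (hu : 0 < p.2 0) :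
    Zker A.1 (p.1 + (chn d n).Ya j p ω) (p.1 + (chn d n).Yb j p ω) =
      c0 d * ((chn d n).U j p ω ^ d)⁻¹ * Real.exp (-(chn d n).qat j A (p.1 + (chn d n).Yb j p ω) p ω) := by
  rw [← Wker_chn hl A _ j p ω hu, Zker]
  congr 1
  simp [Chain.Ya]

lemma Eker_chn (hl : 0 < lam) (hρ : 3 * r ≤ ρ) (hr : 2 < r) (A : Adm d lam ρ) (j : Fin (n+1)) (p : Pt d × Pt d) (ω : Om d n) (hu : 0 < p.2 0) :
    -Eker A.1 (p.1 + (chn d n).Ya j p ω) (p.1 + (chn d n).Yb j p ω) =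
      ((chn d n).U j p ω)⁻¹ * (chn d n).Bt j A p ω *
        Zker A.1 (p.1 + (chn d n).Ya j p ω) (p.1 + (chn d n).Yb j p ω) := by
  have hU : 0 < (chn d n).U j p ω := mul_pos hu (sg_pos ω.2 j)
  have hd : ∀ i, (p.1 + (chn d n).Ya j p ω) i - (p.1 + (chn d n).Yb j p ω) i = (chn d n).Δ j p ω i := by
    intro i; simp [Chain.Ya]
  rw [Eker_eq A.2 hl _ _ ((chn d n).U j p ω) (fun l => (chn d n).ξ j l p ω) hU (by rw [hd, Δ_zero])
    (fun l => by rw [hd, Δ_succ])]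
  congr 2
  unfold Chain.Bt
  congr 1
  congr 1
  refine Finset.sum_congr rfl fun i _ => Finset.sum_congr rfl fun l _ => ?_
  congr 1
  have h1 := ftc_Hf (r := r) (by omega) (JetGood_cmp (lam := lam) hρ hr (.inl (i,l))).j0.1
    (fun k => (JetGood_pdcmp hρ hr k (.inl (i,l))).j0.1) ((chn d n).Yb j) ((chn d n).Δ j) A p ω
  have h2 : ∀ k, (chn d n).Δ j p ω k = (chn d n).U j p ω * (chn d n).dl j k p ω := by
    intro k
    refine Fin.cases ?_ (fun k => ?_) k
    · simp [Δ_zero, Chain.dl, sq]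
    · simp [Δ_succ, Chain.dl]
  rw [div_eq_iff hU.ne']
  simp only [h2, mul_assoc, ← Finset.mul_sum] at h1
  rw [mul_comm]
  exact h1.symm

/-- the full integrand -/
noncomputable def gF (n : ℕ) (A : Adm d lam ρ) (p : Pt d × Pt d) (ω : Om d n) : ℝ :=
  (chn d n).σ 0 ω * ((∏ j : Fin n, (chn d n).Bt j.succ A p ω) * Real.exp (-(chn d n).QF A p ω))

lemma prod_U (p : Pt d × Pt d) (ω : Om d n) (c : ℝ) :
    ∏ j, (c * ((chn d n).U j p ω ^ (d+1))⁻¹) = c ^ (n+1) * ((p.2 0 ^ (d+1)) ^ (n+1))⁻¹ * dens ω.1 := by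
  simp only [chn_U, mul_pow, mul_inv, Finset.prod_mul_distrib, dens, Finset.prod_const, Finset.card_univ, Fintype.card_fin]
  rw [inv_pow]; ring

lemma Jn_chn (hl : 0 < lam) (hρ : 3 * r ≤ ρ) (hr : 2 < r) (A : Adm d lam ρ) (p : Pt d × Pt d) (ω : Om d n) (hu : 0 < p.2 0) :
    Jn A.1 n (p.1 + psi p.2 e0) p.1 (fun i => p.1 + psi p.2 (ω.1 i)) =
      (c0 d ^ (n+1) * ((p.2 0 ^ (d+1)) ^ (n+1))⁻¹ * p.2 0) * dens ω.1 * gF n A p ω := by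
  unfold Jn
  simp only [pts_eq]
  have e0' : psi p.2 (pos e0 ω.1 0) = (chn d n).Ya 0 p ω := by rw [chn_Ya]; rfl
  have e1' : psi p.2 (pos e0 ω.1 1) = (chn d n).Yb 0 p ω := by rw [chn_Yb]; rfl
  rw [e0', e1']
  simp only [← chn_Ya, ← chn_Yb, Eker_chn hl hρ hr A _ p ω hu, Zker_chn hl A _ p ω hu]
  have hUp : ∀ j, 0 < (chn d n).U j p ω := fun j => mul_pos hu (sg_pos ω.2 j)
  have key : ∀ j : Fin (n+1), ((chn d n).U j p ω)⁻¹ * (c0 d * ((chn d n).U j p ω ^ d)⁻¹) = c0 d * ((chn d n).U j p ω ^ (d+1))⁻¹ := by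
    intro j
    rw [pow_succ, mul_inv]; ring
  have h0 : c0 d * ((chn d n).U 0 p ω ^ d)⁻¹ = (chn d n).U 0 p ω * (c0 d * ((chn d n).U 0 p ω ^ (d+1))⁻¹) := by
    rw [← key, ← mul_assoc, mul_inv_cancel₀ (hUp 0).ne', one_mul]
  have hQ : Real.exp (-(chn d n).QF A p ω) = ∏ j, Real.exp (-(chn d n).qat j A (p.1 + (chn d n).Yb j p ω) p ω) := by
    rw [Chain.QF, ← Finset.sum_neg_distrib, Real.exp_sum]
  have hP := prod_U p ω (c0 d)
  rw [Fin.prod_univ_succ] at hP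
  unfold gF
  rw [hQ, Fin.prod_univ_succ]
  have e3 : ∀ j : Fin n, ((chn d n).U j.succ p ω)⁻¹ * (chn d n).Bt j.succ A p ω *
      (c0 d * ((chn d n).U j.succ p ω ^ d)⁻¹ * Real.exp (-(chn d n).qat j.succ A (p.1 + (chn d n).Yb j.succ p ω) p ω)) =
      (c0 d * ((chn d n).U j.succ p ω ^ (d+1))⁻¹) * ((chn d n).Bt j.succ A p ω * Real.exp (-(chn d n).qat j.succ A (p.1 + (chn d n).Yb j.succ p ω) p ω)) := by
    intro j
    rw [← key]; ring
  simp only [e3]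
  have e4 : ∏ j : Fin n, ((chn d n).Bt j.succ A p ω * Real.exp (-(chn d n).qat j.succ A (p.1 + (chn d n).Yb j.succ p ω) p ω)) =
      (∏ j : Fin n, (chn d n).Bt j.succ A p ω) * ∏ j : Fin n, Real.exp (-(chn d n).qat j.succ A (p.1 + (chn d n).Yb j.succ p ω) p ω) :=
    Finset.prod_mul_distrib
  rw [Finset.prod_mul_distrib, e4, h0]
  have hU0 : (chn d n).U 0 p ω = p.2 0 * (chn d n).σ 0 ω := rfl
  rw [hU0] at hP ⊢
  linear_combination (p.2 0 * (chn d n).σ 0 ω * Real.exp (-(chn d n).qat 0 A (p.1 + (chn d n).Yb 0 p ω) p ω) *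
    (∏ j : Fin n, (chn d n).Bt j.succ A p ω) * ∏ j : Fin n, Real.exp (-(chn d n).qat j.succ A (p.1 + (chn d n).Yb j.succ p ω) p ω)) * hP

lemma chn_notMem {p : Pt d × Pt d} (hu : 0 < p.2 0) {ω : Fin n → Pt d} (h : ω ∉ Sset d n) :
    ∃ j, psi p.2 (chainDiff e0 ω j) 0 ≤ 0 := by
  have : ¬ ∀ j, 0 < chainDiff (e0 : Pt d) ω j 0 := h
  push Not at this
  obtain ⟨j, hj⟩ := this
  refine ⟨j, ?_⟩
  rw [psi_zero]
  exact mul_nonpos_of_nonneg_of_nonpos (by positivity) hj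

lemma Jn_chn_zero (A : Coeffs d) (p : Pt d × Pt d) (ω : Fin n → Pt d) (hu : 0 < p.2 0) (h : ω ∉ Sset d n) :
    Jn A n (p.1 + psi p.2 e0) p.1 (fun i => p.1 + psi p.2 (ω i)) = 0 := by
  obtain ⟨j, hj⟩ := chn_notMem hu h
  refine Jn_zero A _ _ _ j ?_
  simp only [pts_eq]
  have : psi p.2 (chainDiff e0 ω j) = psi p.2 (pos e0 ω j.castSucc) - psi p.2 (pos e0 ω j.succ) := by
    rw [← map_sub]; rfl
  rw [this] at hj
  simp only [Pi.add_apply, Pi.sub_apply] at hj ⊢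
  linarith

lemma pow_count {u : ℝ} (hu : 0 < u) (c : ℝ) : (u ^ (d+2)) ^ n * (c * ((u ^ (d+1)) ^ (n+1))⁻¹ * u) = c * u ^ n * (u ^ d)⁻¹ := by
  have h1 : u ^ d ≠ 0 := by positivity
  have h2 : (u ^ (d+1)) ^ (n+1) ≠ 0 := by positivity
  field_simp
  ring

end bridge

/-! ## Part 7: the rescaled Volterra term -/

/-- integrating out the configuration -/
noncomputable def fibS (d n : ℕ) {ε : ℝ} (hε : 0 < ε) : Fib (Wv d Unit) (chn d n).W ε (mu d n) where
  j := fun _ θ => θ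
  γ := (chn d n).κ
  j_meas := measurable_snd
  γ_nonneg := (chn d n).κ_nonneg
  hG := fun p ω θ => by
    have h1 := (chn d n).κ_nonneg θ
    have h2 := norm_nonneg p.2
    simp only [Chain.W, Wv]
    nlinarith
  hH := fun p ω θ => le_rfl
  hitg := fun k => chn_int hε k
  eps_nonneg := hε.le

/-- the coordinates `(u, v)` -/
noncomputable def uvc (ζ : Pt d) : Pt d :=
  Fin.cons (Real.sqrt (ζ 0)) fun i : Fin d => ζ i.succ / Real.sqrt (ζ 0)

lemma uvc_zero (ζ : Pt d) : uvc ζ 0 = Real.sqrt (ζ 0) := rfl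

lemma uvc_pos {ζ : Pt d} (h : 0 < ζ 0) : 0 < uvc ζ 0 := Real.sqrt_pos.2 h

lemma psi_uvc {ζ : Pt d} (h : 0 < ζ 0) : psi (uvc ζ) e0 = ζ := by
  have h1 := (Real.sqrt_pos.2 h).ne'
  funext i
  refine Fin.cases ?_ (fun l => ?_) i
  · simp [psi_zero, e0, uvc, Real.sq_sqrt h.le]
  · simp [psi_succ, e0, uvc, mul_div_cancel₀ _ h1]

section volt
variable {n : ℕ} {lam : ℝ} {ρ r : ℕ} [Nonempty (Adm d lam ρ)]
variable (hl : 0 < lam) (hρ : 3 * r ≤ ρ) (hr : 2 < r)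
include hl hρ hr

lemma good_gF : Good (idx d lam ρ) (chn d n).W (lam/4) r (gF n) := by
  obtain ⟨P, fR, -, -, h, -⟩ := exists_decomp hl hρ hr (C := chn d n)
  exact ((chn d n).good_σ 0).mul0 h

lemma Jn_int (A : Adm d lam ρ) (z zb : Pt d) (h : zb 0 < z 0) :
    Integrable (Jn A.1 n z zb) volume ∧ ∫ y, Jn A.1 n z zb y =
      (uvc (z - zb) 0 ^ d)⁻¹ * (c0 d ^ (n+1) * uvc (z - zb) 0 ^ n * ∫ ω, gF n A (zb, uvc (z - zb)) ω ∂(mu d n)) := by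
  have hz : 0 < (z - zb) 0 := by simpa using h
  set uv := uvc (z - zb) with huv
  have hu : 0 < uv 0 := uvc_pos hz
  have hzz : z = zb + psi uv e0 := by rw [huv, psi_uvc hz]; simp
  have hg : Integrable (gF n A (zb, uv)) (mu d n) :=
    (fibS d n (ε := lam/4) (by positivity)).integrable (good_gF hl hρ hr).base A (zb, uv) ()
  obtain ⟨h1, h2⟩ := cov hu (fun y => Jn A.1 n (zb + psi uv e0) zb (fun i => zb + y i))
    (c0 d ^ (n+1) * ((uv 0 ^ (d+1)) ^ (n+1))⁻¹ * uv 0) (gF n A (zb, uv))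
    (fun ω => Jn_chn hl hρ hr A (zb, uv) ω hu) (fun ω hω => Jn_chn_zero A.1 (zb, uv) ω hu hω) hg
  rw [← hzz] at h1 h2
  have e : ∀ y : Fin n → Pt d, (fun i => zb + y i) = (fun _ => zb) + y := fun y => rfl
  simp only [e] at h1 h2
  constructor
  · have := h1.comp_add_left (-(fun _ : Fin n => zb))
    simpa using this
  · rw [integral_add_left_eq_self (fun y => Jn A.1 n z zb y)] at h2
    rw [h2, pow_count hu]
    ring

lemma Jn_integrable (A : Adm d lam ρ) (n : ℕ) (z zb : Pt d) : Integrable (Jn A.1 n z zb) volume := by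
  rcases lt_or_ge (zb 0) (z 0) with h | h
  · exact (Jn_int hl hρ hr A z zb h).1
  · have : Jn A.1 n z zb = fun _ => 0 := funext fun y => Jn_zero' A.1 z zb h y
    rw [this]; exact integrable_zero _ _ _

lemma volterra_pos (A : Adm d lam ρ) (z zb : Pt d) (h : zb 0 < z 0) :
    volterra A.1 n z zb =
      (uvc (z - zb) 0 ^ d)⁻¹ * (c0 d ^ (n+1) * uvc (z - zb) 0 ^ n * ∫ ω, gF n A (zb, uvc (z - zb)) ω ∂(mu d n)) := by
  rw [volterra_eq A.1 (Jn_integrable hl hρ hr A), (Jn_int hl hρ hr A z zb h).2]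

lemma volterra_neg (A : Adm d lam ρ) (z zb : Pt d) (h : z 0 ≤ zb 0) : volterra A.1 n z zb = 0 := by
  rw [volterra_eq A.1 (Jn_integrable hl hρ hr A)]
  simp [Jn_zero' A.1 z zb h]

end volt

section ktrep
variable {n : ℕ} {Ω : Type*} [MeasurableSpace Ω] {C : Chain d n Ω} {lam : ℝ} {ρ r : ℕ}

lemma KT_repr [Nonempty (Adm d lam ρ)] {P : Adm d lam ρ → Pt d × Pt d → Ω → ℝ} (h : P ∈ KT C lam ρ r) :
    ∃ (ι : Type) (_ : Fintype ι) (g : ι → Adm d lam ρ → Pt d → ℝ)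
      (Q : ι → Fin (n+1) → MvPolynomial (Fin (d+1)) ℝ), (∀ m, J0 r (g m)) ∧
      ∀ A p ω, P A p ω = ∑ m, g m A p.1 * ∏ j, MvPolynomial.eval (fun k => C.dl j k p ω) (Q m j) := by
  induction h using Algebra.adjoin_induction with
  | mem x hx =>
    rcases hx with ⟨g, hg, rfl⟩ | ⟨j, rfl⟩ | ⟨j, l, rfl⟩
    · exact ⟨Unit, inferInstance, fun _ => g, fun _ _ => 1, fun _ => hg, by simp⟩
    · refine ⟨Unit, inferInstance, fun _ _ _ => 1, fun _ => Pi.mulSingle j (MvPolynomial.X 0), fun _ => J0.const 1, fun A p ω => ?_⟩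
      simp only [one_mul, Finset.univ_unique, Finset.sum_singleton]
      rw [Finset.prod_eq_single j (fun i _ hi => by simp [hi]) (by simp)]
      simp [Chain.dl]
    · refine ⟨Unit, inferInstance, fun _ _ _ => 1, fun _ => Pi.mulSingle j (MvPolynomial.X l.succ), fun _ => J0.const 1, fun A p ω => ?_⟩
      simp only [one_mul, Finset.univ_unique, Finset.sum_singleton]
      rw [Finset.prod_eq_single j (fun i _ hi => by simp [hi]) (by simp)]
      simp [Chain.dl]
  | algebraMap c =>
    exact ⟨Unit, inferInstance, fun _ _ _ => c, fun _ _ => 1, fun _ => J0.const c, by simp⟩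
  | add x y _ _ hx hy =>
    obtain ⟨ι, _, g, Q, hg, h⟩ := hx
    obtain ⟨ι', _, g', Q', hg', h'⟩ := hy
    refine ⟨ι ⊕ ι', inferInstance, Sum.elim g g', Sum.elim Q Q', fun m => ?_, fun A p ω => ?_⟩
    · cases m
      · exact hg _
      · exact hg' _
    · simp only [Pi.add_apply, h, h', Fintype.sum_sum_type, Sum.elim_inl, Sum.elim_inr]
  | mul x y _ _ hx hy =>
    obtain ⟨ι, _, g, Q, hg, h⟩ := hx
    obtain ⟨ι', _, g', Q', hg', h'⟩ := hy
    refine ⟨ι × ι', inferInstance, fun m A w => g m.1 A w * g' m.2 A w, fun m j => Q m.1 j * Q' m.2 j, fun m => (hg _).mul (hg' _), fun A p ω => ?_⟩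
    simp only [Pi.mul_apply, h, h', Finset.sum_mul_sum, Fintype.sum_prod_type, map_mul, Finset.prod_mul_distrib]
    refine Finset.sum_congr rfl fun m _ => Finset.sum_congr rfl fun m' _ => ?_
    ring

lemma JetAlg_poly {g : Adm d lam ρ → Pt d → ℝ} (h : g ∈ JetAlg d lam ρ r) :
    ∃ p : MvPolynomial ((Fin (d + 1) → ℕ) × CoeffVar d) ℝ,
      (∀ mo ∈ p.support, ∀ v ∈ mo.support, pdeg v.1 ≤ r) ∧
      ∀ A w, g A w = MvPolynomial.eval (coeffEval A.1 w) p := by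
  suffices ∃ p ∈ MvPolynomial.supported ℝ {v : (Fin (d + 1) → ℕ) × CoeffVar d | pdeg v.1 ≤ r},
      ∀ A w, g A w = MvPolynomial.eval (coeffEval A.1 w) p by
    obtain ⟨p, hp, h⟩ := this
    refine ⟨p, fun mo hmo v hv => ?_, h⟩
    exact MvPolynomial.mem_supported.1 hp (Finset.mem_coe.2 ((MvPolynomial.mem_vars_iff_mem_support v).2 ⟨mo, hmo, hv⟩))
  induction h using Algebra.adjoin_induction with
  | mem x hx =>
    obtain ⟨v, hv, rfl⟩ := hx
    exact ⟨MvPolynomial.X v, (MvPolynomial.X_mem_supported (R := ℝ)).2 hv, by simp⟩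
  | algebraMap c => exact ⟨MvPolynomial.C c, Subalgebra.algebraMap_mem _ c, by simp⟩
  | add x y _ _ hx hy =>
    obtain ⟨p, hp, h⟩ := hx
    obtain ⟨q, hq, h'⟩ := hy
    exact ⟨p + q, add_mem hp hq, by simp [h, h']⟩
  | mul x y _ _ hx hy =>
    obtain ⟨p, hp, h⟩ := hx
    obtain ⟨q, hq, h'⟩ := hy
    exact ⟨p * q, mul_mem hp hq, by simp [h, h']⟩

end ktrep

/-! ## Part 8: regularity of the leading kernels in the parameter `w` -/

section freeze
variable {𝒜 : Type*} {I : Idx 𝒜} {ε : ℝ} {r : ℕ}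

/-- the first argument becomes a parameter -/
def fz (f : 𝒜 → Pt d × Pt d → ℝ) : 𝒜 → Pt d × Pt d → Pt d → ℝ := fun A p w => f A (w, p.2)

lemma Good.freeze {f : 𝒜 → Pt d × Pt d → ℝ} (hf : Good I (Wv d Unit) ε r (fun A p _ => f A p)) :
    Good I (Wv d (Pt d)) ε r (fz f) := by
  have hbase : ∀ f : 𝒜 → Pt d × Pt d → ℝ, Base I (Wv d Unit) ε (fun A p _ => f A p) → Base I (Wv d (Pt d)) ε (fz f) := by
    intro f hf
    refine ⟨fun M => ?_, fun A w => ?_, fun A p => ?_⟩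
    · obtain ⟨C, k, hC, hb⟩ := hf.bdd M
      exact ⟨C, k, hC, fun A B hA hB p w => hb A B hA hB (w, p.2) ()⟩
    · exact (hf.cont A ()).comp (by fun_prop : Continuous fun p : Pt d × Pt d => (w, p.2))
    · exact ((hf.cont A ()).comp (by fun_prop : Continuous fun w : Pt d => (w, p.2))).measurable
  induction r generalizing f with
  | zero => exact hbase f hf
  | succ r ih =>
    have hL : ∀ w : Pt d, ∀ p : Pt d × Pt d, HasFDerivAt (fun q : Pt d × Pt d => (w, q.2))
        ((ContinuousLinearMap.inr ℝ (Pt d) (Pt d)).comp (ContinuousLinearMap.snd ℝ (Pt d) (Pt d))) p := by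
      intro w p
      exact (hasFDerivAt_prodMk_right w p.2).comp p hasFDerivAt_snd
    have hD : ∀ A w p, HasFDerivAt (fun q => fz f A q w) _ p := fun A w p =>
      ((hf.2.1 A ()) (w, p.2)).hasFDerivAt.comp p (hL w p)
    refine ⟨hbase f hf.1, fun A w p => (hD A w p).differentiableAt, fun e => ?_⟩
    have : dirD e (fz f) = fz (fun A p => fderiv ℝ (f A) p (0, e.2)) := by
      funext A p w
      unfold dirD
      rw [(hD A w p).fderiv]
      rfl
    rw [this]
    exact ih (hf.2.2 (0, e.2))

/-- derivative in the parameter -/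
noncomputable def wd (i : Fin (d+1)) (f : 𝒜 → Pt d × Pt d → Pt d → ℝ) : 𝒜 → Pt d × Pt d → Pt d → ℝ :=
  fun A p => pd i (f A p)

noncomputable def fw (m : Fin (d+1) → ℕ) (f : 𝒜 → Pt d × Pt d → Pt d → ℝ) : 𝒜 → Pt d × Pt d → Pt d → ℝ :=
  (List.finRange (d + 1)).foldr (fun i g => (wd i)^[m i] g) f

lemma fw_eq (m : Fin (d+1) → ℕ) (f : 𝒜 → Pt d × Pt d → Pt d → ℝ) (A : 𝒜) (p : Pt d × Pt d) :
    mderiv m (f A p) = fw m f A p :=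
  (foldr_iter_semiconj (fun f : 𝒜 → Pt d × Pt d → Pt d → ℝ => f A p) wd pd (fun _ _ => rfl) m _ f).symm

variable (I ε r) in
/-- families with `h` derivatives in the parameter -/
def G2 : ℕ → (𝒜 → Pt d × Pt d → Pt d → ℝ) → Prop
  | 0, f => Good I (Wv d (Pt d)) ε r f
  | h + 1, f => Good I (Wv d (Pt d)) ε r f ∧ (∀ A p, Differentiable ℝ (f A p)) ∧ ∀ i, G2 h (wd i f)

variable {h : ℕ} {f g : 𝒜 → Pt d × Pt d → Pt d → ℝ}

lemma G2.good (hf : G2 I ε r h f) : Good I (Wv d (Pt d)) ε r f := by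
  cases h with
  | zero => exact hf
  | succ h => exact hf.1

lemma G2.of_succ (hf : G2 I ε r (h+1) f) : G2 I ε r h f := by
  induction h generalizing f with
  | zero => exact hf.1
  | succ h ih => exact ⟨hf.1, hf.2.1, fun i => ih (hf.2.2 i)⟩

lemma G2.of_le {h' : ℕ} (hf : G2 I ε r h f) (hh : h' ≤ h) : G2 I ε r h' f := by
  induction h with
  | zero => obtain rfl : h' = 0 := by omega
            exact hf
  | succ h ih =>
    rcases Nat.lt_or_ge h h' with h1 | h1
    · obtain rfl : h' = h + 1 := by omega
      exact hf
    · exact ih hf.of_succ h1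

lemma pd_add {f g : Pt d → ℝ} (hf : Differentiable ℝ f) (hg : Differentiable ℝ g) (i : Fin (d+1)) (w : Pt d) :
    pd i (fun w => f w + g w) w = pd i f w + pd i g w := by
  unfold pd
  have : fderiv ℝ (fun w => f w + g w) w = _ := ((hf w).hasFDerivAt.fun_add (hg w).hasFDerivAt).fderiv
  rw [this]; rfl

lemma pd_sub {f g : Pt d → ℝ} (hf : Differentiable ℝ f) (hg : Differentiable ℝ g) (i : Fin (d+1)) (w : Pt d) :
    pd i (fun w => f w - g w) w = pd i f w - pd i g w := by
  unfold pd
  have : fderiv ℝ (fun w => f w - g w) w = _ := ((hf w).hasFDerivAt.fun_sub (hg w).hasFDerivAt).fderiv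
  rw [this]; rfl

lemma G2.add (hf : G2 I ε r h f) (hg : G2 I ε r h g) : G2 I ε r h (fun A p w => f A p w + g A p w) := by
  induction h generalizing f g with
  | zero => exact Good.add hf hg
  | succ h ih =>
    refine ⟨hf.1.add hg.1, fun A p => (hf.2.1 A p).add (hg.2.1 A p), fun i => ?_⟩
    have : wd i (fun A p w => f A p w + g A p w) = fun A p w => wd i f A p w + wd i g A p w := by
      funext A p w
      exact pd_add (hf.2.1 A p) (hg.2.1 A p) i w
    rw [this]
    exact ih (hf.2.2 i) (hg.2.2 i)

lemma G2.zero : G2 I ε r h (fun (_ : 𝒜) (_ : Pt d × Pt d) _ => (0:ℝ)) := by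
  induction h with
  | zero => exact Good.zero
  | succ h ih =>
    refine ⟨Good.zero, fun A p => differentiable_const _, fun i => ?_⟩
    convert ih using 1
    funext A p w
    simp [wd, pd]

lemma G2.sum {ι : Type*} (s : Finset ι) {F : ι → 𝒜 → Pt d × Pt d → Pt d → ℝ}
    (hF : ∀ i ∈ s, G2 I ε r h (F i)) : G2 I ε r h (fun A p w => ∑ i ∈ s, F i A p w) := by
  classical
  induction s using Finset.induction_on with
  | empty => simpa using G2.zero
  | insert a s ha ih =>
    simp only [Finset.sum_insert ha]
    exact (hF a (by simp)).add (ih fun i hi => hF i (by simp [hi]))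

lemma G2.fw (hf : G2 I ε r h f) (m : Fin (d+1) → ℕ) (s : ℕ) (hs : s + ∑ i, m i ≤ h) : G2 I ε r s (fw m f) := by
  refine foldr_iter_pred (G2 I ε r) VarBPHZ.wd (fun i n x hx => hx.2.2 i) m _ s _ ?_
  rw [sum_finRange_map]
  exact hf.of_le hs

lemma G2.fw_sub (hf : G2 I ε r h f) (m : Fin (d+1) → ℕ) (hs : ∑ i, m i ≤ h) (A B : 𝒜) (p : Pt d × Pt d) (w : Pt d) :
    mderiv m (fun w => f A p w - f B p w) w = VarBPHZ.fw m f A p w - VarBPHZ.fw m f B p w := by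
  let D : (𝒜 → Pt d × Pt d → Pt d → ℝ) → (𝒜 × 𝒜 → Pt d × Pt d → Pt d → ℝ) :=
    fun f A p w => f A.1 p w - f A.2 p w
  let op : Fin (d+1) → (𝒜 → Pt d × Pt d → Pt d → ℝ) × (𝒜 × 𝒜 → Pt d × Pt d → Pt d → ℝ) →
     (𝒜 → Pt d × Pt d → Pt d → ℝ) × (𝒜 × 𝒜 → Pt d × Pt d → Pt d → ℝ) := fun i x => (wd i x.1, wd i x.2)
  have h1 := foldr_iter_pred (fun n x => G2 I ε r n x.1 ∧ x.2 = D x.1) op (fun i n x hx => ⟨hx.1.2.2 i, by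
      have h2 := hx.2
      change wd i x.2 = D (wd i x.1)
      rw [h2]
      funext A p w
      exact pd_sub (hx.1.2.1 A.1 p) (hx.1.2.1 A.2 p) i w⟩) m (List.finRange (d+1)) 0 (f, D f)
    ⟨by rw [sum_finRange_map]; exact hf.of_le (by omega), rfl⟩
  have e1 := foldr_iter_semiconj Prod.fst op wd (fun _ _ => rfl) m (List.finRange (d+1)) (f, D f)
  have e2 := foldr_iter_semiconj Prod.snd op wd (fun _ _ => rfl) m (List.finRange (d+1)) (f, D f)
  have h2 := h1.2
  rw [e1, e2] at h2
  have h3 := congrFun (fw_eq m (D f) (A, B) p) w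
  change mderiv m (D f (A, B) p) w = _
  rw [h3]
  exact congrFun (congrFun (congrFun h2 (A, B)) p) w

lemma G2.psiBound {X : 𝒜 → Pt d × Pt d → Pt d → ℝ} (hX : G2 I ε r r X) (hε : 0 < ε) (M T : ℝ) (nn : ℕ) :
    ∃ C : ℝ, 0 ≤ C ∧ ∀ m, pdeg m ≤ r → ∀ A B, I.N A ≤ M → I.N B ≤ M → ∀ w,
      (∀ y ∈ psiSet r T nn (fun x uv => VarBPHZ.fw m X A (x, uv) w), y ≤ C) ∧
      (∀ y ∈ psiSet r T nn (fun x uv => VarBPHZ.fw m X A (x, uv) w - VarBPHZ.fw m X B (x, uv) w), y ≤ C * I.δ A B) := by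
  have h1 : ∀ m : Fin (d+1) → Fin (r+1), ∃ C : ℝ, 0 ≤ C ∧ (∑ i, (m i : ℕ) ≤ r → ∀ A B, I.N A ≤ M → I.N B ≤ M → ∀ w,
      (∀ y ∈ psiSet r T nn (fun x uv => VarBPHZ.fw (fun i => (m i : ℕ)) X A (x, uv) w), y ≤ C) ∧
      (∀ y ∈ psiSet r T nn (fun x uv => VarBPHZ.fw (fun i => (m i : ℕ)) X A (x, uv) w - VarBPHZ.fw (fun i => (m i : ℕ)) X B (x, uv) w), y ≤ C * I.δ A B)) := by
    intro m
    by_cases hm : ∑ i, (m i : ℕ) ≤ r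
    · obtain ⟨C, hC, hb⟩ := ((hX.fw (fun i => (m i : ℕ)) 0 (by omega)).good).psiBound hε M T nn
      exact ⟨C, hC, fun _ => hb⟩
    · exact ⟨0, le_rfl, fun h => absurd h hm⟩
  choose C hC hb using h1
  refine ⟨∑ m, C m, Finset.sum_nonneg fun m _ => hC m, fun m hm A B hA hB w => ?_⟩
  have hs := (sum_le_pdeg m).trans hm
  have hmi : ∀ i, m i < r + 1 := fun i => by
    have := Finset.single_le_sum (f := m) (fun _ _ => Nat.zero_le _) (Finset.mem_univ i)
    omega
  have hle : C (fun i => ⟨m i, hmi i⟩) ≤ ∑ m, C m :=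
    Finset.single_le_sum (f := C) (fun m _ => hC m) (Finset.mem_univ _)
  have := hb (fun i => ⟨m i, hmi i⟩) hs A B hA hB w
  refine ⟨fun y hy => (this.1 y hy).trans hle, fun y hy => (this.2 y hy).trans ?_⟩
  exact mul_le_mul_of_nonneg_right hle (I.δ_nonneg A B)

end freeze

section kap
variable {n : ℕ} {lam : ℝ} {ρ r : ℕ}

/-- admissible polynomial factors -/
def QOK (lam : ℝ) (ρ : ℕ) (q : Pt d → Om d n → ℝ) : Prop :=
  ∀ s, Good (idx d lam ρ) (chn d n).W 0 s (fun _ p ω => q p.2 ω)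

noncomputable def kint (q : Pt d → Om d n → ℝ) (A : Adm d lam ρ) (p : Pt d × Pt d) (ω : Om d n) : ℝ :=
  q p.2 ω * Real.exp (-(chn d n).QW A p ω)

noncomputable def kap (q : Pt d → Om d n → ℝ) (A : Adm d lam ρ) (p : Pt d × Pt d) : ℝ :=
  ∫ ω, kint q A p ω ∂(mu d n)

/-- multiplication by `ξ ξ` -/
noncomputable def qxx (j : Fin (n+1)) (l l' : Fin d) (q : Pt d → Om d n → ℝ) : Pt d → Om d n → ℝ :=
  fun uv ω => q uv ω * ((chn d n).ξ j l (0, uv) ω * (chn d n).ξ j l' (0, uv) ω)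

lemma QOK.qxx {q : Pt d → Om d n → ℝ} (hq : QOK lam ρ q) (j : Fin (n+1)) (l l' : Fin d) : QOK lam ρ (qxx j l l' q) :=
  fun s => (hq s).mul0 (((chn d n).good_ξ j l).mul0 ((chn d n).good_ξ j l'))

variable [Nonempty (Adm d lam ρ)] (hl : 0 < lam) (hρ : 3 * r ≤ ρ) (hr : 2 < r)
include hl hρ hr

lemma good_kint {q : Pt d → Om d n → ℝ} (hq : QOK lam ρ q) :
    Good (idx d lam ρ) (chn d n).W (lam/4) r (kint q) := by
  obtain ⟨c, hc⟩ := exists_qat_lower hl d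
  exact (hq r).mul0 ((good_QW hl hρ hr).exp (ε := lam/4) fun M => ⟨(n+1) * c, fun A _ p ω =>
    hc ρ n (Om d n) (chn d n) A (fun j => p.1) p ω⟩)

lemma good_kap {q : Pt d → Om d n → ℝ} (hq : QOK lam ρ q) :
    Good (idx d lam ρ) (Wv d Unit) (lam/4) r (fun A p _ => kap q A p) :=
  (fibS d n (ε := lam/4) (by positivity)).good (good_kint hl hρ hr hq)

lemma kint_integrable {q : Pt d → Om d n → ℝ} (hq : QOK lam ρ q) (A : Adm d lam ρ) (p : Pt d × Pt d) :
    Integrable (kint q A p) (mu d n) :=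
  (fibS d n (ε := lam/4) (by positivity)).integrable (good_kint hl hρ hr hq).base A p ()

lemma pd_kint (q : Pt d → Om d n → ℝ) (i : Fin (d+1)) (A : Adm d lam ρ) (w uv : Pt d) (ω : Om d n) :
    pd i (fun w => kint q A (w, uv) ω) w =
      (-1/2 * (n+1) * pdF i LD A w) * kint q A (w, uv) ω +
        ∑ j, ∑ l, ∑ l', (-1/4 * pdF i (AI l l') A w) * kint (qxx j l l' q) A (w, uv) ω := by
  have hLD := ((Cb_LD (ρ := ρ) hl hρ hr).diff (by omega) A w).hasFDerivAt
  have hAI : ∀ l l', HasFDerivAt (AI l l' A) _ w := fun l l' =>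
    ((JetGood_AI (ρ := ρ) hl hρ hr l l').j0.1.diff (by omega) A w).hasFDerivAt
  have hq : ∀ j, HasFDerivAt (fun w => (chn d n).qat j A w (w, uv) ω) _ w := fun j =>
    (hLD.const_mul (1/2)).add ((HasFDerivAt.fun_sum (u := Finset.univ) fun l _ => HasFDerivAt.fun_sum (u := Finset.univ) fun l' _ =>
      (hAI l l').mul_const ((chn d n).ξ j l (w, uv) ω * (chn d n).ξ j l' (w, uv) ω)).const_mul (1/4))
  have hQ : HasFDerivAt (fun w => (chn d n).QW A (w, uv) ω) _ w :=
    HasFDerivAt.fun_sum (u := Finset.univ) fun j _ => hq j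
  have hE := (hQ.fun_neg.exp).const_mul (q uv ω)
  unfold pd
  have : fderiv ℝ (fun w => kint q A (w, uv) ω) w = _ := hE.fderiv
  rw [this]
  simp only [ContinuousLinearMap.smul_apply, ContinuousLinearMap.neg_apply, ContinuousLinearMap.sum_apply,
    ContinuousLinearMap.add_apply, smul_eq_mul, Finset.sum_add_distrib, Finset.sum_const, Finset.card_univ, Fintype.card_fin,
    nsmul_eq_mul]
  have e1 : ∀ l l', fderiv ℝ (AI l l' A) w (Pi.single i 1) = pdF i (AI l l') A w := fun _ _ => rfl
  have e2 : fderiv ℝ (LD A) w (Pi.single i 1) = pdF i LD A w := rfl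
  have e3 : ∀ j l, (chn d n).ξ j l (0, uv) ω = (chn d n).ξ j l (w, uv) ω := fun _ _ => rfl
  simp only [e1, e2, kint, qxx, e3]
  rw [neg_add, mul_add, mul_add]
  congr 1
  · push_cast; ring
  · simp only [← Finset.mul_sum, ← Finset.sum_neg_distrib]
    simp only [Finset.mul_sum, ← Finset.sum_neg_distrib]
    refine Finset.sum_congr rfl fun j _ => Finset.sum_congr rfl fun l _ => Finset.sum_congr rfl fun l' _ => ?_
    ring

lemma pd_kap {q : Pt d → Om d n → ℝ} (hq : QOK lam ρ q) (A : Adm d lam ρ) (uv : Pt d) :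
    Differentiable ℝ (fun w => kap q A (w, uv)) ∧ ∀ i w, pd i (fun w => kap q A (w, uv)) w =
      (-1/2 * (n+1) * pdF i LD A w) * kap q A (w, uv) +
        ∑ j, ∑ l, ∑ l', (-1/4 * pdF i (AI l l') A w) * kap (qxx j l l' q) A (w, uv) := by
  obtain ⟨s, rfl⟩ : ∃ s, r = s + 1 := ⟨r-1, by omega⟩
  have hk := good_kint hl hρ hr hq
  have hK := good_kap hl hρ hr hq
  have hd : Differentiable ℝ (kap q A) := hK.2.1 A ()
  refine ⟨hd.comp (by fun_prop : Differentiable ℝ fun w : Pt d => (w, uv)), fun i w => ?_⟩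
  have h1 := pd_fst hd i (w, uv)
  have h2 := congrFun (congrFun (congrFun ((fibS d n (ε := lam/4) (by positivity)).dirD_int hk (Pi.single i 1, 0)) A) (w, uv)) ()
  rw [h1]
  refine Eq.trans h2 ?_
  have h3 : ∀ ω, dirD (Pi.single i 1, 0) (kint q) A (w, uv) ω =
      (-1/2 * (n+1) * pdF i LD A w) * kint q A (w, uv) ω +
        ∑ j, ∑ l, ∑ l', (-1/4 * pdF i (AI l l') A w) * kint (qxx j l l' q) A (w, uv) ω := by
    intro ω
    rw [← pd_kint hl hρ hr q i A w uv ω]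
    exact (pd_fst (hk.2.1 A ω) i (w, uv)).symm
  change ∫ ω, dirD (Pi.single i 1, 0) (kint q) A (w, uv) ω ∂(mu d n) = _
  simp only [h3]
  have hi : ∀ j l l', Integrable (fun ω => (-1/4 * pdF i (AI l l') A w) * kint (qxx j l l' q) A (w, uv) ω) (mu d n) :=
    fun j l l' => (kint_integrable hl hρ hr (hq.qxx j l l') A (w, uv)).const_mul _
  rw [integral_add ((kint_integrable hl hρ hr hq A (w, uv)).const_mul _)
    (integrable_finsetSum _ fun j _ => integrable_finsetSum _ fun l _ => integrable_finsetSum _ fun l' _ => hi j l l')]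
  rw [integral_const_mul, integral_finsetSum _ fun j _ => integrable_finsetSum _ fun l _ => integrable_finsetSum _ fun l' _ => hi j l l']
  congr 1
  refine Finset.sum_congr rfl fun j _ => ?_
  rw [integral_finsetSum _ fun l _ => integrable_finsetSum _ fun l' _ => hi j l l']
  refine Finset.sum_congr rfl fun l _ => ?_
  rw [integral_finsetSum _ fun l' _ => hi j l l']
  refine Finset.sum_congr rfl fun l' _ => ?_
  rw [integral_const_mul]
  rfl

lemma G2_kap (h : ℕ) (hh : h ≤ r) {g : Adm d lam ρ → Pt d → ℝ} (hg : Cb (idx d lam ρ) h g)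
    {q : Pt d → Om d n → ℝ} (hq : QOK lam ρ q) :
    G2 (idx d lam ρ) (lam/4) r h (fun A p w => g A w * fz (kap q) A p w) := by
  have hgood : ∀ {g : Adm d lam ρ → Pt d → ℝ} (_ : Base (idx d lam ρ) (trivWt (Pt d)) 0 (fun A p _ => g A p))
      {q : Pt d → Om d n → ℝ} (_ : QOK lam ρ q),
      Good (idx d lam ρ) (Wv d (Pt d)) (lam/4) r (fun A p w => g A w * fz (kap q) A p w) := by
    intro g hg q hq
    have h1 : Base (idx d lam ρ) (Wv d (Pt d)) 0 (fun A _ w => g A w) :=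
      Base.comp hg (x := fun _ w => w) (fun _ => continuous_const) (fun _ => measurable_id)
    exact (Good.param h1).mul0 (good_kap hl hρ hr hq).freeze
  induction h generalizing g q with
  | zero => exact hgood hg hq
  | succ h ih =>
    have hgd : ∀ A, Differentiable ℝ (g A) := fun A => hg.2.1 A ()
    have hkd : ∀ A p, Differentiable ℝ (fun w => fz (kap q) A p w) := fun A p => (pd_kap hl hρ hr hq A p.2).1
    refine ⟨hgood hg.1 hq, fun A p => (hgd A).mul (hkd A p), fun i => ?_⟩
    have hg' : Cb (idx d lam ρ) h g := Good.of_succ hg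
    have hpg : Cb (idx d lam ρ) h (pdF i g) := hg.2.2 (Pi.single i 1)
    have hLD : Cb (idx d lam ρ) h (pdF i LD) :=
      (Good.of_le (Cb_LD (ρ := ρ) hl hρ hr) hh).2.2 (Pi.single i 1)
    have hAI : ∀ l l', Cb (idx d lam ρ) h (pdF i (AI l l')) := fun l l' =>
      (Good.of_le (JetGood_AI (ρ := ρ) hl hρ hr l l').j0.1 hh).2.2 (Pi.single i 1)
    have e : wd i (fun A p w => g A w * fz (kap q) A p w) = fun A p w =>
        (pdF i g A w * fz (kap q) A p w + (g A w * (-1/2 * (n+1) * pdF i LD A w)) * fz (kap q) A p w) +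
        ∑ j, ∑ l, ∑ l', (g A w * (-1/4 * pdF i (AI l l') A w)) * fz (kap (qxx j l l' q)) A p w := by
      funext A p w
      have h1 : pd i (fun w => g A w * fz (kap q) A p w) w = g A w * pd i (fun w => fz (kap q) A p w) w +
          fz (kap q) A p w * pd i (g A) w := by
        unfold pd
        have : fderiv ℝ (fun w => g A w * fz (kap q) A p w) w = _ := ((hgd A w).hasFDerivAt.fun_mul (hkd A p w).hasFDerivAt).fderiv
        rw [this]; rfl
      have h2 := (pd_kap hl hρ hr hq A p.2).2 i w
      change pd i (fun w => g A w * fz (kap q) A p w) w = _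
      rw [h1]
      change g A w * pd i (fun w => kap q A (w, p.2)) w + _ = _
      rw [h2]
      simp only [fz, mul_add, Finset.mul_sum, mul_assoc]
      change _ + _ * pdF i g A w = _
      ring
    rw [e]
    refine ((ih (by omega) hpg hq).add (ih (by omega) (g := fun A w => g A w * (-1/2 * (n+1) * pdF i LD A w)) ?_ hq)).add ?_
    · exact hg'.mul0 (hLD.cmul (-1/2 * (n+1)))
    · refine G2.sum _ fun j _ => G2.sum _ fun l _ => G2.sum _ fun l' _ => ?_
      exact ih (by omega) (g := fun A w => g A w * (-1/4 * pdF i (AI l l') A w)) (hg'.mul0 ((hAI l l').cmul (-1/4))) (hq.qxx j l l')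

end kap

/-! ## Part 9: the building blocks of `Λ_r` -/

section atom
variable {n : ℕ} {lam : ℝ} {ρ r : ℕ}

lemma good_dl (j : Fin (n+1)) (k : Fin (d+1)) (s : ℕ) :
    Good (idx d lam ρ) (chn d n).W 0 s (fun _ p ω => (chn d n).dl j k p ω) := by
  refine Fin.cases ?_ (fun l => ?_) k
  · exact (chn d n).good_U j
  · exact (chn d n).good_ξ j l

lemma good_evalQ (j : Fin (n+1)) (Q : MvPolynomial (Fin (d+1)) ℝ) (s : ℕ) :
    Good (idx d lam ρ) (chn d n).W 0 s (fun _ p ω => MvPolynomial.eval (fun k => (chn d n).dl j k p ω) Q) := by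
  induction Q using MvPolynomial.induction_on with
  | C a => simpa using Good.const a
  | add p q hp hq => simpa using hp.add hq
  | mul_X p i hp => simpa using hp.mul0 (good_dl j i s)

/-- the polynomial weight of a block, without the constants -/
noncomputable def q0 (Q : Fin (n+1) → MvPolynomial (Fin (d+1)) ℝ) (uv : Pt d) (ω : Om d n) : ℝ :=
  (chn d n).σ 0 ω * ∏ j, MvPolynomial.eval (fun k => (chn d n).dl j k (0, uv) ω) (Q j)

/-- the polynomial weight of a block -/
noncomputable def qm (Q : Fin (n+1) → MvPolynomial (Fin (d+1)) ℝ) (uv : Pt d) (ω : Om d n) : ℝ :=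
  (c0 d ^ (n+1) * uv 0 ^ n) * q0 Q uv ω

lemma QOK_q0 (Q : Fin (n+1) → MvPolynomial (Fin (d+1)) ℝ) : QOK lam ρ (q0 Q) := fun s =>
  ((chn d n).good_σ 0).mul0 (Good.prod Finset.univ fun j _ => good_evalQ j (Q j) s)

lemma QOK_qm (Q : Fin (n+1) → MvPolynomial (Fin (d+1)) ℝ) : QOK lam ρ (qm Q) := fun s =>
  ((((chn d n).good_coord 0).pow n).cmul (c0 d ^ (n+1))).mul0 (QOK_q0 Q s)

lemma kap_qm (Q : Fin (n+1) → MvPolynomial (Fin (d+1)) ℝ) (A : Adm d lam ρ) (p : Pt d × Pt d) :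
    kap (qm Q) A p = (c0 d ^ (n+1) * p.2 0 ^ n) * kap (q0 Q) A p := by
  unfold kap
  rw [← integral_const_mul]
  refine integral_congr_ae (ae_of_all _ fun ω => ?_)
  simp only [kint, qm]; ring

/-- the polynomials of the block in the normalization of `Λ_r` -/
noncomputable def Qx (Q : Fin (n+1) → MvPolynomial (Fin (d+1)) ℝ) (j : Fin (n+1)) : MvPolynomial (Fin (d+1)) ℝ :=
  if j = 0 then MvPolynomial.X 0 * Q 0 else Q j

lemma prod_Qx (Q : Fin (n+1) → MvPolynomial (Fin (d+1)) ℝ) (p : Pt d × Pt d) (ω : Om d n) :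
    ∏ j, MvPolynomial.eval (fun k => (chn d n).dl j k p ω) (Qx Q j) = p.2 0 * q0 Q p.2 ω := by
  have h1 : ∀ j k, (chn d n).dl j k (0, p.2) ω = (chn d n).dl j k p ω := fun _ _ => rfl
  simp only [q0, h1]
  rw [Fin.prod_univ_succ, Fin.prod_univ_succ]
  have h2 : ∀ j : Fin n, Qx Q j.succ = Q j.succ := fun j => by simp [Qx, Fin.succ_ne_zero]
  have h3 : Qx Q 0 = MvPolynomial.X 0 * Q 0 := by simp [Qx]
  have h4 : (chn d n).dl 0 0 p ω = p.2 0 * (chn d n).σ 0 ω := rfl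
  simp only [h2, h3, map_mul, MvPolynomial.eval_X, h4]
  ring

lemma ratKer_chn (Q : MvPolynomial (Fin (d+1)) ℝ) (j : Fin (n+1)) (p : Pt d × Pt d) (ω : Om d n) (hu : 0 < p.2 0) :
    ratKer Q ((chn d n).Δ j p ω) = ((chn d n).U j p ω)⁻¹ * MvPolynomial.eval (fun k => (chn d n).dl j k p ω) Q := by
  have hU : 0 < (chn d n).U j p ω := mul_pos hu (sg_pos ω.2 j)
  unfold ratKer
  rw [if_pos (by rw [Δ_zero]; positivity)]
  simp only [Δ_zero, Δ_succ, Real.sqrt_sq hU.le, mul_div_cancel_left₀ _ hU.ne']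
  rfl

lemma Wker_neg (A : Coeffs d) (w z : Pt d) (h : z 0 ≤ 0) : Wker A w z = 0 := by
  unfold Wker; rw [if_neg (not_lt.2 h)]

lemma atom_pos [Nonempty (Adm d lam ρ)] (hl : 0 < lam) (hρ : 3 * r ≤ ρ) (hr : 2 < r)
    (Q : Fin (n+1) → MvPolynomial (Fin (d+1)) ℝ) (P : MvPolynomial ((Fin (d + 1) → ℕ) × CoeffVar d) ℝ)
    (A : Adm d lam ρ) (w ζ : Pt d) (h : 0 < ζ 0) :
    lambdaAtom A.1 P n (Qx Q) w ζ =
      (uvc ζ 0 ^ d)⁻¹ * (MvPolynomial.eval (coeffEval A.1 w) P * kap (qm Q) A (w, uvc ζ)) := by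
  have hu := uvc_pos h
  have hζ := psi_uvc h
  set uv := uvc ζ with huv
  unfold lambdaAtom
  have hA : ∀ ω : Om d n, (fun y : Fin n → Pt d => ∏ i, (ratKer (Qx Q i) (chainDiff ζ y i) * Wker A.1 w (chainDiff ζ y i)))
      (fun i => psi uv (ω.1 i)) = (c0 d ^ (n+1) * ((uv 0 ^ (d+1)) ^ (n+1))⁻¹ * uv 0) * dens ω.1 * kint (q0 Q) A (w, uv) ω := by
    intro ω
    dsimp only
    rw [← hζ]
    simp only [chainDiff_psi]
    have e1 : ∀ j, psi uv (chainDiff e0 ω.1 j) = (chn d n).Δ j (w, uv) ω := fun j => (chn_Δ j (w, uv) ω).symm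
    simp only [e1]
    have e2 : ∀ j, ratKer (Qx Q j) ((chn d n).Δ j (w, uv) ω) * Wker A.1 w ((chn d n).Δ j (w, uv) ω) =
        (c0 d * ((chn d n).U j (w, uv) ω ^ (d+1))⁻¹) * (MvPolynomial.eval (fun k => (chn d n).dl j k (w, uv) ω) (Qx Q j) *
          Real.exp (-(chn d n).qat j A w (w, uv) ω)) := by
      intro j
      rw [ratKer_chn _ j (w, uv) ω hu, Wker_chn hl A w j (w, uv) ω hu, pow_succ, mul_inv]; ring
    simp only [e2]
    rw [Finset.prod_mul_distrib, prod_U, Finset.prod_mul_distrib, prod_Qx, ← Real.exp_sum, Finset.sum_neg_distrib]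
    simp only [kint, Chain.QW]
    ring
  have hB : ∀ ω : Fin n → Pt d, ω ∉ Sset d n →
      (fun y : Fin n → Pt d => ∏ i, (ratKer (Qx Q i) (chainDiff ζ y i) * Wker A.1 w (chainDiff ζ y i)))
      (fun i => psi uv (ω i)) = 0 := by
    intro ω hω
    obtain ⟨j, hj⟩ := chn_notMem (p := (w, uv)) hu hω
    refine Finset.prod_eq_zero (Finset.mem_univ j) ?_
    rw [← hζ, chainDiff_psi, Wker_neg _ _ _ hj, mul_zero]
  have h2 := (cov hu (fun y : Fin n → Pt d => ∏ i, (ratKer (Qx Q i) (chainDiff ζ y i) * Wker A.1 w (chainDiff ζ y i))) _ _ hA hB (kint_integrable hl hρ hr (QOK_q0 Q) A (w, uv))).2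
  rw [h2, pow_count hu, kap_qm]
  simp only [kap]
  ring

lemma atom_neg (Q : Fin (n+1) → MvPolynomial (Fin (d+1)) ℝ) (P : MvPolynomial ((Fin (d + 1) → ℕ) × CoeffVar d) ℝ)
    (A : Coeffs d) (w ζ : Pt d) (h : ζ 0 ≤ 0) : lambdaAtom A P n Q w ζ = 0 := by
  unfold lambdaAtom
  have : ∀ y : Fin n → Pt d, ∏ i, (ratKer (Q i) (chainDiff ζ y i) * Wker A w (chainDiff ζ y i)) = 0 := by
    intro y
    by_contra hne
    have hp : ∀ i, 0 < chainDiff ζ y i 0 := by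
      intro i
      by_contra hi
      exact hne (Finset.prod_eq_zero (Finset.mem_univ i) (by rw [Wker_neg _ _ _ (not_lt.1 hi), mul_zero]))
    have h1 : 0 < ∑ i, chainDiff ζ y i 0 := Finset.sum_pos (fun i _ => hp i) Finset.univ_nonempty
    have h2 := congrFun (sum_chainDiff ζ y) 0
    rw [Finset.sum_apply] at h2
    linarith
  simp [this]

end atom

/-! ## Part 10: conclusion -/

lemma exists_KR {lam : ℝ} {ρ r : ℕ} [Nonempty (Adm d lam ρ)] (hl : 0 < lam) (hρ : 3 * r ≤ ρ) (hr : 2 < r) (n : ℕ) :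
    ∃ (M : ℕ) (p : Fin M → MvPolynomial ((Fin (d + 1) → ℕ) × CoeffVar d) ℝ)
      (Q : Fin M → Fin (n + 1) → MvPolynomial (Fin (d + 1)) ℝ)
      (X : Adm d lam ρ → Pt d × Pt d → Pt d → ℝ) (FR : Adm d lam ρ → Pt d × Pt d → Unit → ℝ),
      (∀ m : Fin M, ∀ mo ∈ (p m).support, ∀ v ∈ mo.support, pdeg v.1 ≤ r) ∧
      G2 (idx d lam ρ) (lam/4) r r X ∧ Good (idx d lam ρ) (Wv d Unit) (lam/4) r FR ∧
      (∀ (A : Adm d lam ρ) (w ζ x : Pt d), ∑ m, lambdaAtom A.1 (p m) n (Q m) w ζ =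
        if 0 < ζ 0 then (uvc ζ 0 ^ d)⁻¹ * X A (x, uvc ζ) w else 0) ∧
      (∀ (A : Adm d lam ρ) (z zb : Pt d), volterra A.1 n z zb - ∑ m, lambdaAtom A.1 (p m) n (Q m) zb (z - zb) =
        if zb 0 < z 0 then (uvc (z - zb) 0 ^ d)⁻¹ * uvc (z - zb) 0 ^ (r-2) * FR A (zb, uvc (z - zb)) () else 0) := by
  obtain ⟨P, fR, hP, hR, hG, hdec⟩ := exists_decomp hl hρ hr (C := chn d n)
  obtain ⟨ι, _, g', Q', hg', hrep'⟩ := KT_repr hP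
  let e := Fintype.equivFin ι
  obtain ⟨M, g, Q, hg, hrep⟩ : ∃ (M : ℕ) (g : Fin M → Adm d lam ρ → Pt d → ℝ)
      (Q : Fin M → Fin (n+1) → MvPolynomial (Fin (d+1)) ℝ), (∀ m, J0 r (g m)) ∧
      ∀ A p ω, P A p ω = ∑ m, g m A p.1 * ∏ j, MvPolynomial.eval (fun k => (chn d n).dl j k p ω) (Q m j) := by
    refine ⟨Fintype.card ι, fun m => g' (e.symm m), fun m => Q' (e.symm m), fun m => hg' _, fun A p ω => ?_⟩
    rw [hrep', ← Equiv.sum_comp e.symm]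
  clear_value e
  choose p hp1 hp2 using fun m => JetAlg_poly (hg m).2
  have hl4 : 0 < lam / 4 := by positivity
  have hσR : Good (idx d lam ρ) (chn d n).W (lam/4) r (fun A p ω => (chn d n).σ 0 ω * fR A p ω) :=
    ((chn d n).good_σ 0).mul0 hR
  have hitg : Good (idx d lam ρ) (Wv d Unit) (lam/4) r
      (fun A p _ => ∫ ω, (chn d n).σ 0 ω * fR A p ω ∂(mu d n)) :=
    (fibS d n (ε := lam/4) hl4).good hσR
  have hatom : ∀ (A : Adm d lam ρ) (w ζ x : Pt d), ∑ m, lambdaAtom A.1 (p m) n (Qx (Q m)) w ζ =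
        if 0 < ζ 0 then (uvc ζ 0 ^ d)⁻¹ * ∑ m, g m A w * fz (kap (qm (Q m))) A (x, uvc ζ) w else 0 := by
    intro A w ζ x
    split_ifs with h
    · rw [Finset.mul_sum]
      refine Finset.sum_congr rfl fun m _ => ?_
      rw [atom_pos hl hρ hr _ _ A w ζ h, ← hp2]; rfl
    · exact Finset.sum_eq_zero fun m _ => atom_neg _ _ _ _ _ (not_lt.1 h)
  refine ⟨M, p, fun m => Qx (Q m), fun A p w => ∑ m, g m A w * fz (kap (qm (Q m))) A p w,
    fun A p _ => c0 d ^ (n+1) * ∫ ω, (chn d n).σ 0 ω * fR A p ω ∂(mu d n), hp1, ?_, hitg.cmul _, hatom, ?_⟩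
  · exact G2.sum _ fun m _ => G2_kap hl hρ hr r le_rfl (hg m).1 (QOK_qm (Q m))
  · intro A z zb
    rw [hatom A zb (z - zb) zb]
    have hiff : 0 < (z - zb) 0 ↔ zb 0 < z 0 := by simp
    simp only [hiff]
    split_ifs with h
    · rw [volterra_pos hl hρ hr A z zb h]
      set uv := uvc (z - zb)
      have hI1 : ∀ m, Integrable (fun ω => g m A zb * kint (q0 (Q m)) A (zb, uv) ω) (mu d n) := fun m =>
        (kint_integrable hl hρ hr (QOK_q0 (Q m)) A (zb, uv)).const_mul _
      have hI2 : Integrable (fun ω => (chn d n).σ 0 ω * fR A (zb, uv) ω) (mu d n) :=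
        (fibS d n (ε := lam/4) hl4).integrable hσR.base A (zb, uv) ()
      have key : uv 0 ^ n * ∫ ω, gF n A (zb, uv) ω ∂(mu d n) =
          uv 0 ^ n * ∑ m, g m A zb * kap (q0 (Q m)) A (zb, uv) +
            uv 0 ^ (r-2) * ∫ ω, (chn d n).σ 0 ω * fR A (zb, uv) ω ∂(mu d n) := by
        have h1 : ∑ m, g m A zb * kap (q0 (Q m)) A (zb, uv) =
            ∫ ω, ∑ m, g m A zb * kint (q0 (Q m)) A (zb, uv) ω ∂(mu d n) := by
          rw [integral_finsetSum _ fun m _ => hI1 m]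
          refine Finset.sum_congr rfl fun m _ => ?_
          rw [integral_const_mul]; rfl
        rw [h1, ← integral_const_mul, ← integral_const_mul, ← integral_const_mul,
          ← integral_add ((integrable_finsetSum _ fun m _ => hI1 m).const_mul _) (hI2.const_mul _)]
        refine integral_congr_ae (ae_of_all _ fun ω => ?_)
        have h2 := hdec A (zb, uv) ω
        have h3 := hrep A (zb, uv) ω
        have h4 : ∑ m, g m A zb * kint (q0 (Q m)) A (zb, uv) ω =
            (chn d n).σ 0 ω * P A (zb, uv) ω * Real.exp (-(chn d n).QW A (zb, uv) ω) := by
          rw [h3, Finset.mul_sum, Finset.sum_mul]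
          refine Finset.sum_congr rfl fun m _ => ?_
          simp only [kint, q0]
          have h5 : ∀ j k, (chn d n).dl j k (0, uv) ω = (chn d n).dl j k (zb, uv) ω := fun _ _ => rfl
          simp only [h5]
          ring
        simp only [h4, gF]
        simp only at h2
        linear_combination (chn d n).σ 0 ω * h2
      have h6 : ∑ m, g m A zb * fz (kap (qm (Q m))) A (zb, uv) zb =
          (c0 d ^ (n+1) * uv 0 ^ n) * ∑ m, g m A zb * kap (q0 (Q m)) A (zb, uv) := by
        rw [Finset.mul_sum]
        refine Finset.sum_congr rfl fun m _ => ?_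
        simp only [fz, kap_qm]; ring
      rw [h6]
      linear_combination (uv 0 ^ d)⁻¹ * c0 d ^ (n+1) * key
    · rw [volterra_neg hl hρ hr A z zb (not_lt.1 h), sub_zero]

lemma psiNorm_le {α : ℝ} {r : ℕ} {T : ℝ} {nn : ℕ} {F Ft : Pt d → Pt d → ℝ} {C : ℝ} (h1 : PsiRep α Ft F) (h2 : PsiSmooth r Ft)
    (hC : 0 ≤ C) (h3 : ∀ y ∈ psiSet r T nn Ft, y ≤ C) : psiNorm α r T nn F ≤ C := by
  have hn : ∀ Ft : Pt d → Pt d → ℝ, 0 ≤ sSup (psiSet r T nn Ft) := by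
    intro Ft
    refine Real.sSup_nonneg ?_
    rintro y ⟨j, m, w, uv, -, -, -, rfl⟩
    positivity
  unfold psiNorm
  refine le_trans (csInf_le ⟨0, ?_⟩ ?_) (Real.sSup_le h3 hC)
  swap
  · exact ⟨Ft, h1, h2, ⟨C, h3⟩, rfl⟩
  rintro y ⟨Ft, -, -, -, rfl⟩
  exact hn Ft

lemma pd_const_mul (c : ℝ) (i : Fin (d+1)) (f : Pt d → ℝ) : pd i (fun w => c * f w) = fun w => c * pd i f w := by
  funext w
  unfold pd
  have : fderiv ℝ (fun w => c * f w) w = c • fderiv ℝ f w :=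
    congrFun (fderiv_const_smul_field (𝕜 := ℝ) (f := f) c) w
  rw [this]; rfl

lemma mderiv_const_mul (c : ℝ) (m : Fin (d+1) → ℕ) (f : Pt d → ℝ) :
    mderiv m (fun w => c * f w) = fun w => c * mderiv m f w :=
  (foldr_iter_semiconj (fun f : Pt d → ℝ => fun w => c * f w) pd pd (fun i f => (pd_const_mul c i f).symm) m _ f).symm

lemma rpow_aux {t : ℝ} (ht : 0 < t) (k : ℕ) (hk : 2 ≤ k) :
    t ^ (((k:ℝ) - d - 2) / 2) = (Real.sqrt t ^ d)⁻¹ * Real.sqrt t ^ (k-2) := by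
  have hs := Real.sqrt_pos.2 ht
  have h1 : ((k:ℝ) - d - 2) / 2 = (1/2) * (((k - 2 : ℕ) : ℝ) - (d:ℝ)) := by
    push_cast [Nat.cast_sub hk]; ring
  rw [h1, Real.rpow_mul ht.le, ← Real.sqrt_eq_rpow, Real.rpow_sub hs, Real.rpow_natCast, Real.rpow_natCast]
  field_simp

section fam
variable {r : ℕ} {Kf : Pt d → Pt d → ℝ} {Y : Pt d × Pt d → Pt d → ℝ}
  (hK : ∀ w ζ x, Kf w ζ = if 0 < ζ 0 then (uvc ζ 0 ^ d)⁻¹ * Y (x, uvc ζ) w else 0)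
  (hdiff : ∀ m, pdeg m < r → ∀ p, Differentiable ℝ (mderiv m (Y p)))
  (hsm : ∀ m, pdeg m ≤ r → ∀ w, PsiSmooth r (fun x uv => mderiv m (Y (x, uv)) w))

include hK in
lemma famDeriv_K (m : Fin (d+1) → ℕ) (w z zb : Pt d) :
    famDeriv m (fun w z zb => Kf w (z - zb)) w z zb =
      if zb 0 < z 0 then (uvc (z - zb) 0 ^ d)⁻¹ * mderiv m (Y (zb, uvc (z - zb))) w else 0 := by
  unfold famDeriv
  have hiff : 0 < (z - zb) 0 ↔ zb 0 < z 0 := by simp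
  simp only [fun w => hK w (z - zb) zb, hiff]
  split_ifs with h
  · rw [mderiv_const_mul]
  · have := congrFun (mderiv_const_mul 0 m (fun _ : Pt d => (0:ℝ))) w
    simpa using this

include hK in
lemma rep_K (m : Fin (d+1) → ℕ) (w : Pt d) :
    PsiRep 2 (fun x uv => mderiv m (Y (x, uv)) w) (famDeriv m (fun w z zb => Kf w (z - zb)) w) := by
  intro z zb
  rw [famDeriv_K hK]
  split_ifs with h
  · have := rpow_aux (d := d) (sub_pos.2 h) 2 le_rfl
    rw [Nat.cast_ofNat] at this
    rw [this]
    simp only [Nat.sub_self, pow_zero, mul_one]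
    rfl
  · rfl

include hK hdiff hsm in
lemma memCPhi_K (hb : ∀ T : ℝ, 0 < T → ∀ nn : ℕ, ∃ C : ℝ, 0 ≤ C ∧ ∀ m, pdeg m ≤ r → ∀ w,
      ∀ y ∈ psiSet r T nn (fun x uv => mderiv m (Y (x, uv)) w), y ≤ C) :
    MemCPhi r 2 r (fun w z zb => Kf w (z - zb)) := by
  refine ⟨⟨fun m hm z zb => ?_, fun m hm w => ?_, fun T hT nn => ?_⟩, fun w z zb h => ?_⟩
  · simp only [famDeriv_K hK]
    split_ifs with h
    · exact (hdiff m hm _).const_mul _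
    · exact differentiable_const _
  · refine ⟨_, rep_K hK m w, hsm m hm w, fun T hT nn => ?_⟩
    obtain ⟨C, -, h⟩ := hb T hT nn
    exact ⟨C, h m hm w⟩
  · obtain ⟨C, hC, h⟩ := hb T hT nn
    refine ⟨C, ?_⟩
    rintro y ⟨m, w, hm, rfl⟩
    exact psiNorm_le (rep_K hK m w) (hsm m hm w) hC (h m hm w)
  · simp only [add_sub_add_right_eq_sub]

include hK hsm in
lemma cpsiNorm_K {T : ℝ} {nn : ℕ} {C : ℝ} (hC : 0 ≤ C) (hb : ∀ m, pdeg m ≤ r → ∀ w,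
      ∀ y ∈ psiSet r T nn (fun x uv => mderiv m (Y (x, uv)) w), y ≤ C) :
    cpsiNorm r 2 r T nn (fun w z zb => Kf w (z - zb)) ≤ C := by
  refine Real.sSup_le ?_ hC
  rintro y ⟨m, w, hm, rfl⟩
  exact psiNorm_le (rep_K hK m w) (hsm m hm w) hC (hb m hm w)

end fam

lemma rep_R {r : ℕ} (hr : 2 < r) {F G : Pt d → Pt d → ℝ}
    (h : ∀ z zb, F z zb = if zb 0 < z 0 then (uvc (z - zb) 0 ^ d)⁻¹ * uvc (z - zb) 0 ^ (r-2) * G zb (uvc (z - zb)) else 0) :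
    PsiRep (r:ℝ) G F := by
  intro z zb
  rw [h]
  split_ifs with h
  · rw [rpow_aux (sub_pos.2 h) r hr.le]
    rfl
  · rfl

lemma volterra_main {lam : ℝ} {ρ r : ℕ} [Nonempty (Adm d lam ρ)] (hl : 0 < lam) (hρ : 3 * r ≤ ρ) (hr : 2 < r) (n : ℕ) :
    ∃ (Kn Rn : Coeffs d → Pt d → Pt d → ℝ),
      (∀ A : Coeffs d, ParReg lam ρ A →
        (∀ z zb : Pt d, volterra A n z zb = Kn A zb (z - zb) + Rn A z zb) ∧
        MemCPhi r 2 r (fun w z zb => Kn A w (z - zb)) ∧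
        MemLambda A r (Kn A) ∧
        MemPsi (r : ℝ) r (Rn A)) ∧
      ∀ A : Coeffs d, ParReg lam ρ A → ∀ T : ℝ, 0 < T → ∀ (nn : ℕ) (ε : ℝ), 0 < ε →
        ∃ δ : ℝ, 0 < δ ∧ ∀ A' : Coeffs d, ParReg lam ρ A' → coeffDist ρ A A' ≤ δ →
          (MemCPhi r 2 r (fun w z zb => Kn A w (z - zb) - Kn A' w (z - zb)) ∧
            cpsiNorm r 2 r T nn (fun w z zb => Kn A w (z - zb) - Kn A' w (z - zb)) ≤ ε) ∧
          (MemPsi (r : ℝ) r (fun z zb => Rn A z zb - Rn A' z zb) ∧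
            psiNorm (r : ℝ) r T nn (fun z zb => Rn A z zb - Rn A' z zb) ≤ ε) := by
  obtain ⟨M, p, Q, X, FR, hp, hX, hFR, hKe, hRe⟩ := exists_KR (d := d) hl hρ hr n
  have hl4 : 0 < lam / 4 := by positivity
  have hfw : ∀ m, pdeg m < r → ∀ A p, Differentiable ℝ (fw m X A p) := fun m hm A p => by
    have := sum_le_pdeg m
    exact (hX.fw m 1 (by omega)).2.1 A p
  have hgood : ∀ m, pdeg m ≤ r → Good (idx d lam ρ) (Wv d (Pt d)) (lam/4) r (fw m X) := fun m hm => by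
    have := sum_le_pdeg m
    exact (hX.fw m 0 (by omega)).good
  refine ⟨fun A w ζ => ∑ m, lambdaAtom A (p m) n (Q m) w ζ,
    fun A z zb => volterra A n z zb - ∑ m, lambdaAtom A (p m) n (Q m) zb (z - zb), ?_, ?_⟩
  · intro A hA
    refine ⟨fun z zb => by ring, ?_, ⟨M, p, fun _ => n, Q, hp, fun w ζ => rfl⟩, ?_⟩
    · refine memCPhi_K (Y := X ⟨A, hA⟩) (fun w ζ x => hKe ⟨A, hA⟩ w ζ x) (fun m hm p => ?_) (fun m hm w => ?_) (fun T _ nn => ?_)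
      · rw [fw_eq]; exact hfw m hm _ _
      · simp only [fw_eq]; exact (hgood m hm).psiSmooth _ _
      · obtain ⟨C, hC, h⟩ := hX.psiBound hl4 ((idx d lam ρ).N ⟨A, hA⟩) T nn
        refine ⟨C, hC, fun m hm w => ?_⟩
        simp only [fw_eq]
        exact (h m hm ⟨A, hA⟩ ⟨A, hA⟩ le_rfl le_rfl w).1
    · refine ⟨fun w uv => FR ⟨A, hA⟩ (w, uv) (), rep_R hr fun z zb => hRe ⟨A, hA⟩ z zb, hFR.psiSmooth _ _, fun T _ nn => ?_⟩
      obtain ⟨C, hC, h⟩ := hFR.psiBound hl4 ((idx d lam ρ).N ⟨A, hA⟩) T nn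
      exact ⟨C, (h ⟨A, hA⟩ ⟨A, hA⟩ le_rfl le_rfl ()).1⟩
  · intro A hA T hT nn ε hε
    set M0 : ℝ := (idx d lam ρ).N ⟨A, hA⟩ + Fintype.card (Cmp d) with hM0
    obtain ⟨C1, hC1, hb1⟩ := hX.psiBound hl4 M0 T nn
    obtain ⟨C2, hC2, hb2⟩ := hFR.psiBound hl4 M0 T nn
    have hpos : 0 < C1 + C2 + 1 := by positivity
    refine ⟨min 1 (ε / (C1 + C2 + 1)), by positivity, fun A' hA' hdist => ?_⟩
    have hd1 : coeffDist ρ A A' ≤ 1 := hdist.trans (min_le_left _ _)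
    have hd2 : coeffDist ρ A A' ≤ ε / (C1 + C2 + 1) := hdist.trans (min_le_right _ _)
    have hd0 : 0 ≤ coeffDist ρ A A' := coeffDist_nonneg ρ A A'
    have hNA : (idx d lam ρ).N ⟨A, hA⟩ ≤ M0 := by
      rw [hM0]; exact le_add_of_nonneg_right (Nat.cast_nonneg _)
    have hNA' : (idx d lam ρ).N ⟨A', hA'⟩ ≤ M0 := by
      refine (idx_N_le ⟨A, hA⟩ ⟨A', hA'⟩).trans ?_
      rw [hM0]
      have : (Fintype.card (Cmp d) : ℝ) * coeffDist ρ A A' ≤ Fintype.card (Cmp d) * 1 :=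
        mul_le_mul_of_nonneg_left hd1 (Nat.cast_nonneg _)
      simp only
      linarith
    have hC : ∀ C, 0 ≤ C → C ≤ C1 + C2 → C * coeffDist ρ A A' ≤ ε := by
      intro C h0 h1
      rw [le_div_iff₀ hpos] at hd2
      nlinarith
    have hKd : ∀ w ζ x, (∑ m, lambdaAtom A (p m) n (Q m) w ζ) - (∑ m, lambdaAtom A' (p m) n (Q m) w ζ) =
        if 0 < ζ 0 then (uvc ζ 0 ^ d)⁻¹ * (fun p w => X ⟨A, hA⟩ p w - X ⟨A', hA'⟩ p w) (x, uvc ζ) w else 0 := by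
      intro w ζ x
      have h1 := hKe ⟨A, hA⟩ w ζ x
      have h2 := hKe ⟨A', hA'⟩ w ζ x
      simp only at h1 h2
      rw [h1, h2]
      split_ifs
      · ring
      · ring
    have hmd : ∀ m, pdeg m ≤ r → ∀ p w, mderiv m ((fun p w => X ⟨A, hA⟩ p w - X ⟨A', hA'⟩ p w) p) w =
        fw m X ⟨A, hA⟩ p w - fw m X ⟨A', hA'⟩ p w := fun m hm p w =>
      hX.fw_sub m ((sum_le_pdeg m).trans hm) _ _ p w
    have hsm : ∀ m, pdeg m ≤ r → ∀ w, PsiSmooth r (fun x uv => mderiv m ((fun p w => X ⟨A, hA⟩ p w - X ⟨A', hA'⟩ p w) (x, uv)) w) := by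
      intro m hm w
      simp only [fun p w => hmd m hm p w]
      exact (hgood m hm).psiSmooth_sub _ _ _
    refine ⟨⟨?_, ?_⟩, ?_⟩
    · refine memCPhi_K (Y := fun p w => X ⟨A, hA⟩ p w - X ⟨A', hA'⟩ p w) (Kf := fun w ζ => (∑ m, lambdaAtom A (p m) n (Q m) w ζ) - (∑ m, lambdaAtom A' (p m) n (Q m) w ζ)) hKd (fun m hm p => ?_) hsm (fun T _ nn => ?_)
      · have : mderiv m ((fun p w => X ⟨A, hA⟩ p w - X ⟨A', hA'⟩ p w) p) =
            fun w => fw m X ⟨A, hA⟩ p w - fw m X ⟨A', hA'⟩ p w := funext fun w => hmd m hm.le p w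
        rw [this]
        exact (hfw m hm _ _).sub (hfw m hm _ _)
      · obtain ⟨C, hC, h⟩ := hX.psiBound hl4 M0 T nn
        refine ⟨C * coeffDist ρ A A', mul_nonneg hC hd0, fun m hm w => ?_⟩
        simp only [fun p w => hmd m hm p w]
        exact (h m hm ⟨A, hA⟩ ⟨A', hA'⟩ hNA hNA' w).2
    · refine cpsiNorm_K (Y := fun p w => X ⟨A, hA⟩ p w - X ⟨A', hA'⟩ p w) (Kf := fun w ζ => (∑ m, lambdaAtom A (p m) n (Q m) w ζ) - (∑ m, lambdaAtom A' (p m) n (Q m) w ζ)) hKd hsm hε.le (fun m hm w y hy => ?_)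
      simp only [fun p w => hmd m hm p w] at hy
      exact ((hb1 m hm ⟨A, hA⟩ ⟨A', hA'⟩ hNA hNA' w).2 y hy).trans (hC C1 hC1 (by linarith))
    · have hrep : PsiRep (r:ℝ) (fun w uv => FR ⟨A, hA⟩ (w, uv) () - FR ⟨A', hA'⟩ (w, uv) ())
          (fun z zb => (volterra A n z zb - ∑ m, lambdaAtom A (p m) n (Q m) zb (z - zb)) -
            (volterra A' n z zb - ∑ m, lambdaAtom A' (p m) n (Q m) zb (z - zb))) := by
        refine rep_R hr fun z zb => ?_
        have h1 := hRe ⟨A, hA⟩ z zb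
        have h2 := hRe ⟨A', hA'⟩ z zb
        simp only at h1 h2
        rw [h1, h2]
        split_ifs
        · ring
        · ring
      have hs := hFR.psiSmooth_sub ⟨A, hA⟩ ⟨A', hA'⟩ ()
      refine ⟨⟨_, hrep, hs, fun T _ nn => ?_⟩, ?_⟩
      · obtain ⟨C, hC, h⟩ := hFR.psiBound hl4 M0 T nn
        exact ⟨_, (h ⟨A, hA⟩ ⟨A', hA'⟩ hNA hNA' ()).2⟩
      · exact psiNorm_le hrep hs hε.le fun y hy =>
          ((hb2 ⟨A, hA⟩ ⟨A', hA'⟩ hNA hNA' ()).2 y hy).trans (hC C2 hC2 (by linarith))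

/-- Decomposition of the terms of the Volterra series.
For `r > 2` and `ρ ≥ 3r`, each term `Z*(−E)^{*n}` can be written as
`K_n^{z̄}(z−z̄) + R_n(z,z̄)` with `K_n ∈ C^r(Φ_r^2) ∩ Λ_r` and `R_n ∈ Ψ_r^r`, and the maps
`𝐀_ρ ∋ (a,b,c) ↦ K_n, R_n` are continuous into the respective spaces. -/
theorem volterra_term_decomposition (d : ℕ) (hd : 1 ≤ d) (lam : ℝ) (hlam : 0 < lam)
    (r : ℕ) (hr : 2 < r) (ρ : ℕ) (hρ : 3 * r ≤ ρ) :
    ∀ n : ℕ, ∃ (Kn Rn : Coeffs d → Pt d → Pt d → ℝ),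
      (∀ A : Coeffs d, ParReg lam ρ A →
        (∀ z zb : Pt d, volterra A n z zb = Kn A zb (z - zb) + Rn A z zb) ∧
        MemCPhi r 2 r (fun w z zb => Kn A w (z - zb)) ∧
        MemLambda A r (Kn A) ∧
        MemPsi (r : ℝ) r (Rn A)) ∧
      ∀ A : Coeffs d, ParReg lam ρ A → ∀ T : ℝ, 0 < T → ∀ (nn : ℕ) (ε : ℝ), 0 < ε →
        ∃ δ : ℝ, 0 < δ ∧ ∀ A' : Coeffs d, ParReg lam ρ A' → coeffDist ρ A A' ≤ δ →
          (MemCPhi r 2 r (fun w z zb => Kn A w (z - zb) - Kn A' w (z - zb)) ∧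
            cpsiNorm r 2 r T nn (fun w z zb => Kn A w (z - zb) - Kn A' w (z - zb)) ≤ ε) ∧
          (MemPsi (r : ℝ) r (fun z zb => Rn A z zb - Rn A' z zb) ∧
            psiNorm (r : ℝ) r T nn (fun z zb => Rn A z zb - Rn A' z zb) ≤ ε) := by
  intro n
  by_cases hne : Nonempty (Adm d lam ρ)
  · exact volterra_main hlam hρ hr n
  · exact ⟨0, 0, fun A hA => absurd ⟨⟨A, hA⟩⟩ hne, fun A hA => absurd ⟨⟨A, hA⟩⟩ hne⟩

end VarBPHZ
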